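/- arXiv:2005.10492 — 6 statements merged into one kernel-verified Lean document; each statement's English description precedes it below -/
import Mathlib

section
/- Consider N agents with dynamics y_i^{(n_i)}(t) = b_i u_i(t), where n_i ≥ 1 and the unknown constants b_i are all nonzero and all of the same sign, communicating over a weight-balanced, strongly connected weighted digraph, with each local cost f_i being l̲-strongly convex with l̄-Lipschitz derivative. Let N̄ : ℝ → ℝ be a smooth function satisfying, with N̄₊(θ) = max{N̄(θ), 0} and N̄₋(θ) = max{−N̄(θ), 0}: lim_{θ→∞} (1/θ)∫₀^θ N̄₊(s)ds = ∞, lim_{θ→∞} (1/θ)∫₀^θ N̄₋(s)ds = ∞, limsup_{θ→∞} (∫₀^θ N̄₊(s)ds)/(∫₀^θ N̄₋(s)ds) = ∞, and limsup_{θ→∞} (∫₀^θ N̄₋(s)ds)/(∫₀^θ N̄₊(s)ds) = ∞. For each i choose constants k_{i1}, …, k_{i,n_i−1} such that λ^{n_i−1} + Σ_{ι=1}^{n_i−1} k_{iι} λ^{ι−1} is Hurwitz, set ζ_i = k_{i1}(y_i − r_i) + Σ_{ι=2}^{n_i−1} k_{iι} ε^{ι−1} y_i^{(ι−1)} + ε^{n_i−1}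 y_i^{(n_i−1)}, and apply the real-time-gradient controller: u_i = N̄(θ_i) ζ_i, θ̇_i = ζ_i², ṙ_i = −α f_i'(y_i) − β Σ_{j=1}^N a_{ij}(r_i − r_j) − Σ_{j=1}^N a_{ij}(v_i − v_j), v̇_i = α β Σ_{j=1}^N a_{ij}(r_i − r_j). Then there exist constants α, β > 0 and ε* > 0 such that for any 0 < ε < ε* and any initial condition, the closed-loop trajectory is well-defined and bounded on [0, ∞) and y_i(t) → y* as t → ∞ for every i = 1,…,N. -/
open Filter

/-- The Laplacian of the weighted digraph with adjacency matrix `A`, applied to `x`. -/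
def digraphLap {N : ℕ} (A : Fin N → Fin N → ℝ) (x : Fin N → ℝ) (i : Fin N) : ℝ :=
  ∑ j, A i j * (x i - x j)

/-- The disagreement energy of `x`. -/
def digraphEnergy {N : ℕ} (A : Fin N → Fin N → ℝ) (x : Fin N → ℝ) : ℝ :=
  ∑ i, ∑ j, A i j * (x i - x j) ^ 2

section Graph

variable {N : ℕ} {A : Fin N → Fin N → ℝ}

lemma digraphEnergy_nonneg (hA : ∀ i j, 0 ≤ A i j) (x : Fin N → ℝ) : 0 ≤ digraphEnergy A x :=
  Finset.sum_nonneg fun i _ => Finset.sum_nonneg fun j _ => mul_nonneg (hA i j) (sq_nonneg _)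

lemma digraphEnergy_transpose (x : Fin N → ℝ) :
    digraphEnergy (fun i j => A j i) x = digraphEnergy A x := by
  unfold digraphEnergy
  rw [Finset.sum_comm]
  refine Finset.sum_congr rfl fun i _ => Finset.sum_congr rfl fun j _ => ?_
  ring

lemma sum_mul_digraphLap (hbal : ∀ i, ∑ j, A i j = ∑ j, A j i) (x z : Fin N → ℝ) :
    ∑ i, x i * digraphLap A z i = ∑ i, z i * digraphLap (fun i j => A j i) x i := by
  unfold digraphLap
  have h1 : ∀ i, x i * ∑ j, A i j * (z i - z j)
      = x i * z i * ∑ j, A i j - ∑ j, A i j * x i * z j := by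
    intro i
    rw [Finset.mul_sum, Finset.mul_sum, ← Finset.sum_sub_distrib]
    exact Finset.sum_congr rfl fun j _ => by ring
  have h2 : ∀ i, z i * ∑ j, A j i * (x i - x j)
      = x i * z i * ∑ j, A j i - ∑ j, A j i * x j * z i := by
    intro i
    rw [Finset.mul_sum, Finset.mul_sum, ← Finset.sum_sub_distrib]
    exact Finset.sum_congr rfl fun j _ => by ring
  simp only [h1, h2, Finset.sum_sub_distrib, hbal]
  rw [Finset.sum_comm (f := fun i j => A i j * x i * z j)]

lemma sum_digraphLap (hbal : ∀ i, ∑ j, A i j = ∑ j, A j i) (z : Fin N → ℝ) :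
    ∑ i, digraphLap A z i = 0 := by
  have h := sum_mul_digraphLap hbal (fun _ => 1) z
  simpa [digraphLap] using h

lemma sum_mul_digraphLap_self (hbal : ∀ i, ∑ j, A i j = ∑ j, A j i) (x : Fin N → ℝ) :
    ∑ i, x i * digraphLap A x i = digraphEnergy A x / 2 := by
  have h := sum_mul_digraphLap hbal x x
  have h3 : ∑ i, x i * digraphLap A x i + ∑ i, x i * digraphLap (fun i j => A j i) x i
      = digraphEnergy A x := by
    unfold digraphLap digraphEnergy
    simp only [Finset.mul_sum]
    rw [Finset.sum_comm (f := fun i j => x i * (A j i * (x i - x j))),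
      ← Finset.sum_add_distrib]
    refine Finset.sum_congr rfl fun i _ => ?_
    rw [← Finset.sum_add_distrib]
    exact Finset.sum_congr rfl fun j _ => by ring
  linarith

lemma sum_digraphLap_sq_le (hA : ∀ i j, 0 ≤ A i j) :
    ∃ C, 0 < C ∧ ∀ x, ∑ i, digraphLap A x i ^ 2 ≤ C * digraphEnergy A x := by
  refine ⟨∑ i, ∑ j, A i j + 1, ?_, fun x => ?_⟩
  · have : 0 ≤ ∑ i, ∑ j, A i j :=
      Finset.sum_nonneg fun i _ => Finset.sum_nonneg fun j _ => hA i j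
    linarith
  unfold digraphEnergy
  rw [Finset.mul_sum]
  refine Finset.sum_le_sum fun i _ => ?_
  have h1 : digraphLap A x i ^ 2 ≤ (∑ j, A i j) * ∑ j, A i j * (x i - x j) ^ 2 := by
    refine Finset.sum_sq_le_sum_mul_sum_of_sq_le_mul _ (fun j _ => hA i j)
      (fun j _ => mul_nonneg (hA i j) (sq_nonneg _)) (fun j _ => le_of_eq ?_)
    ring
  refine h1.trans (mul_le_mul_of_nonneg_right ?_ 
    (Finset.sum_nonneg fun j _ => mul_nonneg (hA i j) (sq_nonneg _)))
  have : ∑ j, A i j ≤ ∑ i, ∑ j, A i j :=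
    Finset.single_le_sum (f := fun i => ∑ j, A i j)
      (fun i _ => Finset.sum_nonneg fun j _ => hA i j) (Finset.mem_univ i)
  linarith

lemma sub_sq_le_digraphEnergy (hA : ∀ i j, 0 ≤ A i j) {i j : Fin N}
    (h : Relation.TransGen (fun p q : Fin N => 0 < A q p) i j) :
    ∃ C, 0 < C ∧ ∀ x : Fin N → ℝ, (x i - x j) ^ 2 ≤ C * digraphEnergy A x := by
  have edge : ∀ p q, 0 < A q p → ∀ x : Fin N → ℝ,
      (x p - x q) ^ 2 ≤ 1 / A q p * digraphEnergy A x := by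
    intro p q hpq x
    rw [one_div, inv_mul_eq_div, le_div_iff₀ hpq]
    have h1 : A q p * (x q - x p) ^ 2 ≤ ∑ j, A q j * (x q - x j) ^ 2 :=
      Finset.single_le_sum (f := fun j => A q j * (x q - x j) ^ 2)
        (fun j _ => mul_nonneg (hA q j) (sq_nonneg _)) (Finset.mem_univ p)
    have h2 : ∑ j, A q j * (x q - x j) ^ 2 ≤ digraphEnergy A x :=
      Finset.single_le_sum (f := fun q => ∑ j, A q j * (x q - x j) ^ 2)
        (fun i _ => Finset.sum_nonneg fun j _ => mul_nonneg (hA i j) (sq_nonneg _))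
        (Finset.mem_univ q)
    linarith [show A q p * (x q - x p) ^ 2 = (x p - x q) ^ 2 * A q p by ring]
  induction h with
  | single h => exact ⟨_, one_div_pos.2 h, edge _ _ h⟩
  | tail _ h ih =>
    obtain ⟨C, hC, ih⟩ := ih
    refine ⟨2 * C + 2 * (1 / A _ _), by have := one_div_pos.2 h; positivity, fun x => ?_⟩
    have h1 := ih x
    have h2 := edge _ _ h x
    rename_i p q _
    nlinarith [sq_nonneg ((x i - x p) - (x p - x q))]

lemma mul_sum_sub_sq_le_digraphEnergy (hA : ∀ i j, 0 ≤ A i j)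
    (hconn : ∀ i j : Fin N, i ≠ j →
      Relation.TransGen (fun p q : Fin N => 0 < A q p) i j) :
    ∃ C, 0 < C ∧ ∀ x : Fin N → ℝ, ∑ i, ∑ j, (x i - x j) ^ 2 ≤ C * digraphEnergy A x := by
  have h : ∀ i j, ∃ C, 0 < C ∧ ∀ x : Fin N → ℝ, (x i - x j) ^ 2 ≤ C * digraphEnergy A x := by
    intro i j
    by_cases hij : i = j
    · exact ⟨1, one_pos, fun x => by simp [hij, digraphEnergy_nonneg hA]⟩
    · exact sub_sq_le_digraphEnergy hA (hconn i j hij)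
  choose C hC h using h
  refine ⟨∑ i, ∑ j, C i j + 1, ?_, fun x => ?_⟩
  · have : 0 ≤ ∑ i, ∑ j, C i j :=
      Finset.sum_nonneg fun i _ => Finset.sum_nonneg fun j _ => (hC i j).le
    linarith
  · have h1 : ∑ i, ∑ j, (x i - x j) ^ 2 ≤ (∑ i, ∑ j, C i j) * digraphEnergy A x := by
      simp only [Finset.sum_mul]
      exact Finset.sum_le_sum fun i _ => Finset.sum_le_sum fun j _ => h i j x
    linarith [digraphEnergy_nonneg hA x]

lemma sum_sum_sub_sq (x : Fin N → ℝ) :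
    ∑ i, ∑ j, (x i - x j) ^ 2 = 2 * N * ∑ i, x i ^ 2 - 2 * (∑ i, x i) ^ 2 := by
  have h : ∀ i j, (x i - x j) ^ 2 = x i ^ 2 + x j ^ 2 - 2 * (x i * x j) := fun i j => by ring
  simp only [h, Finset.sum_sub_distrib, Finset.sum_add_distrib, Finset.sum_const,
    Finset.card_univ, Fintype.card_fin, nsmul_eq_mul, ← Finset.mul_sum, sq (∑ i, x i),
    Finset.sum_mul_sum]
  ring

lemma mul_sub_le_digraphEnergy (hN : 0 < N) (hA : ∀ i j, 0 ≤ A i j)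
    (hconn : ∀ i j : Fin N, i ≠ j →
      Relation.TransGen (fun p q : Fin N => 0 < A q p) i j) :
    ∃ μ, 0 < μ ∧ ∀ z r : Fin N → ℝ, ∑ i, z i = ∑ i, r i →
      μ * (∑ i, z i ^ 2 - ∑ i, r i ^ 2) ≤ digraphEnergy A z / 2 := by
  obtain ⟨C, hC, h⟩ := mul_sum_sub_sq_le_digraphEnergy hA hconn
  have hN' : (0 : ℝ) < N := by exact_mod_cast hN
  refine ⟨N / C, by positivity, fun z r hzr => ?_⟩
  have h1 := h z
  rw [sum_sum_sub_sq, hzr] at h1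
  have h2 : (∑ i, r i) ^ 2 ≤ N * ∑ i, r i ^ 2 := by
    simpa using sq_sum_le_card_mul_sum_sq (s := Finset.univ) (f := r)
  rw [div_mul_eq_mul_div, div_le_iff₀ hC]
  nlinarith

lemma exists_digraphLap_eq (hN : 0 < N) (hA : ∀ i j, 0 ≤ A i j)
    (hbal : ∀ i, ∑ j, A i j = ∑ j, A j i)
    (hconn : ∀ i j : Fin N, i ≠ j →
      Relation.TransGen (fun p q : Fin N => 0 < A q p) i j)
    (g : Fin N → ℝ) (hg : ∑ i, g i = 0) (s : ℝ) :
    ∃ v : Fin N → ℝ, (∀ i, digraphLap A v i = g i) ∧ ∑ i, v i = s := by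
  have hN' : (N : ℝ) ≠ 0 := by exact_mod_cast hN.ne'
  let T : (Fin N → ℝ) →ₗ[ℝ] (Fin N → ℝ) :=
    { toFun := fun x i => digraphLap A x i + ∑ j, x j
      map_add' := fun x y => by
        ext i
        simp only [digraphLap, Pi.add_apply, Finset.sum_add_distrib, mul_sub, mul_add,
          Finset.sum_sub_distrib]
        ring
      map_smul' := fun c x => by
        ext i
        simp only [digraphLap, Pi.smul_apply, smul_eq_mul, RingHom.id_apply, mul_add,
          Finset.mul_sum]
        congr 1
        exact Finset.sum_congr rfl fun j _ => by ring }
  have hT : ∀ x i, T x i = digraphLap A x i + ∑ j, x j := fun _ _ => rfl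
  obtain ⟨μ, hμ, hP⟩ := mul_sub_le_digraphEnergy hN hA hconn
  have hinj : Function.Injective T := by
    rw [injective_iff_map_eq_zero]
    intro x hx
    have h1 : ∑ i, x i * T x i = 0 := by simp [hx]
    simp only [hT, mul_add, Finset.sum_add_distrib, ← Finset.sum_mul] at h1
    rw [sum_mul_digraphLap_self hbal] at h1
    have h2 := digraphEnergy_nonneg hA x
    have h3 : ∑ i, x i = 0 := by nlinarith [mul_self_nonneg (∑ i, x i)]
    have h4 := hP x 0 (by simpa using h3)
    simp only [Pi.zero_apply] at h4
    have h5 : ∑ i, x i ^ 2 ≤ 0 := by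
      have h6 : digraphEnergy A x = 0 := by nlinarith [mul_self_nonneg (∑ i, x i)]
      rw [h6] at h4
      simp at h4
      nlinarith
    have h7 := (Finset.sum_eq_zero_iff_of_nonneg (fun i _ => sq_nonneg (x i))).1
      (le_antisymm h5 (Finset.sum_nonneg fun i _ => sq_nonneg (x i)))
    ext i
    simpa using h7 i (Finset.mem_univ i)
  obtain ⟨v, hv⟩ := (LinearMap.injective_iff_surjective.1 hinj) (fun i => g i + s)
  have hv' : ∀ i, digraphLap A v i + ∑ j, v j = g i + s := fun i => by rw [← hT, hv]
  have hs : ∑ i, v i = s := by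
    have h1 : ∑ i, (digraphLap A v i + ∑ j, v j) = ∑ i, (g i + s) :=
      Finset.sum_congr rfl fun i _ => hv' i
    simp only [Finset.sum_add_distrib, sum_digraphLap hbal, hg, Finset.sum_const,
      Finset.card_univ, Fintype.card_fin, nsmul_eq_mul, zero_add] at h1
    exact mul_left_cancel₀ hN' h1
  exact ⟨v, fun i => by have := hv' i; linarith, hs⟩

end Graph

/-- Dissipation of the error dynamics of the optimal signal generator, for a large enough
consensus gain. Here `z = r + v` and `d` is the gradient perturbation. -/
lemma generator_dissipation {N : ℕ} (hN : 0 < N) {A : Fin N → Fin N → ℝ}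
    (hA : ∀ i j, 0 ≤ A i j) (hbal : ∀ i, ∑ j, A i j = ∑ j, A j i)
    (hconn : ∀ i j : Fin N, i ≠ j →
      Relation.TransGen (fun p q : Fin N => 0 < A q p) i j)
    {l L : ℝ} (hl : 0 < l) :
    ∃ β γ c C, 0 < β ∧ 0 < γ ∧ 0 < c ∧ 0 < C ∧ ∀ r z h d : Fin N → ℝ,
      ∑ i, z i = ∑ i, r i → (∀ i, l * r i ^ 2 ≤ h i * r i) → (∀ i, |h i| ≤ L * |r i|) →
      ∑ i, r i * (-(h i + d i) - β * digraphLap A r i - (digraphLap A z i - digraphLap A r i))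
        + γ * ∑ i, z i * (-(h i + d i) - (digraphLap A z i - digraphLap A r i))
        ≤ -c * (∑ i, r i ^ 2 + ∑ i, z i ^ 2) + C * ∑ i, d i ^ 2 := by
  obtain ⟨C₁, hC₁, h₁⟩ := sum_digraphLap_sq_le hA
  obtain ⟨C₂, hC₂, h₂⟩ := sum_digraphLap_sq_le (A := fun i j => A j i) (fun i j => hA j i)
  obtain ⟨μ, hμ, hP⟩ := mul_sub_le_digraphEnergy hN hA hconn
  simp only [digraphEnergy_transpose] at h₂
  have young : ∀ (x y : Fin N → ℝ) (a : ℝ), 0 < a →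
      ∑ i, x i * y i ≤ a * ∑ i, x i ^ 2 + 1 / (4 * a) * ∑ i, y i ^ 2 := by
    intro x y a ha
    rw [Finset.mul_sum, Finset.mul_sum, ← Finset.sum_add_distrib]
    refine Finset.sum_le_sum fun i _ => ?_
    have h : a * x i ^ 2 + 1 / (4 * a) * y i ^ 2 - x i * y i
        = a * (x i - y i / (2 * a)) ^ 2 := by field_simp; ring
    nlinarith [mul_nonneg ha.le (sq_nonneg (x i - y i / (2 * a)))]
  set e := 2 * L ^ 2 / μ + μ with he
  have he0 : 0 < e := by positivity
  set γ := l / 8 / e with hγ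
  have hγ0 : 0 < γ := by positivity
  have hγe : γ * e = l / 8 := by rw [hγ]; field_simp
  set b := 1 + 2 * (C₂ * (2 / (γ * μ)) + γ * (2 / μ) * C₁) with hb
  have hb0 : 0 < b := by positivity
  refine ⟨b, γ, min (3 * l / 4) (γ * μ / 2), 2 / l + γ * (2 / μ), hb0, hγ0,
    by positivity, by positivity, fun r z h d hzr hlow hup => ?_⟩
  have e1 : ∑ i, r i * (-(h i + d i) - b * digraphLap A r i
      - (digraphLap A z i - digraphLap A r i))
      = -(∑ i, h i * r i) + ∑ i, r i * (-d i) - (b - 1) * ∑ i, r i * digraphLap A r i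
        - ∑ i, r i * digraphLap A z i := by
    rw [Finset.mul_sum, ← Finset.sum_neg_distrib, ← Finset.sum_add_distrib,
      ← Finset.sum_sub_distrib, ← Finset.sum_sub_distrib]
    exact Finset.sum_congr rfl fun i _ => by ring
  have e2 : ∑ i, z i * (-(h i + d i) - (digraphLap A z i - digraphLap A r i))
      = ∑ i, z i * (-h i) + ∑ i, z i * (-d i) - ∑ i, z i * digraphLap A z i
        + ∑ i, z i * digraphLap A r i := by
    rw [← Finset.sum_add_distrib, ← Finset.sum_sub_distrib, ← Finset.sum_add_distrib]
    exact Finset.sum_congr rfl fun i _ => by ring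
  have e3 : -∑ i, r i * digraphLap A z i
      = ∑ i, z i * (-digraphLap (fun i j => A j i) r i) := by
    rw [sum_mul_digraphLap hbal, ← Finset.sum_neg_distrib]
    exact Finset.sum_congr rfl fun i _ => by ring
  have b1 : l * ∑ i, r i ^ 2 ≤ ∑ i, h i * r i := by
    rw [Finset.mul_sum]; exact Finset.sum_le_sum fun i _ => hlow i
  have b2 := young r (fun i => -d i) (l / 8) (by positivity)
  have b3 := young z (fun i => -digraphLap (fun i j => A j i) r i) (γ * μ / 8) (by positivity)
  have b4 := young z (fun i => -h i) (μ / 8) (by positivity)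
  have b5 := young z (fun i => -d i) (μ / 8) (by positivity)
  have b6 := young z (fun i => digraphLap A r i) (μ / 8) (by positivity)
  simp only [neg_sq] at b2 b3 b4 b5 b6
  have b7 : ∑ i, h i ^ 2 ≤ L ^ 2 * ∑ i, r i ^ 2 := by
    rw [Finset.mul_sum]
    refine Finset.sum_le_sum fun i _ => ?_
    rw [← sq_abs (h i), ← sq_abs (r i), ← mul_pow]
    exact pow_le_pow_left₀ (abs_nonneg _) (hup i) 2
  have b8 := hP z r hzr
  have b9 := h₁ r
  have b10 := h₂ r
  rw [e1, e2, sum_mul_digraphLap_self hbal, sum_mul_digraphLap_self hbal]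
  have hR : 0 ≤ ∑ i, r i ^ 2 := Finset.sum_nonneg fun i _ => sq_nonneg _
  have hZ : 0 ≤ ∑ i, z i ^ 2 := Finset.sum_nonneg fun i _ => sq_nonneg _
  have s1 : (1:ℝ) / (4 * (l / 8)) = 2 / l := by field_simp; norm_num
  have s2 : (1:ℝ) / (4 * (μ / 8)) = 2 / μ := by field_simp; norm_num
  have s3 : (1:ℝ) / (4 * (γ * μ / 8)) = 2 / (γ * μ) := by field_simp; norm_num
  rw [s1] at b2
  rw [s2] at b4 b5 b6
  rw [s3] at b3
  set R := ∑ i, r i ^ 2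
  set Z := ∑ i, z i ^ 2
  set D := ∑ i, d i ^ 2
  set E := digraphEnergy A r
  have t1 : 2 / (γ * μ) * ∑ i, digraphLap (fun i j => A j i) r i ^ 2
      ≤ 2 / (γ * μ) * (C₂ * E) := mul_le_mul_of_nonneg_left b10 (by positivity)
  have t2 : 2 / μ * ∑ i, digraphLap A r i ^ 2 ≤ 2 / μ * (C₁ * E) :=
    mul_le_mul_of_nonneg_left b9 (by positivity)
  have t3 : 2 / μ * ∑ i, h i ^ 2 ≤ 2 / μ * (L ^ 2 * R) :=
    mul_le_mul_of_nonneg_left b7 (by positivity)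
  have u1 : ∑ i, z i * (-h i) + ∑ i, z i * (-d i) - digraphEnergy A z / 2
        + ∑ i, z i * digraphLap A r i
      ≤ -(5 * μ / 8) * Z + e * R + 2 / μ * D + 2 / μ * (C₁ * E) := by
    have : e * R = 2 / μ * (L ^ 2 * R) + μ * R := by rw [he]; ring
    rw [this]
    linarith
  have u2 := mul_le_mul_of_nonneg_left u1 hγ0.le
  have u3 : (b - 1) * (E / 2) = 2 / (γ * μ) * (C₂ * E) + γ * (2 / μ * (C₁ * E)) := by
    rw [hb]; ring
  have u4 : γ * (-(5 * μ / 8) * Z + e * R + 2 / μ * D + 2 / μ * (C₁ * E))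
      = -(5 * (γ * μ) / 8) * Z + l / 8 * R + γ * (2 / μ) * D + γ * (2 / μ * (C₁ * E)) := by
    rw [← hγe]; ring
  have m1 : min (3 * l / 4) (γ * μ / 2) * R ≤ 3 * l / 4 * R :=
    mul_le_mul_of_nonneg_right (min_le_left _ _) hR
  have m2 : min (3 * l / 4) (γ * μ / 2) * Z ≤ γ * μ / 2 * Z :=
    mul_le_mul_of_nonneg_right (min_le_right _ _) hZ
  rw [u4] at u2
  linarith

lemma monotoneOn_Ici_of_hasDerivAt_nonneg {F F' : ℝ → ℝ}
    (hF : ∀ t, 0 ≤ t → HasDerivAt F (F' t) t) (h : ∀ t, 0 ≤ t → 0 ≤ F' t) :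
    MonotoneOn F (Set.Ici 0) := by
  refine monotoneOn_of_deriv_nonneg (convex_Ici 0)
    (fun t ht => (hF t ht).continuousAt.continuousWithinAt)
    (fun t ht => (hF t (interior_subset ht)).differentiableAt.differentiableWithinAt)
    (fun t ht => ?_)
  rw [(hF t (interior_subset ht)).deriv]
  exact h t (interior_subset ht)

/-- A version of Barbalat's lemma. -/
lemma tendsto_zero_of_hasDerivAt_bound {g g' F F' : ℝ → ℝ} {K B : ℝ}
    (hg : ∀ t, 0 ≤ t → HasDerivAt g (g' t) t) (hg' : ∀ t, 0 ≤ t → |g' t| ≤ K)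
    (hg0 : ∀ t, 0 ≤ t → 0 ≤ g t)
    (hF : ∀ t, 0 ≤ t → HasDerivAt F (F' t) t) (hgF : ∀ t, 0 ≤ t → g t ≤ F' t)
    (hB : ∀ t, 0 ≤ t → F t ≤ B) : Tendsto g atTop (nhds 0) := by
  have hmono : MonotoneOn F (Set.Ici 0) :=
    monotoneOn_Ici_of_hasDerivAt_nonneg hF fun t ht => (hg0 t ht).trans (hgF t ht)
  have hK : 0 ≤ K := (abs_nonneg _).trans (hg' 0 le_rfl)
  have hmono2 : ∀ s, 0 ≤ s → ∀ t, s ≤ t → g s * (t - s) - K * (t - s) ^ 2 / 2 ≤ F t - F s := by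
    intro s hs
    have hlow : ∀ t, 0 ≤ t → g s - K * t ≤ g (s + t) := by
      have := monotoneOn_Ici_of_hasDerivAt_nonneg (F := fun t => g (s + t) + K * t)
        (F' := fun t => g' (s + t) + K)
        (fun t ht => by
          have h1 := (hg (s + t) (by linarith)).comp_const_add s t
          have h2 := (hasDerivAt_id t).const_mul K
          exact (h1.add h2).congr_deriv (by simp))
        (fun t ht => by linarith [neg_le_of_abs_le (hg' (s + t) (by linarith))])
      intro t ht
      have h := this (Set.mem_Ici.2 le_rfl) (Set.mem_Ici.2 ht) ht
      simp at h
      linarith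
    have := monotoneOn_Ici_of_hasDerivAt_nonneg
      (F := fun t => F (s + t) - (g s * t - K * t ^ 2 / 2))
      (F' := fun t => F' (s + t) - (g s - K * t))
      (fun t ht => by
        have h1 := (hF (s + t) (by linarith)).comp_const_add s t
        have h2 := (hasDerivAt_id t).const_mul (g s)
        have h3 := (((hasDerivAt_id t).pow 2).const_mul K).div_const 2
        refine (h1.sub (h2.sub h3)).congr_deriv ?_
        simp
        ring)
      (fun t ht => by linarith [hlow t ht, hgF (s + t) (by linarith)])
    intro t ht
    have h := this (Set.mem_Ici.2 le_rfl) (Set.mem_Ici.2 (sub_nonneg.2 ht)) (sub_nonneg.2 ht)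
    simp at h
    linarith
  have hsup : ∃ l, Tendsto (fun t => F (max t 0)) atTop (nhds l) := by
    have hm : Monotone fun t => F (max t 0) := fun a c hac =>
      hmono (Set.mem_Ici.2 (le_max_right _ _)) (Set.mem_Ici.2 (le_max_right _ _)) (max_le_max hac le_rfl)
    exact ⟨_, tendsto_atTop_ciSup hm ⟨B, by rintro _ ⟨t, rfl⟩; exact hB _ (le_max_right _ _)⟩⟩
  obtain ⟨l, hl⟩ := hsup
  rw [Metric.tendsto_atTop]
  intro η hη
  set δ := η / (K + 1) with hδ
  have hδ0 : 0 < δ := by positivity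
  have hKδ : K * δ ≤ η := by
    rw [hδ, mul_div_assoc', div_le_iff₀ (by linarith)]; nlinarith
  obtain ⟨T, hT⟩ := (Metric.tendsto_atTop.1 hl) (η * δ / 8) (by positivity)
  refine ⟨max T 0, fun s hs => ?_⟩
  have hs0 : 0 ≤ s := (le_max_right _ _).trans hs
  have hsT : T ≤ s := (le_max_left _ _).trans hs
  have h1 := hT s hsT
  have h2 := hT (s + δ) (by linarith)
  rw [Real.dist_eq, max_eq_left (by linarith), abs_lt] at h1 h2
  have h3 := hmono2 s hs0 (s + δ) (by linarith)
  rw [Real.dist_eq, sub_zero, abs_of_nonneg (hg0 s hs0)]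
  by_contra hcon
  push Not at hcon
  simp only [add_sub_cancel_left] at h3
  nlinarith [mul_le_mul_of_nonneg_right hcon hδ0.le, mul_le_mul_of_nonneg_right hKδ hδ0.le,
    mul_pos hη hδ0]

/-- If same-sign combinations of Nussbaum integrals stay bounded below along nondecreasing
parameters, then the parameters are bounded. -/
lemma bounded_of_nussbaum {N : ℕ} {Nb : ℝ → ℝ} (hNb : Continuous Nb)
    (hplus : Tendsto (fun θ : ℝ => (∫ s in (0:ℝ)..θ, max (Nb s) 0) / θ) atTop atTop)
    (hratio : ∀ M : ℝ, ∃ᶠ θ in atTop,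
      M < (∫ s in (0:ℝ)..θ, max (-Nb s) 0) / (∫ s in (0:ℝ)..θ, max (Nb s) 0))
    {g M : Fin N → ℝ} (hg : ∀ i, 0 < g i) {th : Fin N → ℝ → ℝ}
    (hcont : ∀ i, ContinuousOn (th i) (Set.Ici 0)) (hmono : ∀ i, MonotoneOn (th i) (Set.Ici 0))
    {K : ℝ} (hK : ∀ t, 0 ≤ t →
      K ≤ ∑ i, (g i * (∫ s in (0:ℝ)..(th i t), Nb s) + M i * th i t)) :
    ∃ B, ∀ t, 0 ≤ t → ∀ i, |th i t| ≤ B := by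
  set P : ℝ → ℝ := fun θ => ∫ s in (0:ℝ)..θ, max (Nb s) 0 with hP
  set Q : ℝ → ℝ := fun θ => ∫ s in (0:ℝ)..θ, max (-Nb s) 0 with hQ
  have cP : Continuous fun s => max (Nb s) 0 := hNb.max continuous_const
  have cQ : Continuous fun s => max (-Nb s) 0 := hNb.neg.max continuous_const
  have mono : ∀ q : ℝ → ℝ, Continuous q → (∀ s, 0 ≤ q s) →
      Monotone fun θ => ∫ s in (0:ℝ)..θ, q s := by
    intro q hq h0 a c hac
    have h1 := intervalIntegral.integral_add_adjacent_intervals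
      (hq.intervalIntegrable 0 a) (hq.intervalIntegrable a c) (μ := MeasureTheory.volume)
    have h2 := intervalIntegral.integral_nonneg hac (f := q) (μ := MeasureTheory.volume)
      (fun s _ => h0 s)
    simp only
    linarith
  have mP : Monotone P := mono _ cP fun s => le_max_right _ _
  have mQ : Monotone Q := mono _ cQ fun s => le_max_right _ _
  have hPQ : ∀ θ, ∫ s in (0:ℝ)..θ, Nb s = P θ - Q θ := by
    intro θ
    rw [hP, hQ, ← intervalIntegral.integral_sub (cP.intervalIntegrable _ _)
      (cQ.intervalIntegrable _ _)]
    refine intervalIntegral.integral_congr fun s _ => ?_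
    rcases le_total (Nb s) 0 with h | h
    · rw [max_eq_right h, max_eq_left (by linarith)]; ring
    · rw [max_eq_left h, max_eq_right (by linarith)]; ring
  suffices hub : ∃ B, ∀ t, 0 ≤ t → ∀ i, th i t ≤ B by
    obtain ⟨B, hB⟩ := hub
    refine ⟨max B (∑ i, |th i 0|), fun t ht i => abs_le.2 ⟨?_, (hB t ht i).trans (le_max_left _ _)⟩⟩
    have h1 := hmono i (Set.mem_Ici.2 le_rfl) (Set.mem_Ici.2 ht) ht
    have h2 : |th i 0| ≤ ∑ i, |th i 0| :=
      Finset.single_le_sum (f := fun i => |th i 0|) (fun _ _ => abs_nonneg _) (Finset.mem_univ i)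
    have h3 := le_max_right B (∑ i, |th i 0|)
    linarith [neg_abs_le (th i 0)]
  by_contra hcon
  push Not at hcon
  obtain ⟨t₀, ht₀, i₀, -⟩ := hcon 0
  have hne : (Finset.univ : Finset (Fin N)).Nonempty := ⟨i₀, Finset.mem_univ _⟩
  set Θ : ℝ → ℝ := fun t => Finset.univ.sup' hne fun i => th i t with hΘ
  have hΘc : ContinuousOn Θ (Set.Ici 0) :=
    ContinuousOn.finset_sup'_apply hne fun i _ => hcont i
  have hle : ∀ i t, th i t ≤ Θ t := fun i t =>
    Finset.le_sup' (fun i => th i t) (Finset.mem_univ i)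
  have hval : ∀ x, Θ 0 ≤ x → ∃ t, 0 ≤ t ∧ Θ t = x := by
    intro x hx
    obtain ⟨t, ht, i, hi⟩ := hcon x
    have := intermediate_value_Icc ht (hΘc.mono Set.Icc_subset_Ici_self)
    obtain ⟨s, hs, hsx⟩ := this ⟨hx, hi.le.trans (hle i t)⟩
    exact ⟨s, hs.1, hsx⟩
  set G := ∑ i, g i with hG
  set m := ∑ i, |M i| with hm
  obtain ⟨gm, hgm0, hgm⟩ : ∃ gm, 0 < gm ∧ ∀ i, gm ≤ g i := by
    obtain ⟨j, -, hj⟩ := Finset.exists_min_image Finset.univ g hne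
    exact ⟨g j, hg j, fun i => hj i (Finset.mem_univ i)⟩
  set c0 := ∑ i, (g i * |Q (th i 0)| + |M i| * |th i 0|) with hc0
  set D := (G + m + 1) / gm with hD
  have hGpos : 0 ≤ G := Finset.sum_nonneg fun i _ => (hg i).le
  have hmpos : 0 ≤ m := Finset.sum_nonneg fun i _ => abs_nonneg _
  have ev : ∀ᶠ θ : ℝ in atTop, 1 ≤ P θ / θ ∧ 1 ≤ θ ∧ Θ 0 ≤ θ ∧ c0 - K + 1 ≤ θ :=
    (hplus.eventually_ge_atTop 1).and ((eventually_ge_atTop 1).and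
      ((eventually_ge_atTop _).and (eventually_ge_atTop _)))
  obtain ⟨θ, hθ, h1, h2, h3, h4⟩ := ((hratio D).and_eventually ev).exists
  have hPθ : θ ≤ P θ := by
    rw [le_div_iff₀ (by linarith)] at h1; linarith
  have hQθ : (G + m + 1) * P θ < gm * Q θ := by
    rw [lt_div_iff₀ (by linarith : (0:ℝ) < ∫ s in (0:ℝ)..θ, max (Nb s) 0)] at hθ
    have : D * gm = G + m + 1 := by rw [hD]; field_simp
    change D * P θ < Q θ at hθ
    nlinarith
  obtain ⟨t, ht, htθ⟩ := hval θ h3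
  obtain ⟨j, -, hj⟩ := Finset.exists_mem_eq_sup' hne fun i => th i t
  have hj' : th j t = θ := by rw [← htθ]; exact hj.symm
  have bound : ∀ i, g i * (∫ s in (0:ℝ)..(th i t), Nb s) + M i * th i t
      ≤ (g i * P θ + |M i| * θ) + (g i * |Q (th i 0)| + |M i| * |th i 0|)
        - (if i = j then gm * Q θ else 0) := by
    intro i
    have hmi := hmono i (Set.mem_Ici.2 le_rfl) (Set.mem_Ici.2 ht) ht
    have b1 : g i * P (th i t) ≤ g i * P θ :=
      mul_le_mul_of_nonneg_left (mP (htθ ▸ hle i t)) (hg i).le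
    have b2 : M i * th i t ≤ |M i| * θ + |M i| * |th i 0| := by
      have : |th i t| ≤ θ + |th i 0| := by
        have := hle i t
        rw [abs_le]; constructor
        · linarith [neg_abs_le (th i 0)]
        · linarith [abs_nonneg (th i 0)]
      calc M i * th i t ≤ |M i * th i t| := le_abs_self _
        _ = |M i| * |th i t| := abs_mul _ _
        _ ≤ |M i| * (θ + |th i 0|) := mul_le_mul_of_nonneg_left this (abs_nonneg _)
        _ = _ := by ring
    rw [hPQ]
    split_ifs with hij
    · subst hij
      rw [hj'] at b1 b2 ⊢
      have b3 : gm * Q θ ≤ g i * Q θ := by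
        refine mul_le_mul_of_nonneg_right (hgm i) ?_
        have : 0 ≤ (G + m + 1) * P θ := by
          apply mul_nonneg <;> linarith
        nlinarith
      have b4 : 0 ≤ g i * |Q (th i 0)| := mul_nonneg (hg i).le (abs_nonneg _)
      nlinarith
    · have b3 : g i * (-|Q (th i 0)|) ≤ g i * Q (th i t) :=
        mul_le_mul_of_nonneg_left ((neg_abs_le _).trans (mQ hmi)) (hg i).le
      nlinarith
  have hsum := (hK t ht).trans (Finset.sum_le_sum fun i _ => bound i)
  simp only [Finset.sum_add_distrib, Finset.sum_sub_distrib, ← Finset.sum_mul,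
    Finset.sum_ite_eq', Finset.mem_univ, if_true] at hsum
  rw [hc0, Finset.sum_add_distrib] at h4
  have hmθ : m * θ ≤ m * P θ := mul_le_mul_of_nonneg_left hPθ hmpos
  change K ≤ G * P θ + m * θ + _ - _ at hsum
  nlinarith

/-- The value at the sequence `x` of the linear functional with coefficients `p`. -/
noncomputable def coeffPairing (p : Polynomial ℂ) (x : ℕ → ℂ) : ℂ :=
  ∑ m ∈ Finset.range (p.natDegree + 1), p.coeff m * x m

lemma coeffPairing_eq {p : Polynomial ℂ} {d : ℕ} (h : p.natDegree < d) (x : ℕ → ℂ) :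
    coeffPairing p x = ∑ m ∈ Finset.range d, p.coeff m * x m := by
  unfold coeffPairing
  refine Finset.sum_subset (Finset.range_subset_range.2 h) fun m _ hm => ?_
  rw [Polynomial.coeff_eq_zero_of_natDegree_lt (by simpa [Nat.lt_succ_iff] using hm), zero_mul]

lemma coeffPairing_shift (p : Polynomial ℂ) (lam : ℂ) (x : ℕ → ℂ) :
    coeffPairing p (fun m => x (m + 1))
      = lam * coeffPairing p x
        + coeffPairing ((Polynomial.X - Polynomial.C lam) * p) x := by
  have h : ((Polynomial.X - Polynomial.C lam) * p).natDegree < p.natDegree + 1 + 1 := by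
    have := Polynomial.natDegree_mul_le (p := Polynomial.X - Polynomial.C lam) (q := p)
    rw [Polynomial.natDegree_X_sub_C] at this
    omega
  rw [coeffPairing_eq h, coeffPairing_eq (d := p.natDegree + 1 + 1) (by omega) x]
  simp only [sub_mul, Polynomial.coeff_sub, Polynomial.coeff_C_mul, Finset.sum_sub_distrib,
    Finset.mul_sum, mul_assoc]
  have h2 := Finset.sum_range_succ'
    (fun m => (Polynomial.X * p : Polynomial ℂ).coeff m * x m) (p.natDegree + 1)
  rw [h2]
  simp [coeffPairing, Polynomial.coeff_X_mul]

lemma norm_sq_sum_mul_le (a x : ℕ → ℂ) (d : ℕ) :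
    ‖∑ m ∈ Finset.range d, a m * x m‖ ^ 2
      ≤ (∑ m ∈ Finset.range d, ‖a m‖ ^ 2) * ∑ m ∈ Finset.range d, ‖x m‖ ^ 2 := by
  have h1 : ‖∑ m ∈ Finset.range d, a m * x m‖ ≤ ∑ m ∈ Finset.range d, ‖a m‖ * ‖x m‖ :=
    (norm_sum_le _ _).trans_eq (Finset.sum_congr rfl fun m _ => norm_mul _ _)
  exact (pow_le_pow_left₀ (norm_nonneg _) h1 2).trans (Finset.sum_mul_sq_le_sq_mul_sq _ _ _)

/-- A quadratic Lyapunov function `V`, with polarization `B`, for a chain of integrators closed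
by the polynomial with roots `s` in the open left half plane. -/
lemma exists_chain_lyapunov (s : Multiset ℂ) (hs : ∀ z ∈ s, z.re < 0) :
    ∃ (V : (ℕ → ℂ) → ℝ) (B : (ℕ → ℂ) → (ℕ → ℂ) → ℝ) (c C : ℝ), 0 < c ∧ 0 < C ∧
      (∀ (x : ℝ → ℕ → ℂ) (x' : ℕ → ℂ) (t : ℝ),
        (∀ m < Multiset.card s, HasDerivAt (fun τ => x τ m) (x' m) t) →
        HasDerivAt (fun τ => V (x τ)) (2 * B (x t) x') t) ∧
      (∀ (x y z : ℕ → ℂ) (a b : ℝ), B x (fun m => a * y m + b * z m) = a * B x y + b * B x z) ∧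
      (∀ x y, B x y ≤ C * (∑ m ∈ Finset.range (Multiset.card s), ‖x m‖ ^ 2
        + ∑ m ∈ Finset.range (Multiset.card s), ‖y m‖ ^ 2)) ∧
      (∀ x, B x (fun m => x (m + 1)) ≤ -c * ∑ m ∈ Finset.range (Multiset.card s), ‖x m‖ ^ 2
        + C * ‖coeffPairing (s.map fun z => Polynomial.X - Polynomial.C z).prod x‖ ^ 2) ∧
      (∀ x, c * ∑ m ∈ Finset.range (Multiset.card s), ‖x m‖ ^ 2 ≤ V x) := by
  induction s using Multiset.induction_on with
  | empty =>
    refine ⟨fun _ => 0, fun _ _ => 0, 1, 1, one_pos, one_pos, fun x x' t _ => ?_, ?_, ?_, ?_, ?_⟩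
    · simpa using hasDerivAt_const t (0 : ℝ)
    all_goals simp
  | cons lam s ih =>
    obtain ⟨V, B, c, C, hc, hC, hV, hlin, hbd, hdiss, hpos⟩ :=
      ih fun z hz => hs z (Multiset.mem_cons_of_mem hz)
    set p := (s.map fun z => Polynomial.X - Polynomial.C z).prod with hp
    set d := Multiset.card s with hd
    have hmonic : p.Monic := Polynomial.monic_multiset_prod_of_monic _ _
      fun z _ => Polynomial.monic_X_sub_C z
    have hdeg : p.natDegree = d := by
      exact Polynomial.natDegree_multiset_prod_X_sub_C_eq_card s
    have hpair : ∀ x, coeffPairing p x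
        = ∑ m ∈ Finset.range d, p.coeff m * x m + x d := by
      intro x
      have h1 : p.coeff d = 1 := by rw [← hdeg]; exact hmonic
      rw [coeffPairing, hdeg, Finset.sum_range_succ, h1, one_mul]
    have hcons : ((lam ::ₘ s).map fun z => Polynomial.X - Polynomial.C z).prod
        = (Polynomial.X - Polynomial.C lam) * p := by simp [hp]
    rw [hcons, Multiset.card_cons, ← hd]
    set K := ∑ m ∈ Finset.range d, ‖p.coeff m‖ ^ 2 with hK
    have hK0 : 0 ≤ K := Finset.sum_nonneg fun m _ => sq_nonneg _
    set σ := -lam.re with hσ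
    have hσ0 : 0 < σ := by
      have := hs lam (Multiset.mem_cons_self _ _); linarith
    set κ := σ / (4 * C) with hκ
    have hκ0 : 0 < κ := by positivity
    have hκC : κ * C = σ / 4 := by rw [hκ]; field_simp
    let S : (ℕ → ℂ) → ℝ := fun x => ∑ m ∈ Finset.range d, ‖x m‖ ^ 2
    have hS0 : ∀ x, 0 ≤ S x := fun x => Finset.sum_nonneg fun m _ => sq_nonneg _
    have hlast : ∀ x, S x + ‖x d‖ ^ 2 ≤ (1 + 2 * K) * S x + 2 * ‖coeffPairing p x‖ ^ 2 := by
      intro x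
      have h1 : x d = coeffPairing p x - ∑ m ∈ Finset.range d, p.coeff m * x m := by
        rw [hpair]; ring
      have h2 : ‖x d‖ ≤ ‖coeffPairing p x‖ + ‖∑ m ∈ Finset.range d, p.coeff m * x m‖ := by
        conv_lhs => rw [h1]
        exact norm_sub_le _ _
      have h3 := norm_sq_sum_mul_le p.coeff x d
      have h4 := pow_le_pow_left₀ (norm_nonneg _) h2 2
      change _ ≤ K * S x at h3
      nlinarith [sq_nonneg (‖coeffPairing p x‖ - ‖∑ m ∈ Finset.range d, p.coeff m * x m‖)]
    have hpairbd : ∀ x, ‖coeffPairing p x‖ ^ 2 ≤ (2 * K + 2) * (S x + ‖x d‖ ^ 2) := by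
      intro x
      have h2 := norm_add_le (∑ m ∈ Finset.range d, p.coeff m * x m) (x d)
      rw [← hpair] at h2
      have h3 := norm_sq_sum_mul_le p.coeff x d
      have h4 := pow_le_pow_left₀ (norm_nonneg _) h2 2
      change _ ≤ K * S x at h3
      nlinarith [sq_nonneg (‖x d‖ - ‖∑ m ∈ Finset.range d, p.coeff m * x m‖), hS0 x,
        mul_nonneg hK0 (sq_nonneg ‖x d‖)]
    have hinner : ∀ w z : ℂ, (starRingEnd ℂ w * z).re ≤ ‖w‖ * ‖z‖ := by
      intro w z
      refine (Complex.re_le_norm _).trans_eq ?_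
      rw [norm_mul, RCLike.norm_conj]
    set c' := min (min (κ * c / (1 + 2 * K)) (σ / 8)) (1 / 2) with hc'
    have hc'0 : 0 < c' := by positivity
    have hc'1 : c' * (1 + 2 * K) ≤ κ * c := by
      rw [← le_div_iff₀ (by positivity)]
      exact (min_le_left _ _).trans (min_le_left _ _)
    have hc'2 : c' ≤ σ / 8 := (min_le_left _ _).trans (min_le_right _ _)
    have hc'3 : c' ≤ 1 / 2 := min_le_right _ _
    refine ⟨fun x => κ * V x + ‖coeffPairing p x‖ ^ 2,
      fun x y => κ * B x y + (starRingEnd ℂ (coeffPairing p x) * coeffPairing p y).re,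
      c', max (κ * C + 2 * K + 2) (1 / (2 * σ)), hc'0, by positivity, ?_, ?_, ?_, ?_, ?_⟩
    · intro x x' t hx
      have h1 := hV x x' t fun m hm => hx m (by omega)
      have h2 : HasDerivAt (fun τ => coeffPairing p (x τ)) (coeffPairing p x') t := by
        unfold coeffPairing
        refine HasDerivAt.fun_sum fun m hm => ?_
        rw [hdeg, Finset.mem_range] at hm
        exact (hx m hm).const_mul _
      have h3 := h2.norm_sq
      refine ((h1.const_mul κ).add h3).congr_deriv ?_
      simp only [Complex.inner]
      rw [mul_comm (coeffPairing p x')]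
      ring
    · intro x y z a b
      have h1 : coeffPairing p (fun m => a * y m + b * z m)
          = a * coeffPairing p y + b * coeffPairing p z := by
        simp only [coeffPairing, Finset.mul_sum, ← Finset.sum_add_distrib]
        exact Finset.sum_congr rfl fun m _ => by ring
      simp only [hlin, h1, mul_add, Complex.add_re]
      have h2 : ∀ (r : ℝ) (w v : ℂ), (w * (r * v)).re = r * (w * v).re := by
        intro r w v
        rw [mul_left_comm, Complex.re_ofReal_mul]
      rw [h2, h2]
      ring
    · intro x y
      simp only [Finset.sum_range_succ]
      have h1 := hbd x y
      have h2 := hinner (coeffPairing p x) (coeffPairing p y)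
      have h3 := hpairbd x
      have h4 := hpairbd y
      change _ ≤ _ * ((S x + _) + (S y + _))
      change _ ≤ _ * (S x + S y) at h1
      have h5 : (κ * C + 2 * K + 2) * (S x + ‖x d‖ ^ 2 + (S y + ‖y d‖ ^ 2))
          ≤ max (κ * C + 2 * K + 2) (1 / (2 * σ)) * (S x + ‖x d‖ ^ 2 + (S y + ‖y d‖ ^ 2)) := by
        refine mul_le_mul_of_nonneg_right (le_max_left _ _) ?_
        have := hS0 x; have := hS0 y; positivity
      refine le_trans ?_ h5
      have h6 := mul_le_mul_of_nonneg_left h1 hκ0.le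
      have h7 : 0 ≤ κ * C * (‖x d‖ ^ 2 + ‖y d‖ ^ 2) := by positivity
      nlinarith [sq_nonneg (‖coeffPairing p x‖ - ‖coeffPairing p y‖)]
    · intro x
      simp only [Finset.sum_range_succ]
      set q := (Polynomial.X - Polynomial.C lam) * p
      have h1 := hdiss x
      rw [coeffPairing_shift p lam x]
      set w := coeffPairing p x
      set w' := coeffPairing q x
      have h2 : (starRingEnd ℂ w * (lam * w + w')).re
          = lam.re * ‖w‖ ^ 2 + (starRingEnd ℂ w * w').re := by
        rw [mul_add, Complex.add_re, mul_left_comm, ← Complex.normSq_eq_conj_mul_self,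
          Complex.re_mul_ofReal, Complex.normSq_eq_norm_sq]
      rw [h2]
      have h3 := hinner w w'
      have h4 := hlast x
      change _ ≤ -c * S x + _ at h1
      change _ ≤ -c' * (S x + _) + _
      have h5 : 1 / (2 * σ) * ‖w'‖ ^ 2
          ≤ max (κ * C + 2 * K + 2) (1 / (2 * σ)) * ‖w'‖ ^ 2 :=
        mul_le_mul_of_nonneg_right (le_max_right _ _) (sq_nonneg _)
      have h6 : ‖w‖ * ‖w'‖ ≤ σ / 2 * ‖w‖ ^ 2 + 1 / (2 * σ) * ‖w'‖ ^ 2 := by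
        have : σ / 2 * ‖w‖ ^ 2 + 1 / (2 * σ) * ‖w'‖ ^ 2 - ‖w‖ * ‖w'‖
          = σ / 2 * (‖w‖ - ‖w'‖ / σ) ^ 2 := by field_simp; ring
        nlinarith [mul_nonneg hσ0.le (sq_nonneg (‖w‖ - ‖w'‖ / σ))]
      have h7 := mul_le_mul_of_nonneg_left h1 hκ0.le
      have h8 : κ * (-c * S x + C * ‖w‖ ^ 2) = -(κ * c) * S x + σ / 4 * ‖w‖ ^ 2 := by
        rw [← hκC]; ring
      have h9 := mul_le_mul_of_nonneg_left h4 hc'0.le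
      have h10 := mul_le_mul_of_nonneg_right hc'1 (hS0 x)
      have h11 := mul_le_mul_of_nonneg_right hc'2 (sq_nonneg ‖w‖)
      have h12 : lam.re = -σ := by rw [hσ]; ring
      rw [h12]
      rw [h8] at h7
      linarith
    · intro x
      simp only [Finset.sum_range_succ]
      have h4 := hlast x
      have h5 := hpos x
      change _ * S x ≤ _ at h5
      change c' * (S x + _) ≤ _
      have h7 := mul_le_mul_of_nonneg_left h5 hκ0.le
      have h9 := mul_le_mul_of_nonneg_left h4 hc'0.le
      have h10 := mul_le_mul_of_nonneg_right hc'1 (hS0 x)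
      have h11 := mul_le_mul_of_nonneg_right hc'3 (sq_nonneg ‖coeffPairing p x‖)
      linarith

lemma sum_Icc_one_eq_sum_range (f : ℕ → ℝ) (d : ℕ) :
    ∑ ι ∈ Finset.Icc 1 d, f ι = ∑ m ∈ Finset.range d, f (m + 1) := by
  induction d with
  | zero => simp
  | succ d ih => rw [Finset.sum_Icc_succ_top (by omega), ih, Finset.sum_range_succ]

/-- The real quadratic Lyapunov function of a chain of `d` integrators closed by a Hurwitz
polynomial. -/
lemma exists_real_chain_lyapunov (d : ℕ) (k : ℕ → ℝ)
    (hk : ∀ z : ℂ, (Polynomial.X ^ d + ∑ ι ∈ Finset.Icc 1 d,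
        Polynomial.C ((k ι : ℂ)) * Polynomial.X ^ (ι - 1)).IsRoot z → z.re < 0) :
    ∃ (V : (ℕ → ℝ) → ℝ) (B : (ℕ → ℝ) → (ℕ → ℝ) → ℝ) (c C : ℝ), 0 < c ∧ 0 < C ∧
      (∀ (x : ℝ → ℕ → ℝ) (x' : ℕ → ℝ) (t : ℝ),
        (∀ m < d, HasDerivAt (fun τ => x τ m) (x' m) t) →
        HasDerivAt (fun τ => V (x τ)) (B (x t) x') t) ∧
      (∀ (x : ℕ → ℝ) (e a ρ : ℝ), 0 < e → 0 < a →
        B x (fun m => e * x (m + 1) + (if m = 0 then ρ else 0))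
          ≤ e * (-c * ∑ m ∈ Finset.range d, x m ^ 2
              + C * (∑ m ∈ Finset.range d, k (m + 1) * x m + x d) ^ 2)
            + C * (a * ∑ m ∈ Finset.range d, x m ^ 2 + ρ ^ 2 / a)) ∧
      (∀ x, c * ∑ m ∈ Finset.range d, x m ^ 2 ≤ V x) := by
  set q : Polynomial ℂ := ∑ ι ∈ Finset.Icc 1 d,
    Polynomial.C ((k ι : ℂ)) * Polynomial.X ^ (ι - 1) with hq
  set p : Polynomial ℂ := Polynomial.X ^ d + q with hp
  have hqdeg : q.degree < (d : WithBot ℕ) := by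
    rw [hq]
    refine Polynomial.mem_degreeLT.1 (Submodule.sum_mem _ fun ι hι => ?_)
    rw [Finset.mem_Icc] at hι
    refine Polynomial.mem_degreeLT.2 ?_
    refine (Polynomial.degree_C_mul_X_pow_le _ _).trans_lt ?_
    exact_mod_cast (by omega : ι - 1 < d)
  have hmonic : p.Monic := Polynomial.monic_X_pow_add hqdeg
  have hdeg : p.natDegree = d := by
    apply Polynomial.natDegree_eq_of_degree_eq_some
    rw [hp, Polynomial.degree_add_eq_left_of_degree_lt (by rwa [Polynomial.degree_X_pow]),
      Polynomial.degree_X_pow]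
  have hsplit : p.Splits := IsAlgClosed.splits p
  have hprod : (p.roots.map fun z => Polynomial.X - Polynomial.C z).prod = p :=
    (hsplit.eq_prod_roots_of_monic hmonic).symm
  have hcard : Multiset.card p.roots = d := by
    rw [← hsplit.natDegree_eq_card_roots, hdeg]
  have hpair : ∀ x : ℕ → ℝ, coeffPairing p (fun m => (x m : ℂ))
      = ((∑ m ∈ Finset.range d, k (m + 1) * x m + x d : ℝ) : ℂ) := by
    intro x
    have h1 : p.coeff d = 1 := by rw [← hdeg]; exact hmonic
    rw [coeffPairing, hdeg, Finset.sum_range_succ, h1, one_mul]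
    push_cast
    congr 1
    refine Finset.sum_congr rfl fun m hm => ?_
    rw [Finset.mem_range] at hm
    congr 1
    rw [hp, hq]
    simp only [Polynomial.coeff_add, Polynomial.finsetSum_coeff, Polynomial.coeff_C_mul,
      Polynomial.coeff_X_pow]
    rw [if_neg hm.ne, zero_add, Finset.sum_eq_single (m + 1)]
    · simp
    · intro ι hι hne
      rw [Finset.mem_Icc] at hι
      rw [if_neg (by omega), mul_zero]
    · intro h
      exact absurd (Finset.mem_Icc.2 ⟨by omega, by omega⟩) h
  obtain ⟨V, B, c, C, hc, hC, hV, hlin, hbd, hdiss, hpos⟩ :=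
    exists_chain_lyapunov p.roots fun z hz => hk z (Polynomial.isRoot_of_mem_roots hz)
  rw [hcard] at hV hbd hdiss hpos
  rw [hprod] at hdiss
  refine ⟨fun x => V fun m => x m, fun x y => 2 * B (fun m => x m) (fun m => y m),
    min c (2 * c), 2 * C, by positivity, by positivity, ?_, ?_, ?_⟩
  · intro x x' t hx
    exact hV (fun τ m => x τ m) (fun m => x' m) t fun m hm => (hx m hm).ofReal_comp
  · intro x e a ρ he ha
    set e₀ : ℕ → ℂ := fun m => if m = 0 then 1 else 0 with he₀
    have h1 : (fun m => ((e * x (m + 1) + (if m = 0 then ρ else 0) : ℝ) : ℂ))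
        = fun m => (e : ℂ) * (fun m => (x (m + 1) : ℂ)) m + (ρ : ℂ) * e₀ m := by
      funext m
      by_cases hm : m = 0 <;> simp [he₀, hm]
    have h2 : B (fun m => x m) (fun m => ((ρ / a : ℝ) : ℂ) * e₀ m + ((0 : ℝ) : ℂ) * e₀ m)
        = ρ / a * B (fun m => x m) e₀ := by rw [hlin]; ring
    have h3 := hbd (fun m => x m)
      (fun m => ((ρ / a : ℝ) : ℂ) * e₀ m + ((0 : ℝ) : ℂ) * e₀ m)
    rw [h2] at h3
    have h4 : ∑ m ∈ Finset.range d,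
        ‖((ρ / a : ℝ) : ℂ) * e₀ m + ((0 : ℝ) : ℂ) * e₀ m‖ ^ 2 ≤ (ρ / a) ^ 2 := by
      have : ∀ m, ‖((ρ / a : ℝ) : ℂ) * e₀ m + ((0 : ℝ) : ℂ) * e₀ m‖ ^ 2
          = if m = 0 then (ρ / a) ^ 2 else 0 := by
        intro m
        by_cases hm : m = 0
        · simp only [he₀, hm, if_true, mul_one, Complex.ofReal_zero, add_zero,
            Complex.norm_real, Real.norm_eq_abs, sq_abs]
        · simp [he₀, hm]
      simp only [this, Finset.sum_ite_eq']
      split_ifs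
      · exact le_rfl
      · positivity
    have h5 := hdiss fun m => x m
    rw [hpair] at h5
    simp only [Complex.norm_real, Real.norm_eq_abs, sq_abs] at h3 h5
    simp only [h1, hlin]
    set S := ∑ m ∈ Finset.range d, x m ^ 2
    set w := ∑ m ∈ Finset.range d, k (m + 1) * x m + x d
    set b₁ := B (fun m => x m) (fun m => (x (m + 1) : ℂ))
    set b₂ := B (fun m => x m) e₀
    have h6 : ρ * b₂ = a * (ρ / a * b₂) := by field_simp
    have h7 : a * (ρ / a * b₂) ≤ a * (C * (S + (ρ / a) ^ 2)) :=
      mul_le_mul_of_nonneg_left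
        (h3.trans (mul_le_mul_of_nonneg_left (add_le_add le_rfl h4) hC.le)) ha.le
    have h8 : a * (C * (S + (ρ / a) ^ 2)) = C * (a * S + ρ ^ 2 / a) := by field_simp
    have h9 := mul_le_mul_of_nonneg_left h5 he.le
    have hS : 0 ≤ e * S :=
      mul_nonneg he.le (Finset.sum_nonneg fun m _ => sq_nonneg _)
    have h10 := mul_le_mul_of_nonneg_right (min_le_right c (2 * c)) hS
    rw [h8] at h7
    nlinarith
  · intro x
    have h := hpos fun m => x m
    simp only [Complex.norm_real, Real.norm_eq_abs, sq_abs] at h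
    refine le_trans (mul_le_mul_of_nonneg_right (min_le_left _ _)
      (Finset.sum_nonneg fun m _ => sq_nonneg _)) h

/-- Dissipation inequality of one high-order agent tracking its reference `r`, uniformly in the
trajectory; the high gain `1 / ε` yields an arbitrarily large margin `K`. -/
lemma agent_dissipation {n : ℕ} (hn : 1 ≤ n) (k : ℕ → ℝ)
    (hk : ∀ z : ℂ, (Polynomial.X ^ (n - 1) + ∑ ι ∈ Finset.Icc 1 (n - 1),
        Polynomial.C ((k ι : ℂ)) * Polynomial.X ^ (ι - 1)).IsRoot z → z.re < 0)
    (b : ℝ) {δ : ℝ} (hδ : 0 < δ) (K : ℝ) :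
    ∃ εstar, 0 < εstar ∧ ∀ ε, 0 < ε → ε < εstar → ∃ M C : ℝ,
      ∀ y r ρ ζ u η : ℝ → ℝ, ContDiff ℝ (n : ℕ∞) y →
        (∀ t, ζ t =
          (∑ ι ∈ Finset.Icc 1 (n - 1), k ι *
            (if ι = 1 then y t - r t else ε ^ (ι - 1) * iteratedDeriv (ι - 1) y t))
          + (if n = 1 then y t - r t else ε ^ (n - 1) * iteratedDeriv (n - 1) y t)) →
        (∀ t, u t = η t * ζ t) →
        (∀ t, 0 ≤ t → HasDerivAt (iteratedDeriv (n - 1) y) (b * u t) t) →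
        (∀ t, 0 ≤ t → HasDerivAt r (ρ t) t) →
        ∃ U U' X : ℝ → ℝ, (∀ t, 0 ≤ X t) ∧ (∀ t, (y t - r t) ^ 2 ≤ X t + ζ t ^ 2) ∧
          (∀ t, ζ t ^ 2 ≤ 2 * U t) ∧
          (∀ t, ∀ m ≤ n - 1,
            (if m = 0 then y t - r t else ε ^ m * iteratedDeriv m y t) ^ 2 ≤ C * U t) ∧
          (∀ t, 0 ≤ t → HasDerivAt U (U' t) t) ∧
          (∀ t, 0 ≤ t → U' t ≤ ε ^ (n - 1) * b * η t * ζ t ^ 2 - K * X t + M * ζ t ^ 2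
            + δ * ρ t ^ 2) := by
  obtain ⟨d, rfl⟩ : ∃ d, n = d + 1 := ⟨n - 1, by omega⟩
  simp only [Nat.add_sub_cancel] at hk ⊢
  obtain ⟨V, B, c, C, hc, hC, hV, hdiss, hpos⟩ := exists_real_chain_lyapunov d k hk
  set a := 2 * C / δ with ha
  have ha0 : 0 < a := by positivity
  set κ₂ := ∑ m ∈ Finset.range d, k (m + 1) ^ 2 with hκ₂
  have hκ₂0 : 0 ≤ κ₂ := Finset.sum_nonneg fun m _ => sq_nonneg _
  set e := (c / 2) / (κ₂ * (1 + 2 * κ₂) + 1) with he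
  have he0 : 0 < e := by positivity
  have heκ : e * (κ₂ * (1 + 2 * κ₂)) ≤ c / 2 := by
    rw [he, div_mul_eq_mul_div, div_le_iff₀ (by positivity)]
    nlinarith
  set κ := ∑ m ∈ Finset.range d, k (m + 1) * (if m = 0 then (1:ℝ) else 0)
    + (if d = 0 then 1 else 0) with hκ
  refine ⟨c / (2 * (|K| + C * a)), by positivity, fun ε hε hεlt => ?_⟩
  refine ⟨1 / ε * (C + 2 * (e * κ₂) + 1 / (4 * e)) + κ ^ 2 / (2 * δ),
    4 + (1 + 2 * κ₂) / c, ?_⟩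
  intro y r ρ ζ u η hy hζ hu hyd hr
  set x : ℝ → ℕ → ℝ := fun t m => if m = 0 then y t - r t else ε ^ m * iteratedDeriv m y t
    with hx
  have hζ' : ∀ t, ζ t = ∑ m ∈ Finset.range d, k (m + 1) * x t m + x t d := by
    intro t
    rw [hζ t, sum_Icc_one_eq_sum_range]
    simp [hx]
  set S : ℝ → ℝ := fun t => ∑ m ∈ Finset.range d, x t m ^ 2 with hS
  have hS0 : ∀ t, 0 ≤ S t := fun t => Finset.sum_nonneg fun m _ => sq_nonneg _
  have hxd : ∀ t, x t d ^ 2 ≤ 2 * ζ t ^ 2 + 2 * κ₂ * S t := by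
    intro t
    have h1 : (∑ m ∈ Finset.range d, k (m + 1) * x t m) ^ 2 ≤ κ₂ * S t :=
      Finset.sum_mul_sq_le_sq_mul_sq _ _ _
    have h2 : x t d = ζ t - ∑ m ∈ Finset.range d, k (m + 1) * x t m := by rw [hζ' t]; ring
    rw [h2]
    nlinarith [sq_nonneg (ζ t + ∑ m ∈ Finset.range d, k (m + 1) * x t m)]
  have hxm : ∀ t, ∀ m < d, x t m ^ 2 ≤ S t := fun t m hm =>
    Finset.single_le_sum (f := fun m => x t m ^ 2) (fun _ _ => sq_nonneg _)
      (Finset.mem_range.2 hm)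
  have hw : ∀ t, (∑ m ∈ Finset.range d, k (m + 1) * x t (m + 1)) ^ 2
      ≤ κ₂ * ((1 + 2 * κ₂) * S t + 2 * ζ t ^ 2) := by
    intro t
    refine (Finset.sum_mul_sq_le_sq_mul_sq _ _ _).trans (mul_le_mul_of_nonneg_left ?_ hκ₂0)
    have h1 := Finset.sum_range_succ' (fun m => x t m ^ 2) d
    rw [Finset.sum_range_succ] at h1
    have h2 := hxd t
    change S t + _ = _ at h1
    nlinarith [sq_nonneg (x t 0)]
  have hdx : ∀ t, 0 ≤ t → ∀ m < d,
      HasDerivAt (fun τ => x τ m) (1 / ε * x t (m + 1) + (if m = 0 then -ρ t else 0)) t := by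
    intro t ht m hm
    have h1 : HasDerivAt (iteratedDeriv m y) (iteratedDeriv (m + 1) y t) t := by
      rw [iteratedDeriv_succ]
      refine DifferentiableAt.hasDerivAt ?_
      refine (hy.differentiable_iteratedDeriv m ?_).differentiableAt
      exact_mod_cast (by omega : m < d + 1)
    by_cases h0 : m = 0
    · subst h0
      simp only [hx, if_true, iteratedDeriv_zero] at h1 ⊢
      refine (h1.sub (hr t ht)).congr_deriv ?_
      simp
      field_simp
      ring
    · simp only [hx, h0, if_false]
      refine (h1.const_mul (ε ^ m)).congr_deriv ?_
      simp only [Nat.succ_ne_zero, if_false, pow_succ]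
      field_simp
      ring
  have hdd : ∀ t, 0 ≤ t → HasDerivAt (fun τ => x τ d)
      (ε ^ d * (b * u t) + (if d = 0 then -ρ t else 0)) t := by
    intro t ht
    have h1 := hyd t ht
    by_cases h0 : d = 0
    · simp only [hx, h0, if_true, iteratedDeriv_zero] at h1 ⊢
      refine (h1.sub (hr t ht)).congr_deriv ?_
      simp
      ring
    · simp only [hx, h0, if_false]
      refine (h1.const_mul (ε ^ d)).congr_deriv ?_
      ring
  set w : ℝ → ℝ := fun t => ∑ m ∈ Finset.range d, k (m + 1) * x t (m + 1) with hwdef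
  have hdζ : ∀ t, 0 ≤ t →
      HasDerivAt ζ (ε ^ d * b * η t * ζ t + 1 / ε * w t - κ * ρ t) t := by
    intro t ht
    have h1 : HasDerivAt ζ
        (∑ m ∈ Finset.range d, k (m + 1) * (1 / ε * x t (m + 1) + (if m = 0 then -ρ t else 0))
          + (ε ^ d * (b * u t) + (if d = 0 then -ρ t else 0))) t := by
      rw [show ζ = fun τ => ∑ m ∈ Finset.range d, k (m + 1) * x τ m + x τ d from funext hζ']
      exact (HasDerivAt.fun_sum fun m hm =>
        (hdx t ht m (Finset.mem_range.1 hm)).const_mul _).add (hdd t ht)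
    refine h1.congr_deriv ?_
    rw [hu t, hκ, add_mul, Finset.sum_mul, hwdef]
    have h2 : ∀ m, k (m + 1) * (1 / ε * x t (m + 1) + (if m = 0 then -ρ t else 0))
        = 1 / ε * (k (m + 1) * x t (m + 1))
          - k (m + 1) * (if m = 0 then 1 else 0) * ρ t := by
      intro m
      split_ifs <;> ring
    simp only [h2, Finset.sum_sub_distrib, ← Finset.mul_sum]
    split_ifs <;> ring
  refine ⟨fun t => V (x t) + ζ t ^ 2 / 2,
    fun t => B (x t) (fun m => 1 / ε * x t (m + 1) + (if m = 0 then -ρ t else 0))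
      + ζ t * (ε ^ d * b * η t * ζ t + 1 / ε * w t - κ * ρ t), S, hS0, ?_, ?_, ?_, ?_, ?_⟩
  · intro t
    have hx0 : y t - r t = x t 0 := by simp [hx]
    rw [hx0]
    rcases Nat.eq_zero_or_pos d with h0 | h0
    · have h1 := hζ' t
      simp only [h0, Finset.range_zero, Finset.sum_empty, zero_add] at h1
      rw [h1]
      linarith [hS0 t]
    · linarith [hxm t 0 h0, sq_nonneg (ζ t)]
  · intro t
    have := hpos (x t)
    have := mul_nonneg hc.le (hS0 t)
    simp only
    linarith
  · intro t m hm
    change x t m ^ 2 ≤ _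
    have h1 := hpos (x t)
    change c * S t ≤ _ at h1
    have h2 : S t ≤ V (x t) / c := by rw [le_div_iff₀ hc]; linarith
    have h3 : x t m ^ 2 ≤ (1 + 2 * κ₂) * S t + 2 * ζ t ^ 2 := by
      rcases hm.lt_or_eq with h | h
      · nlinarith [hxm t m h, mul_nonneg hκ₂0 (hS0 t), sq_nonneg (ζ t)]
      · rw [h]; linarith [hxd t, hS0 t]
    have h4 : (1 + 2 * κ₂) * S t ≤ (1 + 2 * κ₂) * (V (x t) / c) :=
      mul_le_mul_of_nonneg_left h2 (by positivity)
    have h5 : 0 ≤ V (x t) := (mul_nonneg hc.le (hS0 t)).trans h1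
    have h6 : 0 ≤ (1 + 2 * κ₂) / c * (ζ t ^ 2 / 2) := by positivity
    have h7 : (4 + (1 + 2 * κ₂) / c) * (V (x t) + ζ t ^ 2 / 2)
        = 4 * V (x t) + 2 * ζ t ^ 2 + (1 + 2 * κ₂) * (V (x t) / c)
          + (1 + 2 * κ₂) / c * (ζ t ^ 2 / 2) := by ring
    rw [h7]
    linarith
  · intro t ht
    have h1 := hV x (fun m => 1 / ε * x t (m + 1) + (if m = 0 then -ρ t else 0)) t (hdx t ht)
    refine (h1.add (((hdζ t ht).pow 2).div_const 2)).congr_deriv ?_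
    simp
    ring
  · intro t ht
    have h1 := hdiss (x t) (1 / ε) a (-ρ t) (by positivity) ha0
    rw [← hζ' t] at h1
    change _ ≤ 1 / ε * (-c * S t + _) + C * (a * S t + _) at h1
    have h2 : C * (a * S t + (-ρ t) ^ 2 / a) = C * a * S t + δ / 2 * ρ t ^ 2 := by
      rw [ha]; field_simp
    rw [h2] at h1
    have h3 : ζ t * w t ≤ e * (κ₂ * ((1 + 2 * κ₂) * S t + 2 * ζ t ^ 2))
        + 1 / (4 * e) * ζ t ^ 2 := by
      have h4 : e * w t ^ 2 + 1 / (4 * e) * ζ t ^ 2 - ζ t * w t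
          = e * (w t - ζ t / (2 * e)) ^ 2 := by field_simp; ring
      have h5 := mul_le_mul_of_nonneg_left (hw t) he0.le
      change e * w t ^ 2 ≤ _ at h5
      linarith [mul_nonneg he0.le (sq_nonneg (w t - ζ t / (2 * e)))]
    have h4 : -(ζ t * (κ * ρ t)) ≤ δ / 2 * ρ t ^ 2 + κ ^ 2 / (2 * δ) * ζ t ^ 2 := by
      have : δ / 2 * ρ t ^ 2 + κ ^ 2 / (2 * δ) * ζ t ^ 2 + ζ t * (κ * ρ t)
          = δ / 2 * (ρ t + κ * ζ t / δ) ^ 2 := by field_simp; ring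
      linarith [mul_nonneg (half_pos hδ).le (sq_nonneg (ρ t + κ * ζ t / δ))]
    have h5 : e * (κ₂ * ((1 + 2 * κ₂) * S t)) ≤ c / 2 * S t := by
      have := mul_le_mul_of_nonneg_right heκ (hS0 t)
      linarith
    have h6 : ζ t * w t ≤ c / 2 * S t + (2 * (e * κ₂) + 1 / (4 * e)) * ζ t ^ 2 := by linarith
    have h7 := mul_le_mul_of_nonneg_left h6 (one_div_pos.2 hε).le
    have h8 : K + C * a ≤ c / 2 * (1 / ε) := by
      rw [lt_div_iff₀ (by positivity)] at hεlt
      rw [mul_one_div, le_div_iff₀ hε]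
      nlinarith [le_abs_self K]
    have h9 := mul_le_mul_of_nonneg_right h8 (hS0 t)
    simp only
    nlinarith

lemma sum_digraphLap_sq_le_sum_sq {N : ℕ} {A : Fin N → Fin N → ℝ} (hA : ∀ i j, 0 ≤ A i j) :
    ∃ C, 0 < C ∧ ∀ x : Fin N → ℝ, ∑ i, digraphLap A x i ^ 2 ≤ C * ∑ i, x i ^ 2 := by
  obtain ⟨C, hC, h⟩ := sum_digraphLap_sq_le hA
  set a := ∑ i, ∑ j, A i j with ha
  have ha0 : 0 ≤ a := Finset.sum_nonneg fun i _ => Finset.sum_nonneg fun j _ => hA i j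
  refine ⟨C * (4 * a + 1), by positivity, fun x => (h x).trans ?_⟩
  rw [mul_assoc]
  refine mul_le_mul_of_nonneg_left ?_ hC.le
  have hx : 0 ≤ ∑ i, x i ^ 2 := Finset.sum_nonneg fun i _ => sq_nonneg _
  have h1 : digraphEnergy A x ≤ a * (4 * ∑ i, x i ^ 2) := by
    rw [ha]
    simp only [digraphEnergy, Finset.sum_mul]
    refine Finset.sum_le_sum fun i _ => Finset.sum_le_sum fun j _ =>
      mul_le_mul_of_nonneg_left ?_ (hA i j)
    have hi := Finset.single_le_sum (f := fun i => x i ^ 2) (fun _ _ => sq_nonneg _)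
      (Finset.mem_univ i)
    have hj := Finset.single_le_sum (f := fun i => x i ^ 2) (fun _ _ => sq_nonneg _)
      (Finset.mem_univ j)
    nlinarith [sq_nonneg (x i + x j)]
  linarith

/-- A Lyapunov function of the whole closed loop. Along trajectories it dissipates `Y`, up to the
terms driven by the squares of the `ζ i`. -/
lemma closed_loop_lyapunov {N : ℕ} (hN : 0 < N) {A : Fin N → Fin N → ℝ}
    (hA : ∀ i j, 0 ≤ A i j) (hbal : ∀ i, ∑ j, A i j = ∑ j, A j i)
    (hconn : ∀ i j : Fin N, i ≠ j →
      Relation.TransGen (fun p q : Fin N => 0 < A q p) i j)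
    {f' : Fin N → ℝ → ℝ} {l L : ℝ} (hl : 0 < l)
    (hsc : ∀ i a c, l * (a - c) ^ 2 ≤ (f' i a - f' i c) * (a - c))
    (hlip : ∀ i a c, |f' i a - f' i c| ≤ L * |a - c|)
    {ystar : ℝ} (hstar : ∑ i, f' i ystar = 0)
    {n : Fin N → ℕ} (hn : ∀ i, 1 ≤ n i) (b : Fin N → ℝ) {k : Fin N → ℕ → ℝ}
    (hk : ∀ i, ∀ z : ℂ,
      (Polynomial.X ^ (n i - 1) + ∑ ι ∈ Finset.Icc 1 (n i - 1),
        Polynomial.C ((k i ι : ℂ)) * Polynomial.X ^ (ι - 1)).IsRoot z → z.re < 0) :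
    ∃ β εstar : ℝ, 0 < β ∧ 0 < εstar ∧ ∀ ε : ℝ, 0 < ε → ε < εstar →
      ∃ (M : Fin N → ℝ) (C : ℝ), 0 < C ∧
      ∀ (y u η r v ζ : Fin N → ℝ → ℝ),
        (∀ i, ContDiff ℝ (n i : ℕ∞) (y i)) →
        (∀ i t, ζ i t =
          (∑ ι ∈ Finset.Icc 1 (n i - 1), k i ι *
            (if ι = 1 then y i t - r i t
             else ε ^ (ι - 1) * iteratedDeriv (ι - 1) (y i) t))
          + (if n i = 1 then y i t - r i t
             else ε ^ (n i - 1) * iteratedDeriv (n i - 1) (y i) t)) →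
        (∀ i t, u i t = η i t * ζ i t) →
        (∀ i t, 0 ≤ t →
          HasDerivAt (iteratedDeriv (n i - 1) (y i)) (b i * u i t) t) →
        (∀ i t, 0 ≤ t → HasDerivAt (r i)
          (-f' i (y i t) - β * digraphLap A (fun j => r j t) i
            - digraphLap A (fun j => v j t) i) t) →
        (∀ i t, 0 ≤ t → HasDerivAt (v i) (β * digraphLap A (fun j => r j t) i) t) →
        ∃ (W W' Y : ℝ → ℝ) (vstar : Fin N → ℝ),
          (∀ t, 0 ≤ t → HasDerivAt W (W' t) t) ∧ (∀ t, 0 ≤ W t) ∧ (∀ t, 0 ≤ Y t) ∧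
          (∀ t, 0 ≤ t → W' t ≤ -Y t
            + ∑ i, (ε ^ (n i - 1) * b i * η i t + M i) * ζ i t ^ 2) ∧
          (∀ t i, (y i t - ystar) ^ 2 ≤ C * (Y t + ∑ i, ζ i t ^ 2)) ∧
          (∀ t i, (r i t - ystar) ^ 2 ≤ C * W t) ∧
          (∀ t i, (r i t - ystar + (v i t - vstar i)) ^ 2 ≤ C * W t) ∧
          (∀ t i, ζ i t ^ 2 ≤ C * W t) ∧
          (∀ t i, ∀ m ≤ n i - 1, (if m = 0 then y i t - r i t
            else ε ^ m * iteratedDeriv m (y i) t) ^ 2 ≤ C * W t) := by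
  obtain ⟨β, γ, c, Cg, hβ, hγ, hc, hCg, hgen⟩ :=
    generator_dissipation hN hA hbal hconn (L := L) hl
  obtain ⟨CL, hCL, hLap⟩ := sum_digraphLap_sq_le_sum_sq hA
  set Cρ := 4 * (L ^ 2 + 1 + (β - 1) ^ 2 * CL + CL) with hCρ
  have hCρ0 : 0 < Cρ := by positivity
  set δ := c / (2 * Cρ) with hδ
  have hδ0 : 0 < δ := by positivity
  have hδC : δ * Cρ = c / 2 := by rw [hδ]; field_simp
  set K₀ := (Cg + c / 2) * L ^ 2 with hK₀
  have hK₀0 : 0 ≤ K₀ := by positivity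
  choose es hes hagent using fun i => agent_dissipation (hn i) (k i) (hk i) (b i) hδ0 (K₀ + 1)
  obtain ⟨j₀, -, hj₀⟩ := Finset.exists_min_image Finset.univ es ⟨⟨0, hN⟩, Finset.mem_univ _⟩
  refine ⟨β, es j₀, hβ, hes j₀, fun ε hε hεs => ?_⟩
  choose M C hagent using fun i => hagent i ε hε (hεs.trans_le (hj₀ i (Finset.mem_univ i)))
  set Cs := ∑ i, |C i| with hCs
  have hCs0 : 0 ≤ Cs := Finset.sum_nonneg fun i _ => abs_nonneg _
  refine ⟨fun i => M i + K₀, 4 / c + 2 + 2 / γ + Cs, by positivity, ?_⟩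
  intro y u η r v ζ hy hζ hu hyd hr hv
  choose U U' X hX hyX hζU hxU hU hU' using fun i =>
    hagent i (y i) (r i) _ (ζ i) (u i) (η i) (hy i) (hζ i) (hu i) (hyd i) (hr i)
  obtain ⟨vs, hvs, hvsum⟩ := exists_digraphLap_eq hN hA hbal hconn (fun i => -f' i ystar)
    (by simp [hstar]) (∑ i, v i 0)
  set rt : ℝ → Fin N → ℝ := fun t i => r i t - ystar with hrt
  set zt : ℝ → Fin N → ℝ := fun t i => r i t - ystar + (v i t - vs i) with hzt
  set h : ℝ → Fin N → ℝ := fun t i => f' i (r i t) - f' i ystar with hh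
  set d : ℝ → Fin N → ℝ := fun t i => f' i (y i t) - f' i (r i t) with hd
  have hLr : ∀ t i, digraphLap A (fun j => r j t) i = digraphLap A (rt t) i := by
    intro t i
    simp only [digraphLap, hrt]
    exact Finset.sum_congr rfl fun j _ => by ring
  have hLv : ∀ t i, digraphLap A (fun j => v j t) i
      = digraphLap A (zt t) i - digraphLap A (rt t) i - f' i ystar := by
    intro t i
    rw [sub_eq_add_neg _ (f' i ystar), ← hvs i]
    simp only [digraphLap, hrt, hzt, ← Finset.sum_sub_distrib, ← Finset.sum_add_distrib]
    exact Finset.sum_congr rfl fun j _ => by ring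
  set ρ : ℝ → Fin N → ℝ := fun t i => -(h t i + d t i) - β * digraphLap A (rt t) i
      - (digraphLap A (zt t) i - digraphLap A (rt t) i) with hρ
  have hρeq : ∀ t i, -f' i (y i t) - β * digraphLap A (fun j => r j t) i
      - digraphLap A (fun j => v j t) i = ρ t i := by
    intro t i
    rw [hLr, hLv]
    simp only [hρ, hh, hd]
    ring
  simp only [hρeq] at hr hU'
  have hv' : ∀ i t, 0 ≤ t → HasDerivAt (v i) (β * digraphLap A (rt t) i) t := by
    intro i t ht
    rw [← hLr]
    exact hv i t ht
  have hdz : ∀ i t, 0 ≤ t → HasDerivAt (fun τ => zt τ i)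
      (-(h t i + d t i) - (digraphLap A (zt t) i - digraphLap A (rt t) i)) t := by
    intro i t ht
    refine (((hr i t ht).sub_const ystar).add ((hv' i t ht).sub_const (vs i))).congr_deriv ?_
    simp only [hρ]
    ring
  have hdr : ∀ i t, 0 ≤ t → HasDerivAt (fun τ => rt τ i) (ρ t i) t := fun i t ht =>
    (hr i t ht).sub_const ystar
  have hvconst : ∀ t, 0 ≤ t → ∑ i, v i t = ∑ i, v i 0 := by
    have hder : ∀ t, 0 ≤ t → HasDerivAt (fun τ => ∑ i, v i τ) 0 t := by
      intro t ht
      refine (HasDerivAt.fun_sum fun i _ => hv' i t ht).congr_deriv ?_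
      rw [← Finset.mul_sum, sum_digraphLap hbal, mul_zero]
    intro t ht
    have h1 := monotoneOn_Ici_of_hasDerivAt_nonneg hder (fun _ _ => le_rfl)
      (Set.mem_Ici.2 le_rfl) (Set.mem_Ici.2 ht) ht
    have h2 := monotoneOn_Ici_of_hasDerivAt_nonneg (fun t ht => (hder t ht).neg)
      (fun _ _ => by simp) (Set.mem_Ici.2 le_rfl) (Set.mem_Ici.2 ht) ht
    simp only [Pi.neg_apply] at h1 h2
    linarith
  have hzr : ∀ t, 0 ≤ t → ∑ i, zt t i = ∑ i, rt t i := by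
    intro t ht
    simp only [hzt, Finset.sum_add_distrib, Finset.sum_sub_distrib]
    rw [hvconst t ht, hvsum]
    simp [hrt]
  set R : ℝ → ℝ := fun t => ∑ i, rt t i ^ 2 with hR
  set Z : ℝ → ℝ := fun t => ∑ i, zt t i ^ 2 with hZ
  have hR0 : ∀ t, 0 ≤ R t := fun t => Finset.sum_nonneg fun i _ => sq_nonneg _
  have hZ0 : ∀ t, 0 ≤ Z t := fun t => Finset.sum_nonneg fun i _ => sq_nonneg _
  have hD : ∀ t, ∑ i, d t i ^ 2 ≤ L ^ 2 * (∑ i, X i t + ∑ i, ζ i t ^ 2) := by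
    intro t
    rw [← Finset.sum_add_distrib, Finset.mul_sum]
    refine Finset.sum_le_sum fun i _ => ?_
    have h1 := pow_le_pow_left₀ (abs_nonneg _) (hlip i (y i t) (r i t)) 2
    rw [sq_abs, mul_pow, sq_abs] at h1
    exact h1.trans (mul_le_mul_of_nonneg_left (hyX i t) (sq_nonneg _))
  have hH : ∀ t, ∑ i, h t i ^ 2 ≤ L ^ 2 * R t := by
    intro t
    rw [hR, Finset.mul_sum]
    refine Finset.sum_le_sum fun i _ => ?_
    have h1 := pow_le_pow_left₀ (abs_nonneg _) (hlip i (r i t) ystar) 2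
    rwa [sq_abs, mul_pow, sq_abs] at h1
  have hρbd : ∀ t, ∑ i, ρ t i ^ 2 ≤ Cρ * (R t + Z t + ∑ i, d t i ^ 2) := by
    intro t
    have h1 : ∑ i, ρ t i ^ 2 ≤ 4 * (∑ i, h t i ^ 2 + ∑ i, d t i ^ 2
        + (β - 1) ^ 2 * ∑ i, digraphLap A (rt t) i ^ 2 + ∑ i, digraphLap A (zt t) i ^ 2) := by
      rw [Finset.mul_sum, ← Finset.sum_add_distrib, ← Finset.sum_add_distrib,
        ← Finset.sum_add_distrib, Finset.mul_sum]
      refine Finset.sum_le_sum fun i _ => ?_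
      have : ∀ p q s w : ℝ, (p + q + s + w) ^ 2 ≤ 4 * (p ^ 2 + q ^ 2 + s ^ 2 + w ^ 2) := by
        intro p q s w
        nlinarith [sq_nonneg (p - q), sq_nonneg (p - s), sq_nonneg (p - w), sq_nonneg (q - s),
          sq_nonneg (q - w), sq_nonneg (s - w)]
      have h2 := this (h t i) (d t i) ((β - 1) * digraphLap A (rt t) i) (digraphLap A (zt t) i)
      rw [mul_pow] at h2
      refine le_trans (le_of_eq ?_) h2
      simp only [hρ]
      ring
    have h2 := hH t
    have h3 := mul_le_mul_of_nonneg_left (hLap (rt t)) (sq_nonneg (β - 1))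
    have h4 := hLap (zt t)
    have hD0 : 0 ≤ ∑ i, d t i ^ 2 := Finset.sum_nonneg fun i _ => sq_nonneg _
    change _ ≤ (β - 1) ^ 2 * (CL * R t) at h3
    change _ ≤ CL * Z t at h4
    have p1 : 0 ≤ (1 + CL) * R t := mul_nonneg (by positivity) (hR0 t)
    have p2 : 0 ≤ (L ^ 2 + 1 + (β - 1) ^ 2 * CL) * Z t := mul_nonneg (by positivity) (hZ0 t)
    have p3 : 0 ≤ (L ^ 2 + (β - 1) ^ 2 * CL + CL) * ∑ i, d t i ^ 2 :=
      mul_nonneg (by positivity) hD0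
    rw [hCρ]
    linarith
  set W : ℝ → ℝ := fun t => R t / 2 + γ * (Z t / 2) + ∑ i, U i t with hW
  have hU0 : ∀ i t, 0 ≤ U i t := fun i t => by linarith [hζU i t, sq_nonneg (ζ i t)]
  have hUs0 : ∀ t, 0 ≤ ∑ i, U i t := fun t => Finset.sum_nonneg fun i _ => hU0 i t
  have hX0 : ∀ t, 0 ≤ ∑ i, X i t := fun t => Finset.sum_nonneg fun i _ => hX i t
  have hζ0 : ∀ t, 0 ≤ ∑ i, ζ i t ^ 2 := fun t => Finset.sum_nonneg fun i _ => sq_nonneg _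
  have hγZ : ∀ t, 0 ≤ γ * (Z t / 2) := fun t => mul_nonneg hγ.le (by linarith [hZ0 t])
  have hW0 : ∀ t, 0 ≤ W t := fun t => by
    simp only [hW]; linarith [hR0 t, hγZ t, hUs0 t]
  have hUW : ∀ i t, U i t ≤ W t := fun i t => by
    have := Finset.single_le_sum (f := fun i => U i t) (fun i _ => hU0 i t) (Finset.mem_univ i)
    simp only [hW]
    linarith [hR0 t, hγZ t]
  have hri : ∀ t i, rt t i ^ 2 ≤ R t := fun t i =>
    Finset.single_le_sum (f := fun i => rt t i ^ 2) (fun _ _ => sq_nonneg _) (Finset.mem_univ i)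
  have hzi : ∀ t i, zt t i ^ 2 ≤ Z t := fun t i =>
    Finset.single_le_sum (f := fun i => zt t i ^ 2) (fun _ _ => sq_nonneg _) (Finset.mem_univ i)
  have hCW : ∀ q t, q ≤ 4 / c + 2 + 2 / γ + Cs → q * W t ≤ (4 / c + 2 + 2 / γ + Cs) * W t :=
    fun q t hq => mul_le_mul_of_nonneg_right hq (hW0 t)
  have hc4 : 0 < 4 / c := by positivity
  have hγ2 : 0 < 2 / γ := by positivity
  refine ⟨W, fun t => ∑ i, rt t i * ρ t i
      + γ * ∑ i, zt t i * (-(h t i + d t i) - (digraphLap A (zt t) i - digraphLap A (rt t) i))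
      + ∑ i, U' i t,
    fun t => c / 2 * (R t + Z t) + ∑ i, X i t, vs, ?_, hW0, ?_, ?_, ?_, ?_, ?_, ?_, ?_⟩
  · intro t ht
    have h1 : HasDerivAt (fun τ => R τ / 2) (∑ i, rt t i * ρ t i) t := by
      refine ((HasDerivAt.fun_sum fun i _ => (hdr i t ht).fun_pow 2).div_const 2).congr_deriv ?_
      rw [Finset.sum_div]
      exact Finset.sum_congr rfl fun i _ => by simp; ring
    have h2 : HasDerivAt (fun τ => Z τ / 2) (∑ i, zt t i *
        (-(h t i + d t i) - (digraphLap A (zt t) i - digraphLap A (rt t) i))) t := by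
      refine ((HasDerivAt.fun_sum fun i _ => (hdz i t ht).fun_pow 2).div_const 2).congr_deriv ?_
      rw [Finset.sum_div]
      exact Finset.sum_congr rfl fun i _ => by simp; ring
    exact (h1.add (h2.const_mul γ)).add (HasDerivAt.fun_sum fun i _ => hU i t ht)
  · intro t
    have := mul_nonneg (half_pos hc).le (add_nonneg (hR0 t) (hZ0 t))
    simp only
    linarith [hX0 t]
  · intro t ht
    have h1 := hgen (rt t) (zt t) (h t) (d t) (hzr t ht) (fun i => hsc i (r i t) ystar)
      (fun i => hlip i (r i t) ystar)
    change ∑ i, rt t i * ρ t i + _ ≤ -c * (R t + Z t) + _ at h1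
    have h2 : ∑ i, U' i t ≤ ∑ i, (ε ^ (n i - 1) * b i * η i t + M i) * ζ i t ^ 2
        - (K₀ + 1) * ∑ i, X i t + δ * ∑ i, ρ t i ^ 2 := by
      rw [Finset.mul_sum, Finset.mul_sum, ← Finset.sum_sub_distrib, ← Finset.sum_add_distrib]
      exact Finset.sum_le_sum fun i _ => (hU' i t ht).trans (le_of_eq (by ring))
    have h3 : ∑ i, (ε ^ (n i - 1) * b i * η i t + (M i + K₀)) * ζ i t ^ 2
        = ∑ i, (ε ^ (n i - 1) * b i * η i t + M i) * ζ i t ^ 2 + K₀ * ∑ i, ζ i t ^ 2 := by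
      rw [Finset.mul_sum, ← Finset.sum_add_distrib]
      exact Finset.sum_congr rfl fun i _ => by ring
    have h4 := mul_le_mul_of_nonneg_left (hρbd t) hδ0.le
    rw [← mul_assoc, hδC] at h4
    have h5 := mul_le_mul_of_nonneg_left (hD t) (by positivity : 0 ≤ Cg + c / 2)
    rw [← mul_assoc, ← hK₀] at h5
    rw [h3]
    linarith
  · intro t i
    have h1 : (y i t - ystar) ^ 2 ≤ 2 * rt t i ^ 2 + 2 * (y i t - r i t) ^ 2 := by
      simp only [hrt]
      nlinarith [sq_nonneg ((r i t - ystar) - (y i t - r i t))]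
    have h2 := hyX i t
    have h3 := hri t i
    have h4 := Finset.single_le_sum (f := fun i => X i t) (fun i _ => hX i t) (Finset.mem_univ i)
    have h5 := Finset.single_le_sum (f := fun i => ζ i t ^ 2) (fun i _ => sq_nonneg (ζ i t))
      (Finset.mem_univ i)
    have h6 : 4 / c * (c / 2 * (R t + Z t)) = 2 * (R t + Z t) := by field_simp; norm_num
    have h7 : 0 ≤ 4 / c * (∑ i, X i t + ∑ i, ζ i t ^ 2) :=
      mul_nonneg hc4.le (add_nonneg (hX0 t) (hζ0 t))
    have h8 : 0 ≤ c / 2 * (R t + Z t) :=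
      mul_nonneg (half_pos hc).le (add_nonneg (hR0 t) (hZ0 t))
    have h9 : 0 ≤ (2 / γ + Cs) * (c / 2 * (R t + Z t) + ∑ i, X i t + ∑ i, ζ i t ^ 2) :=
      mul_nonneg (by positivity) (add_nonneg (add_nonneg h8 (hX0 t)) (hζ0 t))
    linarith [hZ0 t]
  · intro t i
    refine le_trans ?_ (hCW 2 t (by linarith))
    have h1 := hri t i
    change rt t i ^ 2 ≤ _
    simp only [hW]
    linarith [hγZ t, hUs0 t]
  · intro t i
    refine le_trans ?_ (hCW (2 / γ) t (by linarith))
    have h1 := hzi t i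
    change zt t i ^ 2 ≤ _
    have h2 : 2 / γ * (γ * (Z t / 2)) = Z t := by field_simp
    have h3 : 0 ≤ 2 / γ * (R t / 2 + ∑ i, U i t) :=
      mul_nonneg hγ2.le (by linarith [hR0 t, hUs0 t])
    simp only [hW]
    linarith
  · intro t i
    refine le_trans ?_ (hCW 2 t (by linarith))
    linarith [hζU i t, hUW i t]
  · intro t i m hm
    have h1 := Finset.single_le_sum (f := fun i => |C i|) (fun _ _ => abs_nonneg _)
      (Finset.mem_univ i)
    refine le_trans ?_ (hCW Cs t (by linarith))
    calc _ ≤ C i * U i t := hxU i t m hm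
      _ ≤ |C i| * U i t := mul_le_mul_of_nonneg_right (le_abs_self _) (hU0 i t)
      _ ≤ Cs * W t := mul_le_mul h1 (hUW i t) (hU0 i t) hCs0

/-- The version of `bounded_of_nussbaum` where the common sign of the coefficients is unknown. -/
lemma bounded_of_nussbaum_of_same_sign {N : ℕ} {Nb : ℝ → ℝ} (hNb : Continuous Nb)
    (hplus : Tendsto (fun θ : ℝ => (∫ s in (0:ℝ)..θ, max (Nb s) 0) / θ) atTop atTop)
    (hminus : Tendsto (fun θ : ℝ => (∫ s in (0:ℝ)..θ, max (-Nb s) 0) / θ) atTop atTop)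
    (hratio₁ : ∀ M : ℝ, ∃ᶠ θ in atTop,
      M < (∫ s in (0:ℝ)..θ, max (Nb s) 0) / (∫ s in (0:ℝ)..θ, max (-Nb s) 0))
    (hratio₂ : ∀ M : ℝ, ∃ᶠ θ in atTop,
      M < (∫ s in (0:ℝ)..θ, max (-Nb s) 0) / (∫ s in (0:ℝ)..θ, max (Nb s) 0))
    {g M : Fin N → ℝ} (hg : (∀ i, 0 < g i) ∨ ∀ i, g i < 0) {th : Fin N → ℝ → ℝ}
    (hcont : ∀ i, ContinuousOn (th i) (Set.Ici 0)) (hmono : ∀ i, MonotoneOn (th i) (Set.Ici 0))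
    {K : ℝ} (hK : ∀ t, 0 ≤ t →
      K ≤ ∑ i, (g i * (∫ s in (0:ℝ)..(th i t), Nb s) + M i * th i t)) :
    ∃ B, ∀ t, 0 ≤ t → ∀ i, |th i t| ≤ B := by
  rcases hg with hg | hg
  · exact bounded_of_nussbaum hNb hplus hratio₂ hg hcont hmono hK
  · refine bounded_of_nussbaum (Nb := fun s => -Nb s) (g := fun i => -g i) (M := M) (K := K)
      hNb.neg hminus (fun M => ?_) (fun i => neg_pos.2 (hg i)) hcont hmono (fun t ht => ?_)
    · simpa only [neg_neg] using hratio₁ M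
    · simpa only [intervalIntegral.integral_neg, neg_mul_neg] using hK t ht

lemma exists_uniform_bound {N : ℕ} {q : Fin N → ℝ → ℝ}
    (h : ∀ i, ∃ B, ∀ t, 0 ≤ t → |q i t| ≤ B) : ∃ B, ∀ t, 0 ≤ t → ∀ i, |q i t| ≤ B := by
  choose B hB using h
  exact ⟨∑ i, |B i|, fun t ht i => (hB i t ht).trans ((le_abs_self _).trans
    (Finset.single_le_sum (f := fun i => |B i|) (fun _ _ => abs_nonneg _) (Finset.mem_univ i)))⟩

lemma abs_le_add_of_sq_le {x y B : ℝ} (h : (x - y) ^ 2 ≤ B) : |x| ≤ √B + |y| := by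
  have h1 := Real.abs_le_sqrt h
  have h2 := abs_add_le (x - y) y
  rw [sub_add_cancel] at h2
  linarith

/-- Theorem 2: optimal consensus with real-time gradients. For agents
`y_i^{(n_i)} = b_i u_i` whose unknown gains `b_i` all have the same sign, over a
weight-balanced strongly connected digraph, with strongly convex local costs
(Lipschitz gradients), a smooth function `N̄` satisfying the strengthened Nussbaum
conditions on `N̄₊ = max{N̄,0}` and `N̄₋ = max{−N̄,0}`, and Hurwitz coefficients
`k_{iι}`, there exist `α, β > 0` and `ε* > 0` such that for any `0 < ε < ε*`, along
any closed-loop trajectory of the real-time-gradient controller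
`u_i = N̄(θ_i)ζ_i`, `θ̇_i = ζ_i²`,
`ṙ_i = −αf_i'(y_i) − βΣ_j a_{ij}(r_i−r_j) − Σ_j a_{ij}(v_i−v_j)`,
`v̇_i = αβΣ_j a_{ij}(r_i−r_j)`, all states are bounded on `[0,∞)` and
`y_i(t) → y*` for every `i`. -/
theorem optimal_consensus_realtime_gradient
    (N : ℕ) (hN : 2 ≤ N)
    (A : Fin N → Fin N → ℝ)
    (hAdiag : ∀ i, A i i = 0) (hAnn : ∀ i j, 0 ≤ A i j)
    (hbal : ∀ i, ∑ j, A i j = ∑ j, A j i)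
    (hconn : ∀ i j : Fin N, i ≠ j →
      Relation.TransGen (fun p q : Fin N => 0 < A q p) i j)
    (f : Fin N → ℝ → ℝ) (f' : Fin N → ℝ → ℝ)
    (llow lup : ℝ) (hl0 : 0 < llow) (hll : llow ≤ lup)
    (hderiv : ∀ i x, HasDerivAt (f i) (f' i x) x)
    (hsc : ∀ i a c, llow * (a - c) ^ 2 ≤ (f' i a - f' i c) * (a - c))
    (hlip : ∀ i a c, |f' i a - f' i c| ≤ lup * |a - c|)
    (ystar : ℝ) (hstar : ∀ y : ℝ, (∑ i, f i ystar) ≤ ∑ i, f i y)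
    -- agent orders and unknown gains, all nonzero and of the same sign
    (n : Fin N → ℕ) (hn : ∀ i, 1 ≤ n i)
    (b : Fin N → ℝ) (hbsign : (∀ i, 0 < b i) ∨ (∀ i, b i < 0))
    -- a smooth function satisfying the strengthened Nussbaum conditions
    (Nb : ℝ → ℝ) (hNbsmooth : ContDiff ℝ (⊤ : ℕ∞) Nb)
    (hplus : Tendsto (fun θ : ℝ => (∫ s in (0:ℝ)..θ, max (Nb s) 0) / θ) atTop atTop)
    (hminus : Tendsto (fun θ : ℝ => (∫ s in (0:ℝ)..θ, max (-Nb s) 0) / θ) atTop atTop)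
    (hratio₁ : ∀ M : ℝ, ∃ᶠ θ in atTop,
      M < (∫ s in (0:ℝ)..θ, max (Nb s) 0) / (∫ s in (0:ℝ)..θ, max (-Nb s) 0))
    (hratio₂ : ∀ M : ℝ, ∃ᶠ θ in atTop,
      M < (∫ s in (0:ℝ)..θ, max (-Nb s) 0) / (∫ s in (0:ℝ)..θ, max (Nb s) 0))
    -- Hurwitz coefficients
    (k : Fin N → ℕ → ℝ)
    (hHurwitz : ∀ i, ∀ z : ℂ,
      (Polynomial.X ^ (n i - 1) + ∑ ι ∈ Finset.Icc 1 (n i - 1),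
        Polynomial.C ((k i ι : ℂ)) * Polynomial.X ^ (ι - 1)).IsRoot z → z.re < 0) :
    ∃ α β εstar : ℝ, 0 < α ∧ 0 < β ∧ 0 < εstar ∧
      ∀ ε : ℝ, 0 < ε → ε < εstar →
      ∀ (y u th : Fin N → ℝ → ℝ) (r v : Fin N → ℝ → ℝ) (ζ : Fin N → ℝ → ℝ),
        (∀ i, ContDiff ℝ (n i : ℕ∞) (y i)) →
        -- definition of ζ_i
        (∀ i t, ζ i t =
          (∑ ι ∈ Finset.Icc 1 (n i - 1), k i ι *
            (if ι = 1 then y i t - r i t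
             else ε ^ (ι - 1) * iteratedDeriv (ι - 1) (y i) t))
          + (if n i = 1 then y i t - r i t
             else ε ^ (n i - 1) * iteratedDeriv (n i - 1) (y i) t)) →
        -- the distributed controller
        (∀ i t, u i t = Nb (th i t) * ζ i t) →
        (∀ i t, 0 ≤ t → HasDerivAt (th i) ((ζ i t) ^ 2) t) →
        -- agent dynamics y_i^{(n_i)} = b_i u_i
        (∀ i t, 0 ≤ t →
          HasDerivAt (iteratedDeriv (n i - 1) (y i)) (b i * u i t) t) →
        -- real-time-gradient optimal signal generator
        (∀ i t, 0 ≤ t → HasDerivAt (r i)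
          (-α * f' i (y i t) - β * (∑ j, A i j * (r i t - r j t))
            - ∑ j, A i j * (v i t - v j t)) t) →
        (∀ i t, 0 ≤ t → HasDerivAt (v i)
          (α * β * ∑ j, A i j * (r i t - r j t)) t) →
        -- boundedness of the closed-loop trajectory and optimal consensus
        (∃ B : ℝ, ∀ t, 0 ≤ t → ∀ i,
          (∀ ι, ι ≤ n i - 1 → |iteratedDeriv ι (y i) t| ≤ B) ∧
          |th i t| ≤ B ∧ |r i t| ≤ B ∧ |v i t| ≤ B) ∧
        (∀ i, Tendsto (fun t => y i t) atTop (nhds ystar)) := by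
  have hN0 : 0 < N := by omega
  have hcrit : ∑ i, f' i ystar = 0 :=
    IsLocalMin.hasDerivAt_eq_zero (f := fun x => ∑ i, f i x) (Eventually.of_forall hstar)
      (HasDerivAt.fun_sum fun i _ => hderiv i ystar)
  obtain ⟨β, εstar, hβ, hεstar, hLyap⟩ := closed_loop_lyapunov hN0 hAnn hbal hconn hl0 hsc hlip
    hcrit hn b hHurwitz
  refine ⟨1, β, εstar, one_pos, hβ, hεstar, fun ε hε hεlt y u th r v ζ hy hζ hu hth hag hr hv => ?_⟩
  obtain ⟨M, C, hC, hLyap⟩ := hLyap ε hε hεlt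
  obtain ⟨W, W', Y, vstar, hW, hW0, hY0, hW', hyY, hrW, hzW, hζW, hXW⟩ :=
    hLyap y u (fun i t => Nb (th i t)) r v ζ hy hζ hu hag
      (fun i t ht => by simpa only [neg_mul, one_mul, digraphLap] using hr i t ht)
      (fun i t ht => by simpa only [one_mul, digraphLap] using hv i t ht)
  clear hLyap
  have hNb : Continuous Nb := hNbsmooth.continuous
  have hNbI : ∀ x, HasDerivAt (fun x => ∫ s in (0:ℝ)..x, Nb s) (Nb x) x := fun x =>
    intervalIntegral.integral_hasDerivAt_right (hNb.intervalIntegrable _ _)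
      hNb.stronglyMeasurable.stronglyMeasurableAtFilter hNb.continuousAt
  set g : Fin N → ℝ := fun i => ε ^ (n i - 1) * b i with hg
  set P : ℝ → ℝ := fun t =>
    ∑ i, (g i * (∫ s in (0:ℝ)..(th i t), Nb s) + M i * th i t) with hP
  have hPd : ∀ t, 0 ≤ t → HasDerivAt P (∑ i, (g i * Nb (th i t) + M i) * ζ i t ^ 2) t := by
    intro t ht
    refine (HasDerivAt.fun_sum fun i _ => (((hNbI (th i t)).comp t (hth i t ht)).const_mul
      (g i)).add ((hth i t ht).const_mul (M i))).congr_deriv ?_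
    exact Finset.sum_congr rfl fun i _ => by ring
  have hΦd : ∀ t, 0 ≤ t → HasDerivAt (fun t => P t - W t)
      ((∑ i, (g i * Nb (th i t) + M i) * ζ i t ^ 2) - W' t) t :=
    fun t ht => (hPd t ht).sub (hW t ht)
  have hΦY : ∀ t, 0 ≤ t → Y t ≤ (∑ i, (g i * Nb (th i t) + M i) * ζ i t ^ 2) - W' t :=
    fun t ht => by linarith [hW' t ht]
  have hΦ : ∀ t, 0 ≤ t → P 0 - W 0 ≤ P t - W t := fun t ht =>
    monotoneOn_Ici_of_hasDerivAt_nonneg hΦd (fun t ht => (hY0 t).trans (hΦY t ht))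
      (Set.mem_Ici.2 le_rfl) (Set.mem_Ici.2 ht) ht
  have hgsign : (∀ i, 0 < g i) ∨ ∀ i, g i < 0 :=
    hbsign.imp (fun h i => mul_pos (pow_pos hε _) (h i))
      fun h i => mul_neg_of_pos_of_neg (pow_pos hε _) (h i)
  obtain ⟨Bθ, hBθ⟩ := bounded_of_nussbaum_of_same_sign hNb hplus hminus hratio₁ hratio₂ hgsign
    (fun i t ht => (hth i t ht).continuousAt.continuousWithinAt)
    (fun i => monotoneOn_Ici_of_hasDerivAt_nonneg (hth i) fun t _ => sq_nonneg _)
    (M := M) (K := P 0 - W 0) (fun t ht => by linarith [hΦ t ht, hW0 t])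
  have hbdd : ∀ q : ℝ → ℝ, Continuous q → ∃ K, ∀ t, 0 ≤ t → ∀ i, |q (th i t)| ≤ K := by
    intro q hq
    obtain ⟨K, hK⟩ := (isCompact_Icc (a := -Bθ) (b := Bθ)).exists_bound_of_continuousOn
      hq.continuousOn
    exact ⟨K, fun t ht i => hK _ (abs_le.1 (hBθ t ht i))⟩
  obtain ⟨BN, hBN⟩ := hbdd Nb hNb
  obtain ⟨BI, hBI⟩ := hbdd (fun x => ∫ s in (0:ℝ)..x, Nb s)
    (continuous_iff_continuousAt.2 fun x => (hNbI x).continuousAt)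
  have hPb : ∀ t, 0 ≤ t → P t ≤ ∑ i, (|g i| * BI + |M i| * Bθ) := by
    intro t ht
    refine Finset.sum_le_sum fun i _ => add_le_add ?_ ?_
    · exact (le_abs_self _).trans ((abs_mul _ _).le.trans
        (mul_le_mul_of_nonneg_left (hBI t ht i) (abs_nonneg _)))
    · exact (le_abs_self _).trans ((abs_mul _ _).le.trans
        (mul_le_mul_of_nonneg_left (hBθ t ht i) (abs_nonneg _)))
  set BP := ∑ i, (|g i| * BI + |M i| * Bθ) with hBP
  set D := C * (BP - (P 0 - W 0)) with hD
  have hWD : ∀ t, 0 ≤ t → C * W t ≤ D := fun t ht =>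
    mul_le_mul_of_nonneg_left (by linarith [hΦ t ht, hPb t ht]) hC.le
  have hrb : ∀ t, 0 ≤ t → ∀ i, |r i t| ≤ √D + |ystar| := fun t ht i =>
    abs_le_add_of_sq_le ((hrW t i).trans (hWD t ht))
  have hXb : ∀ t, 0 ≤ t → ∀ i, ∀ m ≤ n i - 1, |if m = 0 then y i t - r i t
      else ε ^ m * iteratedDeriv m (y i) t| ≤ √D := fun t ht i m hm =>
    Real.abs_le_sqrt ((hXW t i m hm).trans (hWD t ht))
  have hζb : ∀ t, 0 ≤ t → ∀ i, |ζ i t| ≤ √D := fun t ht i =>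
    Real.abs_le_sqrt ((hζW t i).trans (hWD t ht))
  have hvb : ∀ i, ∃ B, ∀ t, 0 ≤ t → |v i t| ≤ B := by
    refine fun i => ⟨√D + |ystar + vstar i| + (√D + |ystar|), fun t ht => ?_⟩
    have h1 : |r i t + v i t| ≤ √D + |ystar + vstar i| :=
      abs_le_add_of_sq_le (by
        rw [add_sub_add_comm]
        exact (hzW t i).trans (hWD t ht))
    have h2 := abs_sub (r i t + v i t) (r i t)
    rw [add_sub_cancel_left] at h2
    linarith [hrb t ht i]
  obtain ⟨Bv, hBv⟩ := exists_uniform_bound hvb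
  have hyb : ∀ t, 0 ≤ t → ∀ i, |y i t| ≤ √D + (√D + |ystar|) := by
    intro t ht i
    have h1 := hXb t ht i 0 (Nat.zero_le _)
    rw [if_pos rfl] at h1
    have h2 := abs_add_le (y i t - r i t) (r i t)
    rw [sub_add_cancel] at h2
    linarith [hrb t ht i]
  have hsD : 0 ≤ √D := Real.sqrt_nonneg D
  set By := √D + (√D + |ystar|) with hBy
  have hBy0 : 0 ≤ By := by positivity
  set Bm : ℕ → ℝ := fun m => √D / ε ^ m with hBm
  have hBm0 : ∀ m, 0 ≤ Bm m := fun m => by positivity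
  have hderivb : ∀ t, 0 ≤ t → ∀ i, ∀ m ≤ n i - 1, m ≠ 0 → |iteratedDeriv m (y i) t| ≤ Bm m := by
    intro t ht i m hm hm0
    have h1 := hXb t ht i m hm
    rw [if_neg hm0, abs_mul, abs_of_pos (pow_pos hε m)] at h1
    rw [hBm, le_div_iff₀' (pow_pos hε m)]
    exact h1
  refine ⟨?_, fun i => ?_⟩
  · set S := ∑ i, ∑ m ∈ Finset.range (n i), Bm m with hS
    have hS0 : ∀ i, ∀ m ≤ n i - 1, Bm m ≤ S := by
      intro i m hm
      refine (Finset.single_le_sum (f := Bm) (s := Finset.range (n i)) (fun m _ => hBm0 m)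
        (Finset.mem_range.2 (by have := hn i; omega))).trans ?_
      exact Finset.single_le_sum (f := fun i => ∑ m ∈ Finset.range (n i), Bm m)
        (fun i _ => Finset.sum_nonneg fun m _ => hBm0 m) (Finset.mem_univ i)
    have hS1 : 0 ≤ S := Finset.sum_nonneg fun i _ => Finset.sum_nonneg fun m _ => hBm0 m
    refine ⟨By + S + |Bθ| + |Bv|, fun t ht i => ⟨fun m hm => ?_, ?_, ?_, ?_⟩⟩
    · have h1 := abs_nonneg Bθ
      have h2 := abs_nonneg Bv
      by_cases hm0 : m = 0
      · subst hm0
        rw [iteratedDeriv_zero]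
        linarith [hyb t ht i]
      · linarith [hderivb t ht i m hm hm0, hS0 i m hm]
    · linarith [hBθ t ht i, le_abs_self Bθ, abs_nonneg Bv]
    · linarith [hrb t ht i, abs_nonneg Bθ, abs_nonneg Bv]
    · linarith [hBv t ht i, abs_nonneg Bθ, le_abs_self Bv]
  · obtain ⟨y', hy', Ky, hKy⟩ : ∃ y' : ℝ → ℝ, (∀ t, 0 ≤ t → HasDerivAt (y i) (y' t) t) ∧
        ∃ K, ∀ t, 0 ≤ t → |y' t| ≤ K := by
      by_cases hn1 : n i = 1
      · refine ⟨fun t => b i * u i t, fun t ht => ?_, |b i| * (BN * √D), fun t ht => ?_⟩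
        · simpa only [hn1, Nat.sub_self, iteratedDeriv_zero] using hag i t ht
        · simp only [hu, abs_mul]
          refine mul_le_mul_of_nonneg_left ?_ (abs_nonneg _)
          exact mul_le_mul (hBN t ht i) (hζb t ht i) (abs_nonneg _)
            ((abs_nonneg _).trans (hBN t ht i))
      · refine ⟨deriv (y i), fun t _ => ?_, Bm 1, fun t ht => ?_⟩
        · refine ((hy i).differentiable ?_ t).hasDerivAt
          have := hn i
          exact_mod_cast (by omega : n i ≠ 0)
        · rw [← iteratedDeriv_one]
          exact hderivb t ht i 1 (by have := hn i; omega) one_ne_zero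
    have hsq : Tendsto (fun t => (y i t - ystar) ^ 2) atTop (nhds 0) := by
      refine tendsto_zero_of_hasDerivAt_bound (g' := fun t => 2 * (y i t - ystar) * y' t)
        (F := fun t => C * ((P t - W t) + ∑ j, th j t))
        (F' := fun t => C * (((∑ i, (g i * Nb (th i t) + M i) * ζ i t ^ 2) - W' t)
          + ∑ j, ζ j t ^ 2))
        (K := 2 * (By + |ystar|) * Ky) (B := C * (BP + ∑ _j : Fin N, Bθ))
        (fun t ht => ?_) (fun t ht => ?_) (fun t _ => sq_nonneg _) (fun t ht => ?_)
        (fun t ht => ?_) (fun t ht => ?_)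
      · exact (((hy' t ht).sub_const ystar).fun_pow 2).congr_deriv (by norm_num)
      · rw [abs_mul, abs_mul, abs_of_pos (two_pos : (0:ℝ) < 2)]
        have h1 : |y i t - ystar| ≤ By + |ystar| :=
          (abs_sub _ _).trans (by linarith [hyb t ht i])
        exact mul_le_mul (mul_le_mul_of_nonneg_left h1 two_pos.le) (hKy t ht) (abs_nonneg _)
          (by positivity)
      · exact ((hΦd t ht).add (HasDerivAt.fun_sum fun j _ => hth j t ht)).const_mul C
      · refine (hyY t i).trans (mul_le_mul_of_nonneg_left ?_ hC.le)
        exact add_le_add_left (hΦY t ht) _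
      · refine mul_le_mul_of_nonneg_left (add_le_add ?_ ?_) hC.le
        · linarith [hPb t ht, hW0 t]
        · exact Finset.sum_le_sum fun j _ => (le_abs_self _).trans (hBθ t ht j)
    have habs : Tendsto (fun t => |y i t - ystar|) atTop (nhds 0) := by
      simpa only [Real.sqrt_sq_eq_abs, Real.sqrt_zero] using hsq.sqrt
    simpa using ((tendsto_zero_iff_abs_tendsto_zero _).2 habs).add_const ystar
end

section
/- Suppose the weighted digraph is weight-balanced and strongly connected and each f_i is l̲-strongly convex with l̄-Lipschitz derivative, and let α, β > 0. Then every equilibrium point (r*, v*) ∈ ℝ^N × ℝ^N of the generator vector field, i.e., every point satisfying 0 = −α f_i'(r_i*) − β Σ_{j=1}^N a_{ij}(r_i* − r_j*) − Σ_{j=1}^N a_{ij}(v_i* − v_j*) and 0 = α β Σ_{j=1}^N a_{ij}(r_i* − r_j*) for all i, satisfies r* = y* · 1_N, where 1_N is the all-one vector; that is, r_i* = y* for every i. -/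
/-- A function that is harmonic for a nonnegative weight matrix of a strongly connected digraph
on a finite vertex set is constant. -/
theorem eq_of_harmonic_of_strongly_connected {ι : Type*} [Fintype ι]
    {A : ι → ι → ℝ} (hA : ∀ i j, 0 ≤ A i j)
    (hconn : ∀ i j : ι, i ≠ j → Relation.TransGen (fun p q : ι => 0 < A q p) i j)
    {r : ι → ℝ} (hr : ∀ i, ∑ j, A i j * (r i - r j) = 0) (i k : ι) : r i = r k := by
  have : Nonempty ι := ⟨i⟩
  obtain ⟨m, hm⟩ := Finite.exists_max r
  have step : ∀ p q, 0 < A q p → r q = r m → r p = r m := by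
    intro p q hpq hq
    have hz := (Finset.sum_eq_zero_iff_of_nonneg (fun j _ =>
      mul_nonneg (hA q j) (sub_nonneg.2 (hq ▸ hm j)))).1 (hr q) p (Finset.mem_univ p)
    have hdiff := (mul_eq_zero.1 hz).resolve_left hpq.ne'
    linarith
  have path : ∀ p q, Relation.TransGen (fun p q : ι => 0 < A q p) p q →
      r q = r m → r p = r m := by
    intro p q h
    induction h with
    | single h => exact step _ _ h
    | tail _ h ih => exact fun hq => ih (step _ _ h hq)
  have all : ∀ p, r p = r m := by
    intro p
    by_cases h : p = m
    · rw [h]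
    · exact path p m (hconn p m h) rfl
  rw [all i, all k]

/-- The Laplacian of a weight-balanced digraph has zero column sums. -/
theorem sum_laplacian_eq_zero_of_balanced {ι : Type*} [Fintype ι] {A : ι → ι → ℝ}
    (hbal : ∀ i, ∑ j, A i j = ∑ j, A j i) (v : ι → ℝ) :
    ∑ i, ∑ j, A i j * (v i - v j) = 0 := by
  simp only [mul_sub, Finset.sum_sub_distrib]
  rw [Finset.sum_comm (f := fun i j => A i j * v j)]
  simp only [← Finset.sum_mul, hbal, sub_self]

/-- Over a weight-balanced, strongly connected weighted digraph, with each `f_i`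
`l̲`-strongly convex with `l̄`-Lipschitz derivative and `α, β > 0`, every equilibrium
`(r*, v*)` of the optimal signal generator, i.e., every point satisfying
`0 = −α f_i'(r_i*) − β Σ_j a_{ij}(r_i* − r_j*) − Σ_j a_{ij}(v_i* − v_j*)` and
`0 = α β Σ_j a_{ij}(r_i* − r_j*)` for all `i`, satisfies `r_i* = y*` for every `i`,
where `y*` is the unique minimizer of `f(y) = Σ_i f_i(y)`. -/
theorem generator_equilibrium_is_optimal
    (N : ℕ) (hN : 2 ≤ N)
    (A : Fin N → Fin N → ℝ)
    (hAdiag : ∀ i, A i i = 0) (hAnn : ∀ i j, 0 ≤ A i j)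
    (hbal : ∀ i, ∑ j, A i j = ∑ j, A j i)
    (hconn : ∀ i j : Fin N, i ≠ j →
      Relation.TransGen (fun p q : Fin N => 0 < A q p) i j)
    (f : Fin N → ℝ → ℝ) (f' : Fin N → ℝ → ℝ)
    (llow lup : ℝ) (hl0 : 0 < llow) (hll : llow ≤ lup)
    (hderiv : ∀ i x, HasDerivAt (f i) (f' i x) x)
    (hsc : ∀ i a c, llow * (a - c) ^ 2 ≤ (f' i a - f' i c) * (a - c))
    (hlip : ∀ i a c, |f' i a - f' i c| ≤ lup * |a - c|)
    (ystar : ℝ) (hstar : ∀ y : ℝ, (∑ i, f i ystar) ≤ ∑ i, f i y)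
    (α β : ℝ) (hα : 0 < α) (hβ : 0 < β)
    (rstar vstar : Fin N → ℝ)
    (hreq : ∀ i, 0 = -α * f' i (rstar i)
      - β * (∑ j, A i j * (rstar i - rstar j))
      - ∑ j, A i j * (vstar i - vstar j))
    (hveq : ∀ i, 0 = α * β * ∑ j, A i j * (rstar i - rstar j)) :
    ∀ i, rstar i = ystar := by
  have hlap : ∀ i, ∑ j, A i j * (rstar i - rstar j) = 0 := fun i =>
    (mul_eq_zero.1 (hveq i).symm).resolve_left (mul_pos hα hβ).ne'
  intro k
  have hcons : ∀ i, rstar i = rstar k :=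
    fun i => eq_of_harmonic_of_strongly_connected hAnn hconn hlap i k
  have hgrad : ∑ i, f' i (rstar k) = 0 := by
    have hi : ∀ i, α * f' i (rstar k) = -∑ j, A i j * (vstar i - vstar j) := by
      intro i
      have h := hreq i
      rw [hlap i, hcons i] at h
      linarith
    have hsum : α * ∑ i, f' i (rstar k) = 0 := by
      rw [Finset.mul_sum, Finset.sum_congr rfl fun i _ => hi i, Finset.sum_neg_distrib,
        sum_laplacian_eq_zero_of_balanced hbal, neg_zero]
    exact (mul_eq_zero.1 hsum).resolve_left hα.ne'
  have hmin : ∑ i, f' i ystar = 0 := by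
    have hd : HasDerivAt (fun y => ∑ i, f i y) (∑ i, f' i ystar) ystar :=
      HasDerivAt.fun_sum fun i _ => hderiv i ystar
    exact IsLocalMin.hasDerivAt_eq_zero (Filter.Eventually.of_forall hstar) hd
  have hle : ∑ _i : Fin N, llow * (rstar k - ystar) ^ 2 ≤ 0 := by
    calc ∑ _i : Fin N, llow * (rstar k - ystar) ^ 2
        ≤ ∑ i, (f' i (rstar k) - f' i ystar) * (rstar k - ystar) :=
          Finset.sum_le_sum fun i _ => hsc i _ _
      _ = 0 := by
          rw [← Finset.sum_mul, Finset.sum_sub_distrib, hgrad, hmin, sub_self, zero_mul]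
  have hnonneg : ∀ i ∈ (Finset.univ : Finset (Fin N)), 0 ≤ llow * (rstar k - ystar) ^ 2 :=
    fun _ _ => by positivity
  have hz := (Finset.sum_eq_zero_iff_of_nonneg hnonneg).1
    (le_antisymm hle (Finset.sum_nonneg hnonneg)) k (Finset.mem_univ k)
  exact sub_eq_zero.1 (pow_eq_zero_iff two_ne_zero |>.1
    ((mul_eq_zero.1 hz).resolve_left hl0.ne'))
end

section
/- The function N̄(θ) = e^{θ²} sin θ is a Nussbaum function: limsup_{θ→∞} (1/θ)∫₀^θ e^{s²} sin s ds = +∞ and liminf_{θ→∞} (1/θ)∫₀^θ e^{s²} sin s ds = −∞. -/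
open Filter

/-- The absolute value of the integral of `exp (s ^ 2) * sin s` over `[n π, (n + 1) π]`. -/
noncomputable def expSqSinArch (n : ℕ) : ℝ :=
  ∫ s in (0:ℝ)..Real.pi, Real.exp ((n * Real.pi + s) ^ 2) * Real.sin s

lemma integral_expSqSin_succ (n : ℕ) :
    (∫ s in (0:ℝ)..((n + 1 : ℕ) * Real.pi), Real.exp (s ^ 2) * Real.sin s) =
      (∫ s in (0:ℝ)..(n * Real.pi), Real.exp (s ^ 2) * Real.sin s) +
        (-1) ^ n * expSqSinArch n := by
  have hint (a b : ℝ) : IntervalIntegrable (fun s => Real.exp (s ^ 2) * Real.sin s)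
      MeasureTheory.volume a b := Continuous.intervalIntegrable (by fun_prop) a b
  rw [← intervalIntegral.integral_add_adjacent_intervals (hint 0 (n * Real.pi)) (hint _ _),
    expSqSinArch, ← intervalIntegral.integral_const_mul]
  congr 1
  have h := intervalIntegral.integral_comp_add_left (a := 0) (b := Real.pi)
    (fun s => Real.exp (s ^ 2) * Real.sin s) (n * Real.pi)
  rw [add_zero] at h
  rw [show ((n + 1 : ℕ) : ℝ) * Real.pi = n * Real.pi + Real.pi by push_cast; ring, ← h]
  refine intervalIntegral.integral_congr fun s _ => ?_
  simp only [add_comm _ s, Real.sin_add_nat_mul_pi]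
  ring

lemma expSqSinArch_nonneg (n : ℕ) : 0 ≤ expSqSinArch n :=
  intervalIntegral.integral_nonneg Real.pi_pos.le fun _ hs =>
    mul_nonneg (Real.exp_pos _).le (Real.sin_nonneg_of_mem_Icc hs)

lemma add_expSqSinArch_le_succ (n : ℕ) :
    2 * (n : ℝ) ^ 2 + expSqSinArch n ≤ expSqSinArch (n + 1) := by
  have hconst : 2 * (n : ℝ) ^ 2 = ∫ s in (0:ℝ)..Real.pi, (n : ℝ) ^ 2 * Real.sin s := by
    rw [intervalIntegral.integral_const_mul, integral_sin, Real.cos_zero, Real.cos_pi]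
    ring
  rw [hconst, expSqSinArch, expSqSinArch, ← intervalIntegral.integral_add
    (Continuous.intervalIntegrable (by fun_prop) _ _)
    (Continuous.intervalIntegrable (by fun_prop) _ _)]
  refine intervalIntegral.integral_mono_on Real.pi_pos.le
    (Continuous.intervalIntegrable (by fun_prop) _ _)
    (Continuous.intervalIntegrable (by fun_prop) _ _) fun s hs => ?_
  rw [← add_mul]
  refine mul_le_mul_of_nonneg_right ?_ (Real.sin_nonneg_of_mem_Icc hs)
  have hpi := Real.pi_gt_three
  have hn : (0:ℝ) ≤ n := n.cast_nonneg
  set u : ℝ := n * Real.pi + s with hu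
  have hnu : (n : ℝ) ≤ u := by nlinarith [hs.1]
  have hsplit : ((n + 1 : ℕ) * Real.pi + s) ^ 2 = u ^ 2 + Real.pi * (2 * u + Real.pi) := by
    rw [hu]; push_cast; ring
  rw [hsplit, Real.exp_add]
  have h₁ := Real.add_one_le_exp (u ^ 2)
  have h₂ := Real.add_one_le_exp (Real.pi * (2 * u + Real.pi))
  have h₃ : 1 ≤ Real.pi * (2 * u + Real.pi) := by nlinarith
  have h₄ : (n : ℝ) ^ 2 ≤ u ^ 2 := by gcongr
  nlinarith [Real.exp_pos (u ^ 2)]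

lemma integral_expSqSin_alternating_bounds (n : ℕ) :
    0 ≤ (-1) ^ n * (∫ s in (0:ℝ)..((n + 1 : ℕ) * Real.pi), Real.exp (s ^ 2) * Real.sin s) ∧
    (-1) ^ n * (∫ s in (0:ℝ)..((n + 1 : ℕ) * Real.pi), Real.exp (s ^ 2) * Real.sin s) ≤
      expSqSinArch n := by
  induction n with
  | zero =>
    rw [integral_expSqSin_succ]
    simpa using expSqSinArch_nonneg 0
  | succ n ih =>
    have hsq : ((-1 : ℝ) ^ (n + 1)) * (-1) ^ (n + 1) = 1 := by
      rw [← mul_pow]; norm_num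
    rw [integral_expSqSin_succ (n + 1), mul_add, ← mul_assoc, hsq, pow_succ (-1 : ℝ)]
    have := add_expSqSinArch_le_succ n
    constructor <;> nlinarith [sq_nonneg (n : ℝ)]

lemma two_mul_sq_le_integral_expSqSin (n : ℕ) :
    2 * (n : ℝ) ^ 2 ≤ (-1) ^ (n + 1) *
      (∫ s in (0:ℝ)..((n + 2 : ℕ) * Real.pi), Real.exp (s ^ 2) * Real.sin s) := by
  have hsq : ((-1 : ℝ) ^ (n + 1)) * (-1) ^ (n + 1) = 1 := by
    rw [← mul_pow]; norm_num
  rw [integral_expSqSin_succ (n + 1), mul_add, ← mul_assoc, hsq, pow_succ (-1 : ℝ)]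
  linarith [add_expSqSinArch_le_succ n, (integral_expSqSin_alternating_bounds n).2]

lemma lt_integral_expSqSin_div {M : ℝ} {n : ℕ} (hn : 2 ≤ n) (hM : 4 * M < n) :
    M < (-1) ^ (n + 1) *
      ((∫ s in (0:ℝ)..((n + 2 : ℕ) * Real.pi), Real.exp (s ^ 2) * Real.sin s) /
        ((n + 2 : ℕ) * Real.pi)) := by
  have hpos : 0 < ((n + 2 : ℕ) : ℝ) * Real.pi := by positivity
  have hn' : (2:ℝ) ≤ n := by exact_mod_cast hn
  rw [← mul_div_assoc, lt_div_iff₀ hpos]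
  refine lt_of_lt_of_le ?_ (two_mul_sq_le_integral_expSqSin n)
  have hle : ((n + 2 : ℕ) : ℝ) * Real.pi ≤ 8 * n := by
    push_cast
    nlinarith [Real.pi_le_four]
  calc M * ((n + 2 : ℕ) * Real.pi) < n / 4 * ((n + 2 : ℕ) * Real.pi) := by
        gcongr; linarith
    _ ≤ n / 4 * (8 * n) := by gcongr
    _ = 2 * (n : ℝ) ^ 2 := by ring

lemma natCast_le_add_two_mul_pi (n : ℕ) : (n : ℝ) ≤ (n + 2 : ℕ) * Real.pi := by
  push_cast
  nlinarith [Real.pi_gt_three, (n.cast_nonneg : (0:ℝ) ≤ n)]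

/-- The function `θ ↦ exp(θ²) sin θ` is a Nussbaum function:
`limsup_{θ→∞} (1/θ)∫₀^θ e^{s²} sin s ds = +∞` and
`liminf_{θ→∞} (1/θ)∫₀^θ e^{s²} sin s ds = −∞`,
expressed via the frequently-filter characterization of infinite limsup/liminf. -/
theorem expSqSin_is_Nussbaum :
    (∀ M : ℝ, ∃ᶠ θ in atTop,
      M < (∫ s in (0:ℝ)..θ, Real.exp (s ^ 2) * Real.sin s) / θ) ∧
    (∀ M : ℝ, ∃ᶠ θ in atTop,
      (∫ s in (0:ℝ)..θ, Real.exp (s ^ 2) * Real.sin s) / θ < M) := by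
  constructor <;> intro M <;> rw [frequently_atTop] <;> intro a
  · obtain ⟨k, hk⟩ := exists_nat_gt (max a (4 * M))
    obtain ⟨hka, hkM⟩ := max_lt_iff.1 hk
    have hle : (k : ℝ) ≤ (2 * k + 3 : ℕ) := by exact_mod_cast (by omega : k ≤ 2 * k + 3)
    refine ⟨_, (hka.le.trans hle).trans (natCast_le_add_two_mul_pi _), ?_⟩
    have h := lt_integral_expSqSin_div (M := M) (n := 2 * k + 3) (by omega) (by linarith)
    rwa [Even.neg_one_pow ⟨k + 2, by omega⟩, one_mul] at h
  · obtain ⟨k, hk⟩ := exists_nat_gt (max a (4 * -M))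
    obtain ⟨hka, hkM⟩ := max_lt_iff.1 hk
    have hle : (k : ℝ) ≤ (2 * k + 2 : ℕ) := by exact_mod_cast (by omega : k ≤ 2 * k + 2)
    refine ⟨_, (hka.le.trans hle).trans (natCast_le_add_two_mul_pi _), ?_⟩
    have h := lt_integral_expSqSin_div (M := -M) (n := 2 * k + 2) (by omega) (by linarith)
    rw [Odd.neg_one_pow ⟨k + 1, by omega⟩] at h
    linarith
end

section
/- Let N̄ : ℝ → ℝ be a continuous function and set N̄₊(θ) = max{N̄(θ), 0} and N̄₋(θ) = max{−N̄(θ), 0}. Suppose that lim_{θ→∞} (1/θ)∫₀^θ N̄₊(s)ds = ∞, lim_{θ→∞} (1/θ)∫₀^θ N̄₋(s)ds = ∞, limsup_{θ→∞} (∫₀^θ N̄₊(s)ds)/(∫₀^θ N̄₋(s)ds) = ∞, and limsup_{θ→∞} (∫₀^θ N̄₋(s)ds)/(∫₀^θ N̄₊(s)ds) = ∞. Then N̄ is a Nussbaum function, i.e., limsup_{θ→∞} (1/θ)∫₀^θ N̄(s)ds = +∞ and liminf_{θ→∞} (1/θ)∫₀^θ N̄(s)ds = −∞. -/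
open Filter

theorem frequently_lt_sub_div_of_frequently_lt_div {P Q : ℝ → ℝ}
    (hQ : Tendsto (fun θ => Q θ / θ) atTop atTop)
    (hPQ : ∃ᶠ θ in atTop, 2 < P θ / Q θ) (M : ℝ) :
    ∃ᶠ θ in atTop, M < (P θ - Q θ) / θ := by
  have hM : ∀ᶠ θ in atTop, max M 0 < Q θ / θ := hQ.eventually_gt_atTop _
  refine (hPQ.and_eventually (hM.and (eventually_gt_atTop 0))).mono ?_
  rintro θ ⟨hratio, hlt, hθ⟩
  have hQpos : 0 < Q θ := (div_pos_iff_of_pos_right hθ).1 ((le_max_right M 0).trans_lt hlt)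
  rw [lt_div_iff₀ hQpos] at hratio
  calc M ≤ max M 0 := le_max_left M 0
    _ < Q θ / θ := hlt
    _ ≤ (P θ - Q θ) / θ := by gcongr; linarith

theorem intervalIntegral_eq_sub_posPart_negPart {f : ℝ → ℝ} (hf : Continuous f) (a b : ℝ) :
    ∫ s in a..b, f s = (∫ s in a..b, max (f s) 0) - ∫ s in a..b, max (-f s) 0 := by
  have hpos : Continuous fun s => max (f s) 0 := by fun_prop
  have hneg : Continuous fun s => max (-f s) 0 := by fun_prop
  rw [← intervalIntegral.integral_sub (hpos.intervalIntegrable a b) (hneg.intervalIntegrable a b)]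
  refine intervalIntegral.integral_congr fun s _ => ?_
  rcases le_total (f s) 0 with h | h <;> simp [h]

/-- If a continuous function `N̄` satisfies, with `N̄₊ = max{N̄,0}` and `N̄₋ = max{−N̄,0}`:
`lim_{θ→∞} (1/θ)∫₀^θ N̄₊ = ∞`, `lim_{θ→∞} (1/θ)∫₀^θ N̄₋ = ∞`,
`limsup_{θ→∞} (∫₀^θ N̄₊)/(∫₀^θ N̄₋) = ∞`, and `limsup_{θ→∞} (∫₀^θ N̄₋)/(∫₀^θ N̄₊) = ∞`,
then `N̄` is a Nussbaum function: `limsup_{θ→∞} (1/θ)∫₀^θ N̄ = +∞` and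
`liminf_{θ→∞} (1/θ)∫₀^θ N̄ = −∞` (infinite limsup/liminf expressed via `∃ᶠ`). -/
theorem strengthened_conditions_imply_Nussbaum
    (Nb : ℝ → ℝ) (hNb : Continuous Nb)
    (hplus : Tendsto (fun θ : ℝ => (∫ s in (0:ℝ)..θ, max (Nb s) 0) / θ) atTop atTop)
    (hminus : Tendsto (fun θ : ℝ => (∫ s in (0:ℝ)..θ, max (-Nb s) 0) / θ) atTop atTop)
    (hratio₁ : ∀ M : ℝ, ∃ᶠ θ in atTop,
      M < (∫ s in (0:ℝ)..θ, max (Nb s) 0) / (∫ s in (0:ℝ)..θ, max (-Nb s) 0))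
    (hratio₂ : ∀ M : ℝ, ∃ᶠ θ in atTop,
      M < (∫ s in (0:ℝ)..θ, max (-Nb s) 0) / (∫ s in (0:ℝ)..θ, max (Nb s) 0)) :
    (∀ M : ℝ, ∃ᶠ θ in atTop, M < (∫ s in (0:ℝ)..θ, Nb s) / θ) ∧
    (∀ M : ℝ, ∃ᶠ θ in atTop, (∫ s in (0:ℝ)..θ, Nb s) / θ < M) := by
  simp only [intervalIntegral_eq_sub_posPart_negPart hNb 0]
  refine ⟨frequently_lt_sub_div_of_frequently_lt_div hminus (hratio₁ 2), fun M => ?_⟩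
  refine (frequently_lt_sub_div_of_frequently_lt_div hplus (hratio₂ 2) (-M)).mono fun θ hθ => ?_
  rw [← neg_sub, neg_div] at hθ
  exact neg_lt_neg_iff.1 hθ
end

section
/- Let N̄ : ℝ → ℝ be a continuous Nussbaum function, let b be a nonzero real constant, C₁ ≥ 0 and C₀ real constants. Let θ : [0, ∞) → ℝ be continuous and nondecreasing, and let V : [0, ∞) → ℝ satisfy V(t) ≥ 0 for all t ≥ 0 and V(t) ≤ b ∫_{θ(0)}^{θ(t)} N̄(s) ds + C₁ θ(t) + C₀ for all t ≥ 0. Then θ is bounded on [0, ∞), i.e., sup_{t ≥ 0} θ(t) < ∞. -/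
open Filter

/-- Nussbaum-type boundedness argument: if `N̄` is a continuous Nussbaum function,
`b ≠ 0`, `C₁ ≥ 0`, `θ : [0,∞) → ℝ` is continuous and nondecreasing, and
`V ≥ 0` satisfies `V(t) ≤ b ∫_{θ(0)}^{θ(t)} N̄(s) ds + C₁ θ(t) + C₀` for all `t ≥ 0`,
then `θ` is bounded on `[0,∞)`. -/
theorem nussbaum_boundedness_lemma
    (Nb : ℝ → ℝ) (hNb : Continuous Nb)
    (hNsup : ∀ M : ℝ, ∃ᶠ θ in atTop, M < (∫ s in (0:ℝ)..θ, Nb s) / θ)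
    (hNinf : ∀ M : ℝ, ∃ᶠ θ in atTop, (∫ s in (0:ℝ)..θ, Nb s) / θ < M)
    (b : ℝ) (hb : b ≠ 0)
    (C₁ C₀ : ℝ) (hC₁ : 0 ≤ C₁)
    (θ : ℝ → ℝ) (hθcont : ContinuousOn θ (Set.Ici 0))
    (hθmono : MonotoneOn θ (Set.Ici 0))
    (V : ℝ → ℝ) (hVnonneg : ∀ t, 0 ≤ t → 0 ≤ V t)
    (hVbound : ∀ t, 0 ≤ t →
      V t ≤ b * (∫ s in (θ 0)..(θ t), Nb s) + C₁ * θ t + C₀) :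
    ∃ B : ℝ, ∀ t, 0 ≤ t → θ t ≤ B := by
  by_contra! hunb
  have hsurj : ∀ x, θ 0 ≤ x → ∃ t, 0 ≤ t ∧ θ t = x := by
    intro x hx
    obtain ⟨t, ht, hxt⟩ := hunb x
    obtain ⟨u, hu, hux⟩ :=
      intermediate_value_Icc ht (hθcont.mono Set.Icc_subset_Ici_self) ⟨hx, hxt.le⟩
    exact ⟨u, hu.1, hux⟩
  set K := C₀ - b * ∫ s in (0:ℝ)..(θ 0), Nb s
  have hlower : ∀ᶠ x in atTop, -C₁ - |K| ≤ b * ((∫ s in (0:ℝ)..x, Nb s) / x) := by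
    filter_upwards [eventually_ge_atTop (θ 0), eventually_ge_atTop 1] with x hx hx1
    obtain ⟨t, ht, rfl⟩ := hsurj x hx
    have hV := (hVnonneg t ht).trans (hVbound t ht)
    rw [← intervalIntegral.integral_interval_sub_left (hNb.intervalIntegrable 0 (θ t))
      (hNb.intervalIntegrable 0 (θ 0))] at hV
    rw [← mul_div_assoc, le_div_iff₀ (by linarith)]
    nlinarith [le_abs_self K, mul_nonneg (abs_nonneg K) (sub_nonneg.2 hx1)]
  rcases hb.lt_or_gt with hneg | hpos
  · obtain ⟨x, hx, hlow⟩ := ((hNsup ((-C₁ - |K|) / b)).and_eventually hlower).exists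
    rw [div_lt_iff_of_neg hneg] at hx
    linarith
  · obtain ⟨x, hx, hlow⟩ := ((hNinf ((-C₁ - |K|) / b)).and_eventually hlower).exists
    rw [lt_div_iff₀ hpos] at hx
    linarith
end

section
/- Consider N agents y_i^{(n_i)}(t) = b_i u_i(t) with n_i ≥ 1 and b_i ≠ 0 unknown, over a weight-balanced, strongly connected weighted digraph, with the local cost functions chosen as f_i(y) = (y − y_i(0))², where y_i(0) is agent i's initial output value. Apply the distributed controller u_i = N̄(θ_i)ζ_i, θ̇_i = ζ_i², ṙ_i = −α f_i'(r_i) − β Σ_j a_{ij}(r_i − r_j) − Σ_j a_{ij}(v_i − v_j), v̇_i = αβ Σ_j a_{ij}(r_i − r_j), where N̄ is a smooth Nussbaum function, ζ_i = k_{i1}(y_i − r_i) + Σ_{ι=2}^{n_i−1} k_{iι} ε^{ι−1} y_i^{(ι−1)} + ε^{n_i−1} y_i^{(n_i−1)} with k_{i1}, …, k_{i,n_i−1} such that λ^{n_i−1} + Σ_{ι=1}^{n_i−1} k_{iι} λ^{ι−1} is Hurwitz, and ε > 0. Then there exist positive constants α, β such that for any ε > 0 and any initial condition, the closed-loop trajectory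 is well-defined and bounded on [0, ∞) and every agent output achieves average consensus: y_i(t) → (1/N) Σ_{j=1}^N y_j(0) as t → ∞ for every i. -/
open Filter

/-- The action of the Laplacian of the weighted digraph `A` on a vector. -/
def lapAct {ι : Type*} [Fintype ι] (A : ι → ι → ℝ) (x : ι → ℝ) (i : ι) : ℝ :=
  ∑ j, A i j * (x i - x j)

section Laplacian

variable {ι : Type*} [Fintype ι] {A : ι → ι → ℝ}

lemma sum_sum_mul_sub_eq_zero (hbal : ∀ i, ∑ j, A i j = ∑ j, A j i) (x : ι → ℝ) :
    ∑ i, ∑ j, A i j * (x i - x j) = 0 := by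
  simp only [mul_sub, Finset.sum_sub_distrib]
  rw [Finset.sum_comm (f := fun i j => A i j * x j)]
  simp only [← Finset.sum_mul, hbal, sub_self]

lemma sum_lapAct (hbal : ∀ i, ∑ j, A i j = ∑ j, A j i) (x : ι → ℝ) :
    ∑ i, lapAct A x i = 0 := sum_sum_mul_sub_eq_zero hbal x

lemma lapAct_add_smul (x z : ι → ℝ) (c : ℝ) (i : ι) :
    lapAct A (fun j => x j + c * z j) i = lapAct A x i + c * lapAct A z i := by
  simp only [lapAct, Finset.mul_sum, ← Finset.sum_add_distrib]
  exact Finset.sum_congr rfl fun j _ => by ring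

lemma sum_mul_lapAct (hbal : ∀ i, ∑ j, A i j = ∑ j, A j i) (x : ι → ℝ) :
    ∑ i, x i * lapAct A x i = (∑ i, ∑ j, A i j * (x i - x j) ^ 2) / 2 := by
  have h := sum_sum_mul_sub_eq_zero hbal (fun i => x i ^ 2)
  have : ∑ i, x i * lapAct A x i
      = ∑ i, ∑ j, (A i j * (x i - x j) ^ 2 / 2 + A i j * (x i ^ 2 - x j ^ 2) / 2) := by
    simp only [lapAct, Finset.mul_sum]
    exact Finset.sum_congr rfl fun i _ => Finset.sum_congr rfl fun j _ => by ring
  rw [this]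
  simp only [Finset.sum_add_distrib, ← Finset.sum_div, h]
  ring

lemma sum_mul_lapAct_nonneg (hA : ∀ i j, 0 ≤ A i j) (hbal : ∀ i, ∑ j, A i j = ∑ j, A j i)
    (x : ι → ℝ) : 0 ≤ ∑ i, x i * lapAct A x i := by
  rw [sum_mul_lapAct hbal]
  have : 0 ≤ ∑ i, ∑ j, A i j * (x i - x j) ^ 2 :=
    Finset.sum_nonneg fun i _ => Finset.sum_nonneg fun j _ => mul_nonneg (hA i j) (sq_nonneg _)
  linarith

lemma sq_sub_le_of_transGen (hA : ∀ i j, 0 ≤ A i j) (hbal : ∀ i, ∑ j, A i j = ∑ j, A j i)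
    {i j : ι} (h : Relation.TransGen (fun p q => 0 < A q p) i j) :
    ∃ C, 0 ≤ C ∧ ∀ x : ι → ℝ, (x i - x j) ^ 2 ≤ C * ∑ i, x i * lapAct A x i := by
  have edge : ∀ p q, 0 < A q p →
      ∃ C, 0 ≤ C ∧ ∀ x : ι → ℝ, (x p - x q) ^ 2 ≤ C * ∑ i, x i * lapAct A x i := by
    intro p q hpq
    refine ⟨2 / A q p, by positivity, fun x => ?_⟩
    have h1 : A q p * (x q - x p) ^ 2 ≤ ∑ j, A q j * (x q - x j) ^ 2 :=
      Finset.single_le_sum (f := fun j => A q j * (x q - x j) ^ 2)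
        (fun j _ => mul_nonneg (hA q j) (sq_nonneg _)) (Finset.mem_univ p)
    have h2 : ∑ j, A q j * (x q - x j) ^ 2 ≤ ∑ i, ∑ j, A i j * (x i - x j) ^ 2 :=
      Finset.single_le_sum (f := fun i => ∑ j, A i j * (x i - x j) ^ 2)
        (fun i _ => Finset.sum_nonneg fun j _ => mul_nonneg (hA i j) (sq_nonneg _))
        (Finset.mem_univ q)
    rw [sum_mul_lapAct hbal, div_mul_eq_mul_div, le_div_iff₀ hpq]
    nlinarith
  induction h with
  | single h => exact edge _ _ h
  | tail _ h ih =>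
    obtain ⟨C, hC, h1⟩ := ih
    obtain ⟨C', hC', h2⟩ := edge _ _ h
    refine ⟨2 * C + 2 * C', by positivity, fun x => ?_⟩
    rename_i p q _
    nlinarith [h1 x, h2 x, sq_nonneg (x i - x p - (x p - x q))]

/-- Poincaré inequality for a strongly connected weight-balanced digraph. -/
lemma exists_poincare [Nonempty ι] (hA : ∀ i j, 0 ≤ A i j)
    (hbal : ∀ i, ∑ j, A i j = ∑ j, A j i)
    (hconn : ∀ i j : ι, i ≠ j → Relation.TransGen (fun p q => 0 < A q p) i j) :
    ∃ l, 0 < l ∧ ∀ x : ι → ℝ, ∑ i, x i = 0 →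
      l * ∑ i, x i ^ 2 ≤ ∑ i, x i * lapAct A x i := by
  have key : ∀ i j, ∃ C, 0 ≤ C ∧ ∀ x : ι → ℝ,
      (x i - x j) ^ 2 ≤ C * ∑ i, x i * lapAct A x i := by
    intro i j
    by_cases h : i = j
    · subst h
      exact ⟨0, le_rfl, fun x => by simp⟩
    · exact sq_sub_le_of_transGen hA hbal (hconn i j h)
  choose C hC hCx using key
  set S := ∑ i, ∑ j, C i j with hS
  have hS0 : 0 ≤ S := Finset.sum_nonneg fun i _ => Finset.sum_nonneg fun j _ => hC i j
  refine ⟨1 / (S + 1), by positivity, fun x hx => ?_⟩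
  set E := ∑ i, x i * lapAct A x i with hE
  have hE0 : 0 ≤ E := sum_mul_lapAct_nonneg hA hbal x
  have h1 : ∑ i, ∑ j, (x i - x j) ^ 2 ≤ S * E := by
    rw [hS, Finset.sum_mul]
    refine Finset.sum_le_sum fun i _ => ?_
    rw [Finset.sum_mul]
    exact Finset.sum_le_sum fun j _ => hCx i j x
  have h2 : ∑ i, ∑ j, (x i - x j) ^ 2 = 2 * Fintype.card ι * ∑ i, x i ^ 2 := by
    have : ∀ i, ∑ j, (x i - x j) ^ 2 = Fintype.card ι * x i ^ 2 + ∑ j, x j ^ 2 := by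
      intro i
      have : ∀ j, (x i - x j) ^ 2 = x i ^ 2 - 2 * x i * x j + x j ^ 2 := fun j => by ring
      simp only [this, Finset.sum_add_distrib, Finset.sum_sub_distrib, ← Finset.mul_sum, hx]
      simp
    simp only [this, Finset.sum_add_distrib, ← Finset.mul_sum]
    simp
    ring
  have h3 : (1 : ℝ) ≤ Fintype.card ι := by exact_mod_cast Fintype.card_pos
  have h4 : 0 ≤ ∑ i, x i ^ 2 := Finset.sum_nonneg fun i _ => sq_nonneg _
  rw [div_mul_eq_mul_div, div_le_iff₀ (by positivity)]
  nlinarith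

lemma exists_sum_sq_lapAct_le (hA : ∀ i j, 0 ≤ A i j)
    (hbal : ∀ i, ∑ j, A i j = ∑ j, A j i) :
    ∃ D, 0 < D ∧ ∀ x : ι → ℝ,
      ∑ i, lapAct A x i ^ 2 ≤ D * ∑ i, x i * lapAct A x i := by
  set S := ∑ i, ∑ j, A i j with hS
  have hS0 : 0 ≤ S := Finset.sum_nonneg fun i _ => Finset.sum_nonneg fun j _ => hA i j
  refine ⟨2 * S + 1, by positivity, fun x => ?_⟩
  have h0 := sum_mul_lapAct_nonneg hA hbal x
  have h1 : ∀ i, lapAct A x i ^ 2 ≤ S * ∑ j, A i j * (x i - x j) ^ 2 := by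
    intro i
    have h2 : lapAct A x i ^ 2 ≤ (∑ j, A i j) * ∑ j, A i j * (x i - x j) ^ 2 := by
      refine Finset.sum_sq_le_sum_mul_sum_of_sq_le_mul _ (fun j _ => hA i j)
        (fun j _ => mul_nonneg (hA i j) (sq_nonneg _)) (fun j _ => (by ring : _ = _).le)
    have h3 : ∑ j, A i j ≤ S :=
      Finset.single_le_sum (f := fun i => ∑ j, A i j)
        (fun i _ => Finset.sum_nonneg fun j _ => hA i j) (Finset.mem_univ i)
    exact h2.trans (mul_le_mul_of_nonneg_right h3
      (Finset.sum_nonneg fun j _ => mul_nonneg (hA i j) (sq_nonneg _)))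
  have h4 : ∑ i, lapAct A x i ^ 2 ≤ S * ∑ i, ∑ j, A i j * (x i - x j) ^ 2 := by
    rw [Finset.mul_sum]
    exact Finset.sum_le_sum fun i _ => h1 i
  have h5 := sum_mul_lapAct hbal x
  nlinarith

/-- Every vector with zero sum is in the range of the Laplacian. -/
lemma exists_lapAct_eq [Nonempty ι] (hA : ∀ i j, 0 ≤ A i j)
    (hbal : ∀ i, ∑ j, A i j = ∑ j, A j i)
    (hconn : ∀ i j : ι, i ≠ j → Relation.TransGen (fun p q => 0 < A q p) i j)
    (w : ι → ℝ) (hw : ∑ i, w i = 0) : ∃ x : ι → ℝ, ∑ i, x i = 0 ∧ ∀ i, lapAct A x i = w i := by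
  obtain ⟨l, hl, hpoin⟩ := exists_poincare hA hbal hconn
  let f : (ι → ℝ) →ₗ[ℝ] (ι → ℝ) :=
    { toFun := fun x i => lapAct A x i + ∑ j, x j
      map_add' := by
        intro x z
        ext i
        have := lapAct_add_smul (A := A) x z 1 i
        simp only [one_mul] at this
        change lapAct A (fun j => x j + z j) i + ∑ j, (x j + z j) = _
        rw [this, Finset.sum_add_distrib, Pi.add_apply]
        ring
      map_smul' := by
        intro c x
        ext i
        have := lapAct_add_smul (A := A) 0 x c i
        simp only [Pi.zero_apply, zero_add] at this
        change lapAct A (fun j => c * x j) i + ∑ j, (c * x j) = c * (lapAct A x i + ∑ j, x j)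
        rw [this, ← Finset.mul_sum]
        simp [lapAct]
        ring }
  have hsum : ∀ x, ∑ i, f x i = Fintype.card ι * ∑ j, x j := by
    intro x
    change ∑ i, (lapAct A x i + ∑ j, x j) = _
    rw [Finset.sum_add_distrib, sum_lapAct hbal]
    simp
  have hcard : (Fintype.card ι : ℝ) ≠ 0 := by exact_mod_cast Fintype.card_ne_zero
  have hzero : ∀ x, ∑ i, f x i = 0 → ∑ i, x i = 0 := by
    intro x hx
    rw [hsum] at hx
    exact (mul_eq_zero.mp hx).resolve_left hcard
  have hinj : Function.Injective f := by
    rw [injective_iff_map_eq_zero]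
    intro x hx
    have h0 : ∑ i, x i = 0 := hzero x (by simp [hx])
    have h1 : ∀ i, lapAct A x i = 0 := by
      intro i
      have : lapAct A x i + ∑ j, x j = 0 := congrFun hx i
      linarith
    have h2 := hpoin x h0
    simp only [h1, mul_zero, Finset.sum_const_zero] at h2
    have h3 : 0 ≤ ∑ i, x i ^ 2 := Finset.sum_nonneg fun i _ => sq_nonneg _
    have h4 : ∑ i, x i ^ 2 = 0 := by nlinarith
    rw [Finset.sum_eq_zero_iff_of_nonneg (fun i _ => sq_nonneg _)] at h4
    ext i
    simpa using h4 i (Finset.mem_univ i)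
  obtain ⟨x, hx⟩ := LinearMap.injective_iff_surjective.mp hinj w
  have h0 : ∑ i, x i = 0 := hzero x (by rw [hx, hw])
  refine ⟨x, h0, fun i => ?_⟩
  have : lapAct A x i + ∑ j, x j = w i := congrFun hx i
  linarith

lemma sum_mul_le_of_sq (x w : ι → ℝ) {c : ℝ} (hc : 0 < c) :
    ∑ i, x i * w i ≤ c / 2 * ∑ i, x i ^ 2 + 1 / (2 * c) * ∑ i, w i ^ 2 := by
  rw [Finset.mul_sum, Finset.mul_sum, ← Finset.sum_add_distrib]
  refine Finset.sum_le_sum fun i _ => ?_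
  have : c / 2 * x i ^ 2 + 1 / (2 * c) * w i ^ 2 - x i * w i = (c * x i - w i) ^ 2 / (2 * c) := by
    field_simp
    ring
  have : 0 ≤ (c * x i - w i) ^ 2 / (2 * c) := by positivity
  linarith

/-- For a large enough gain the quadratic Lyapunov function of the signal generator, restricted to
zero-sum vectors, decreases. -/
lemma exists_gain [Nonempty ι] (hA : ∀ i j, 0 ≤ A i j)
    (hbal : ∀ i, ∑ j, A i j = ∑ j, A j i)
    (hconn : ∀ i j : ι, i ≠ j → Relation.TransGen (fun p q => 0 < A q p) i j) :
    ∃ β, 0 < β ∧ ∀ x w : ι → ℝ, ∑ i, x i = 0 → ∑ i, w i = 0 →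
      ∑ i, (x i * (-2 * x i - (β - 1) * lapAct A x i - lapAct A w i)
          + w i * (-2 * x i - lapAct A w i + lapAct A x i))
        ≤ -(2 * ∑ i, x i ^ 2 + ∑ i, x i * lapAct A x i
            + (∑ i, w i * lapAct A w i) / 4) := by
  obtain ⟨l, hl, hpoin⟩ := exists_poincare hA hbal hconn
  obtain ⟨D, hD, hlap⟩ := exists_sum_sq_lapAct_le hA hbal
  refine ⟨2 + 2 * D / l + 4 / l ^ 2, by positivity, fun x w hx hw => ?_⟩
  have e1 : ∑ i, (-x i) * lapAct A w i ≤ _ :=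
    sum_mul_le_of_sq (fun i => -x i) (lapAct A w) (c := 2 * D) (by positivity)
  have e2 : ∑ i, w i * (-(2 * x i)) ≤ _ :=
    sum_mul_le_of_sq w (fun i => -(2 * x i)) (c := l / 2) (by positivity)
  have e3 : ∑ i, w i * lapAct A x i ≤ _ :=
    sum_mul_le_of_sq w (lapAct A x) (c := l / 2) (by positivity)
  have px := hpoin x hx
  have pw := hpoin w hw
  have lx := hlap x
  have lw := hlap w
  have split : ∀ β : ℝ, ∑ i, (x i * (-2 * x i - (β - 1) * lapAct A x i - lapAct A w i)
          + w i * (-2 * x i - lapAct A w i + lapAct A x i))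
      = -2 * ∑ i, x i ^ 2 - (β - 1) * ∑ i, x i * lapAct A x i + ∑ i, (-x i) * lapAct A w i
        + ∑ i, w i * (-(2 * x i)) - ∑ i, w i * lapAct A w i + ∑ i, w i * lapAct A x i := by
    intro β
    simp only [Finset.mul_sum, ← Finset.sum_add_distrib, ← Finset.sum_sub_distrib]
    exact Finset.sum_congr rfl fun i _ => by ring
  have hx2 : ∑ i, (-(2 * x i)) ^ 2 = 4 * ∑ i, x i ^ 2 := by
    rw [Finset.mul_sum]
    exact Finset.sum_congr rfl fun i _ => by ring
  have hx3 : ∑ i, (-x i) ^ 2 = ∑ i, x i ^ 2 := by simp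
  rw [split]
  rw [hx2] at e2
  rw [hx3] at e1
  set X := ∑ i, x i ^ 2
  set Y := ∑ i, w i ^ 2
  set EX := ∑ i, x i * lapAct A x i
  set EW := ∑ i, w i * lapAct A w i
  set LX := ∑ i, lapAct A x i ^ 2
  set LW := ∑ i, lapAct A w i ^ 2
  have hX : X ≤ EX / l := by rw [le_div_iff₀ hl]; linarith
  have f1 : 2 * D / 2 * X + 1 / (2 * (2 * D)) * LW ≤ D / l * EX + EW / 4 := by
    have : 1 / (2 * (2 * D)) * LW ≤ EW / 4 := by
      rw [one_div_mul_eq_div, div_le_iff₀ (by positivity)]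
      linarith
    have : D * X ≤ D * (EX / l) := mul_le_mul_of_nonneg_left hX hD.le
    have : D / l * EX = D * (EX / l) := by ring
    linarith
  have f2 : l / 2 / 2 * Y + 1 / (2 * (l / 2)) * (4 * X) ≤ EW / 4 + 4 / l ^ 2 * EX := by
    have : 4 / l * X ≤ 4 / l * (EX / l) := mul_le_mul_of_nonneg_left hX (by positivity)
    have h1 : 1 / (2 * (l / 2)) * (4 * X) = 4 / l * X := by field_simp
    have h2 : 4 / l ^ 2 * EX = 4 / l * (EX / l) := by field_simp
    rw [h1, h2]
    linarith
  have f3 : l / 2 / 2 * Y + 1 / (2 * (l / 2)) * LX ≤ EW / 4 + D / l * EX := by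
    have h1 : 1 / (2 * (l / 2)) * LX = LX / l := by field_simp
    have h2 : D / l * EX = D * EX / l := by ring
    rw [h1, h2]
    have : LX / l ≤ D * EX / l := by gcongr
    linarith
  have h2 : 2 * D / l * EX = D / l * EX + D / l * EX := by ring
  linarith

end Laplacian

lemma antitoneOn_Ici_of_hasDerivAt_nonpos {f f' : ℝ → ℝ} {T : ℝ}
    (hf : ∀ t, T ≤ t → HasDerivAt f (f' t) t) (hf' : ∀ t, T ≤ t → f' t ≤ 0) :
    AntitoneOn f (Set.Ici T) := by
  refine antitoneOn_of_hasDerivWithinAt_nonpos (f' := f') (convex_Ici T)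
    (fun t ht => (hf t ht).continuousAt.continuousWithinAt) (fun t ht => ?_) (fun t ht => ?_)
  · exact (hf t (interior_subset ht)).hasDerivWithinAt
  · exact hf' t (interior_subset ht)

/-- A nonnegative solution of `U' ≤ -c U + G'` with `G` convergent tends to zero. -/
lemma tendsto_zero_of_deriv_le {U U' G G' : ℝ → ℝ} {c g : ℝ} (hc : 0 < c)
    (hU0 : ∀ t, 0 ≤ t → 0 ≤ U t) (hU : ∀ t, 0 ≤ t → HasDerivAt U (U' t) t)
    (hG : ∀ t, 0 ≤ t → HasDerivAt G (G' t) t) (hGlim : Tendsto G atTop (nhds g))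
    (hle : ∀ t, 0 ≤ t → U' t ≤ -c * U t + G' t) : Tendsto U atTop (nhds 0) := by
  rw [Metric.tendsto_atTop]
  intro δ hδ
  obtain ⟨T₀, hT₀⟩ := (Metric.tendsto_atTop.mp hGlim) (δ / 4) (by positivity)
  set T := max T₀ 0
  have hT : 0 ≤ T := le_max_right _ _
  have hGT : ∀ t, T ≤ t → |G t - g| < δ / 4 := fun t ht => hT₀ t ((le_max_left _ _).trans ht)
  have hexp : ∀ t, HasDerivAt (fun t => Real.exp (c * t)) (Real.exp (c * t) * c) t := by
    intro t
    simpa using ((hasDerivAt_id t).const_mul c).exp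
  have anti := antitoneOn_Ici_of_hasDerivAt_nonpos (T := T)
    (f := fun t => Real.exp (c * t) * (U t + (g - G t) - δ / 4))
    (f' := fun t => Real.exp (c * t) * c * (U t + (g - G t) - δ / 4)
      + Real.exp (c * t) * (U' t - G' t)) (fun t ht => by
        have := (hexp t).mul ((((hU t (hT.trans ht)).add
          ((hG t (hT.trans ht)).const_sub g))).sub_const (δ / 4))
        exact this.congr_deriv (by simp; ring)) (fun t ht => by
        have h1 := hle t (hT.trans ht)
        have h2 := (abs_lt.mp (hGT t ht)).1
        have h3 : Real.exp (c * t) * c * (U t + (g - G t) - δ / 4)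
          + Real.exp (c * t) * (U' t - G' t)
          = Real.exp (c * t) * (c * (U t + (g - G t) - δ / 4) + (U' t - G' t)) := by ring
        rw [h3]
        refine mul_nonpos_of_nonneg_of_nonpos (Real.exp_pos _).le ?_
        nlinarith)
  set M := Real.exp (c * T) * (U T + (g - G T) - δ / 4)
  have hlim : Tendsto (fun t => Real.exp (-(c * t)) * M) atTop (nhds 0) := by
    have : Tendsto (fun t => Real.exp (-(c * t))) atTop (nhds 0) :=
      Real.tendsto_exp_neg_atTop_nhds_zero.comp (tendsto_id.const_mul_atTop hc)
    simpa using this.mul_const M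
  obtain ⟨T₁, hT₁⟩ := (Metric.tendsto_atTop.mp hlim) (δ / 4) (by positivity)
  refine ⟨max T T₁, fun t ht => ?_⟩
  have htT : T ≤ t := (le_max_left _ _).trans ht
  have h1 := anti (Set.mem_Ici.mpr le_rfl) (Set.mem_Ici.mpr htT) htT
  have h2 := hT₁ t ((le_max_right _ _).trans ht)
  rw [Real.dist_eq, sub_zero] at h2 ⊢
  rw [abs_of_nonneg (hU0 t (hT.trans htT))]
  have h3 : U t + (g - G t) - δ / 4 ≤ Real.exp (-(c * t)) * M := by
    have := mul_le_mul_of_nonneg_left h1 (Real.exp_pos (-(c * t))).le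
    simp only at this
    rwa [← mul_assoc, ← Real.exp_add, neg_add_cancel, Real.exp_zero, one_mul] at this
  have h4 := (abs_lt.mp h2).2
  have h5 := (abs_lt.mp (hGT t htT)).2
  linarith

lemma eventually_abs_le_of_tendsto {f : ℝ → ℝ} {l : ℝ} (hf : ∀ t, 0 ≤ t → ContinuousAt f t)
    (hl : Tendsto f atTop (nhds l)) : ∀ᶠ B in atTop, ∀ t, 0 ≤ t → |f t| ≤ B := by
  obtain ⟨T, hT⟩ := (Metric.tendsto_atTop.mp hl) 1 one_pos
  obtain ⟨B, hB⟩ := (isCompact_Icc (a := (0 : ℝ)) (b := T)).exists_bound_of_continuousOn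
    (fun t ht => (hf t ht.1).continuousWithinAt)
  filter_upwards [eventually_ge_atTop (max B (|l| + 1))] with M hM t ht
  refine le_trans ?_ hM
  rcases le_total t T with h | h
  · exact (hB t ⟨ht, h⟩).trans (le_max_left _ _)
  · refine le_trans ?_ (le_max_right _ _)
    have h1 := hT t h
    rw [Real.dist_eq] at h1
    have h2 : |f t| ≤ |f t - l| + |l| := by simpa using abs_add_le (f t - l) l
    linarith

lemma exists_tendsto_of_monotoneOn_Ici {f : ℝ → ℝ} {B : ℝ} (hf : MonotoneOn f (Set.Ici 0))
    (hB : ∀ t, 0 ≤ t → f t ≤ B) : ∃ l, Tendsto f atTop (nhds l) := by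
  have hm : Monotone fun t => f (max t 0) := fun s t hst =>
    hf (Set.mem_Ici.mpr (le_max_right _ _)) (Set.mem_Ici.mpr (le_max_right _ _))
      (max_le_max_right 0 hst)
  have hb : BddAbove (Set.range fun t => f (max t 0)) := by
    refine ⟨B, ?_⟩
    rintro _ ⟨t, rfl⟩
    exact hB _ (le_max_right _ _)
  refine ⟨_, (tendsto_atTop_ciSup hm hb).congr' ?_⟩
  filter_upwards [eventually_ge_atTop 0] with t ht
  rw [max_eq_left ht]

/-- A Nussbaum gain prevents the adaptation parameter from escaping. -/
lemma bounded_of_nussbaum_s14 {Nb : ℝ → ℝ}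
    (hsup : ∀ M : ℝ, ∃ᶠ θ in atTop, M < (∫ s in (0:ℝ)..θ, Nb s) / θ)
    (hinf : ∀ M : ℝ, ∃ᶠ θ in atTop, (∫ s in (0:ℝ)..θ, Nb s) / θ < M)
    {th : ℝ → ℝ} (hth : ContinuousOn th (Set.Ici 0)) {g K P : ℝ} (hg : g ≠ 0)
    (h : ∀ t, 0 ≤ t → 0 ≤ P + g * (∫ s in (0:ℝ)..(th t), Nb s) + K * th t) :
    ∃ B, ∀ t, 0 ≤ t → th t ≤ B := by
  by_contra! hcon
  have hall : ∀ x, th 0 ≤ x → 0 ≤ P + g * (∫ s in (0:ℝ)..x, Nb s) + K * x := by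
    intro x hx
    obtain ⟨t, ht, hxt⟩ := hcon x
    obtain ⟨s, hs, rfl⟩ := intermediate_value_Icc ht
      (hth.mono Set.Icc_subset_Ici_self) ⟨hx, hxt.le⟩
    exact h s hs.1
  have hbad : ∃ᶠ x in atTop, g * ((∫ s in (0:ℝ)..x, Nb s) / x) < -(K + 1) := by
    rcases lt_or_gt_of_ne hg with hneg | hpos
    · refine (hsup (-(K + 1) / g)).mono fun x hx => ?_
      rw [div_lt_iff_of_neg hneg] at hx
      linarith
    · refine (hinf (-(K + 1) / g)).mono fun x hx => ?_
      rw [lt_div_iff₀ hpos] at hx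
      linarith
  obtain ⟨x, hx, hx0, hxP, hxth⟩ := (hbad.and_eventually ((eventually_gt_atTop 0).and
    ((eventually_gt_atTop P).and (eventually_ge_atTop (th 0))))).exists
  have h1 := hall x hxth
  have h2 := mul_lt_mul_of_pos_right hx hx0
  rw [mul_assoc, div_mul_cancel₀ _ hx0.ne'] at h2
  linarith

section LinearFilter

/-- The linear functional `X ^ i ↦ e i t` on polynomials of degree at most `m`. -/
noncomputable def symbolEval (e : ℕ → ℝ → ℂ) (m : ℕ) (p : Polynomial ℂ) (t : ℝ) : ℂ :=
  ∑ i ∈ Finset.range (m + 1), p.coeff i * e i t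

open Polynomial in
lemma hasDerivAt_symbolEval {e : ℕ → ℝ → ℂ} {m : ℕ} {c t : ℝ}
    (he : ∀ i, i < m → HasDerivAt (e i) (c * e (i + 1) t) t) {p : ℂ[X]}
    (hp : p.natDegree < m) (a : ℂ) :
    HasDerivAt (symbolEval e m p)
      (c * (a * symbolEval e m p t + symbolEval e m ((X - C a) * p) t)) t := by
  have hpm : p.coeff m = 0 := coeff_eq_zero_of_natDegree_lt hp
  have h1 : HasDerivAt (fun t => ∑ i ∈ Finset.range m, p.coeff i * e i t)
      (∑ i ∈ Finset.range m, p.coeff i * (c * e (i + 1) t)) t :=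
    HasDerivAt.fun_sum fun i hi => (he i (Finset.mem_range.mp hi)).const_mul _
  have h2 : symbolEval e m p = fun t => ∑ i ∈ Finset.range m, p.coeff i * e i t := by
    ext t
    simp [symbolEval, Finset.sum_range_succ, hpm]
  have h3 : a * symbolEval e m p t + symbolEval e m ((X - C a) * p) t
      = ∑ i ∈ Finset.range (m + 1), (X * p).coeff i * e i t := by
    simp only [symbolEval, Finset.mul_sum, ← Finset.sum_add_distrib]
    refine Finset.sum_congr rfl fun i _ => ?_
    simp only [sub_mul, coeff_sub, coeff_C_mul]
    ring
  rw [h3, Finset.sum_range_succ', coeff_X_mul_zero, zero_mul, add_zero, h2, Finset.mul_sum]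
  convert h1 using 1
  refine Finset.sum_congr rfl fun i _ => ?_
  rw [coeff_X_mul]
  ring

open Polynomial in
/-- Lyapunov function of a stable linear filter, built as a cascade of first-order filters. -/
lemma exists_lyapunov_of_roots {e : ℕ → ℝ → ℂ} {m : ℕ} {c : ℝ} (hc : 0 < c)
    (he : ∀ i, i < m → ∀ t, 0 ≤ t → HasDerivAt (e i) (c * e (i + 1) t) t) (S : Multiset ℂ) :
    (∀ z ∈ S, z.re < 0) → S.card ≤ m →
    ∃ (W W' : ℝ → ℝ) (a K : ℝ), 0 < a ∧ 0 < K ∧ (∀ t, 0 ≤ W t) ∧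
      (∀ t, 0 ≤ t → HasDerivAt W (W' t) t) ∧
      (∀ t, 0 ≤ t →
        W' t ≤ -a * W t + K * ‖symbolEval e m (S.map fun z => X - C z).prod t‖ ^ 2) ∧
      ∀ p : ℂ[X], p.degree < S.card → ∃ B, ∀ t, ‖symbolEval e m p t‖ ^ 2 ≤ B * W t := by
  induction S using Multiset.induction_on with
  | empty =>
    intro _ _
    refine ⟨0, 0, 1, 1, one_pos, one_pos, fun t => le_rfl, fun t _ => hasDerivAt_const t 0,
      fun t _ => by simp, fun p hp => ⟨0, fun t => ?_⟩⟩
    have : p = 0 := by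
      rw [← degree_eq_bot]
      simpa using hp
    simp [this, symbolEval]
  | cons z S ih =>
    intro hS hcard
    rw [Multiset.card_cons] at hcard
    obtain ⟨W, W', a, K, ha, hK, hW0, hW, hle, hp⟩ :=
      ih (fun x hx => hS x (Multiset.mem_cons_of_mem hx)) (by omega)
    set q := (S.map fun z => X - C z).prod with hq
    have hqdeg : q.natDegree = S.card := natDegree_multiset_prod_X_sub_C_eq_card S
    have hqmonic : q.Monic := monic_multisetProd_X_sub_C S
    set μ := -z.re with hμ
    have hμ0 : 0 < μ := by
      have := hS z (Multiset.mem_cons_self z S)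
      linarith
    set γ := 2 * K / (c * μ) with hγ
    have hγ0 : 0 < γ := by positivity
    have hγK : γ * c * μ = 2 * K := by
      rw [hγ]
      field_simp
    set s := symbolEval e m ((X - C z) * q) with hs
    set x := symbolEval e m q with hx
    refine ⟨fun t => W t + γ * ‖x t‖ ^ 2,
      fun t => W' t + γ * (2 * inner ℝ (x t) (c * (z * x t + s t))),
      min a (c * μ / 2), γ * c / μ, by positivity, by positivity,
      fun t => add_nonneg (hW0 t) (by positivity), fun t ht => ?_, fun t ht => ?_, ?_⟩
    · have h1 : HasDerivAt x (c * (z * x t + s t)) t :=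
        hasDerivAt_symbolEval (fun i hi => he i hi t ht) (by omega) z
      exact (hW t ht).add (h1.norm_sq.const_mul γ)
    · simp only [Multiset.map_cons, Multiset.prod_cons]
      rw [← hq, ← hs]
      have h1 : inner ℝ (x t) (c * (z * x t + s t))
          = c * (-μ * ‖x t‖ ^ 2 + inner ℝ (x t) (s t)) := by
        rw [← Complex.normSq_eq_norm_sq, Complex.normSq_apply]
        simp [Complex.inner, hμ]
        ring
      have h2 : inner ℝ (x t) (s t) ≤ ‖x t‖ * ‖s t‖ := real_inner_le_norm _ _
      have h3 : ‖x t‖ * ‖s t‖ ≤ μ / 2 * ‖x t‖ ^ 2 + ‖s t‖ ^ 2 / (2 * μ) := by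
        have : μ / 2 * ‖x t‖ ^ 2 + ‖s t‖ ^ 2 / (2 * μ) - ‖x t‖ * ‖s t‖
            = (μ * ‖x t‖ - ‖s t‖) ^ 2 / (2 * μ) := by
          field_simp
          ring
        have : 0 ≤ (μ * ‖x t‖ - ‖s t‖) ^ 2 / (2 * μ) := by positivity
        linarith
      have h4 : γ * (2 * inner ℝ (x t) (c * (z * x t + s t)))
          ≤ -(γ * c * μ) * ‖x t‖ ^ 2 + γ * c / μ * ‖s t‖ ^ 2 := by
        rw [h1]
        have : γ * (2 * (c * (-μ * ‖x t‖ ^ 2 + inner ℝ (x t) (s t))))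
            ≤ γ * (2 * (c * (-μ * ‖x t‖ ^ 2 + (μ / 2 * ‖x t‖ ^ 2 + ‖s t‖ ^ 2 / (2 * μ))))) := by
          gcongr
          linarith
        refine this.trans (le_of_eq ?_)
        field_simp
        ring
      have h5 := hle t ht
      have h6 : min a (c * μ / 2) * W t ≤ a * W t :=
        mul_le_mul_of_nonneg_right (min_le_left _ _) (hW0 t)
      have h7 : min a (c * μ / 2) * (γ * ‖x t‖ ^ 2) ≤ c * μ / 2 * (γ * ‖x t‖ ^ 2) :=
        mul_le_mul_of_nonneg_right (min_le_right _ _) (by positivity)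
      have h8 : c * μ / 2 * (γ * ‖x t‖ ^ 2) = K * ‖x t‖ ^ 2 := by
        linear_combination (‖x t‖ ^ 2 / 2) * hγK
      rw [hγK] at h4
      linarith
    · intro p hpdeg
      rw [Multiset.card_cons] at hpdeg
      set d := p.coeff S.card with hd
      obtain ⟨B, hB⟩ := hp (p - C d * q) (by
        rw [degree_lt_iff_coeff_zero]
        intro i hi
        rw [coeff_sub, coeff_C_mul]
        rcases hi.eq_or_lt with rfl | hi
        · have : q.coeff S.card = 1 := by rw [← hqdeg]; exact hqmonic.coeff_natDegree
          rw [this, ← hd, mul_one, sub_self]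
        · rw [coeff_eq_zero_of_natDegree_lt (p := q) (hqdeg.trans_lt hi), mul_zero, sub_zero]
          exact (degree_lt_iff_coeff_zero p _).mp hpdeg i (by omega))
      refine ⟨2 * |B| + 2 * ‖d‖ ^ 2 / γ, fun t => ?_⟩
      have h1 : symbolEval e m p t = symbolEval e m (p - C d * q) t + d * x t := by
        simp only [hx, symbolEval, Finset.mul_sum, ← Finset.sum_add_distrib]
        refine Finset.sum_congr rfl fun i _ => ?_
        simp only [coeff_sub, coeff_C_mul]
        ring
      have h2 : ‖symbolEval e m p t‖ ≤ ‖symbolEval e m (p - C d * q) t‖ + ‖d‖ * ‖x t‖ := by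
        rw [h1, ← norm_mul]
        exact norm_add_le _ _
      set n₁ := ‖symbolEval e m (p - C d * q) t‖
      have h3 : ‖symbolEval e m p t‖ ^ 2 ≤ 2 * n₁ ^ 2 + 2 * (‖d‖ * ‖x t‖) ^ 2 := by
        have := pow_le_pow_left₀ (norm_nonneg _) h2 2
        nlinarith [sq_nonneg (n₁ - ‖d‖ * ‖x t‖)]
      have h4 : n₁ ^ 2 ≤ |B| * W t :=
        (hB t).trans (mul_le_mul_of_nonneg_right (le_abs_self B) (hW0 t))
      have h5 : 0 ≤ |B| * (γ * ‖x t‖ ^ 2) := by positivity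
      have h6 : 0 ≤ ‖d‖ ^ 2 / γ * W t := mul_nonneg (by positivity) (hW0 t)
      have h7 : (2 * |B| + 2 * ‖d‖ ^ 2 / γ) * (W t + γ * ‖x t‖ ^ 2)
          = 2 * (|B| * W t) + 2 * (|B| * (γ * ‖x t‖ ^ 2)) + 2 * (‖d‖ ^ 2 / γ * W t)
            + 2 * (‖d‖ * ‖x t‖) ^ 2 := by
        field_simp
        ring
      rw [h7]
      linarith

open Polynomial in
/-- Lyapunov function of the filter `s = ∑ k_ι e_{ι-1} + e_m` with Hurwitz symbol. -/
lemma exists_lyapunov_of_hurwitz {e : ℕ → ℝ → ℝ} {m : ℕ} {c : ℝ} (hc : 0 < c)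
    (he : ∀ i, i < m → ∀ t, 0 ≤ t → HasDerivAt (e i) (c * e (i + 1) t) t) {k : ℕ → ℝ}
    (hk : ∀ z : ℂ, (X ^ m + ∑ ι ∈ Finset.Icc 1 m,
      C (k ι : ℂ) * X ^ (ι - 1)).IsRoot z → z.re < 0) :
    ∃ (W W' : ℝ → ℝ) (a K B : ℝ), 0 < a ∧ 0 < K ∧ 0 < B ∧ (∀ t, 0 ≤ W t) ∧
      (∀ t, 0 ≤ t → HasDerivAt W (W' t) t) ∧
      (∀ t, 0 ≤ t →
        W' t ≤ -a * W t + K * ((∑ ι ∈ Finset.Icc 1 m, k ι * e (ι - 1) t) + e m t) ^ 2) ∧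
      ∀ i, i < m → ∀ t, e i t ^ 2 ≤ B * W t := by
  set q : ℂ[X] := X ^ m + ∑ ι ∈ Finset.Icc 1 m, C (k ι : ℂ) * X ^ (ι - 1) with hq
  have hlow : (∑ ι ∈ Finset.Icc 1 m, C (k ι : ℂ) * X ^ (ι - 1)).degree < (m : WithBot ℕ) := by
    rw [degree_lt_iff_coeff_zero]
    intro i hi
    rw [finsetSum_coeff]
    refine Finset.sum_eq_zero fun ι hι => ?_
    have := Finset.mem_Icc.mp hι
    rw [coeff_C_mul, coeff_X_pow, if_neg (by omega), mul_zero]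
  have hmonic : q.Monic := monic_X_pow_add hlow
  have hdeg : q.natDegree = m := by
    refine natDegree_eq_of_degree_eq_some ?_
    rw [hq, degree_add_eq_left_of_degree_lt (by rwa [degree_X_pow]), degree_X_pow]
  have hsplit := IsAlgClosed.splits q
  have hprod : (q.roots.map fun z => X - C z).prod = q :=
    (hsplit.eq_prod_roots_of_monic hmonic).symm
  have hcard : q.roots.card = m := by rw [← hdeg]; exact hsplit.natDegree_eq_card_roots.symm
  obtain ⟨W, W', a, K, ha, hK, hW0, hW, hle, hp⟩ :=
    exists_lyapunov_of_roots (e := fun i t => (e i t : ℂ)) (m := m) hc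
      (fun i hi t ht => by simpa using (he i hi t ht).ofReal_comp) q.roots
      (fun z hz => hk z (isRoot_of_mem_roots hz)) hcard.le
  have hX : ∀ i, i ≤ m → ∀ t,
      symbolEval (fun i t => (e i t : ℂ)) m (X ^ i) t = e i t := by
    intro i hi t
    simp only [symbolEval, coeff_X_pow]
    rw [Finset.sum_eq_single_of_mem i (Finset.mem_range.mpr (by omega))
      (fun j _ hj => by simp [hj])]
    simp
  have hqe : ∀ t, symbolEval (fun i t => (e i t : ℂ)) m q t
      = (((∑ ι ∈ Finset.Icc 1 m, k ι * e (ι - 1) t) + e m t : ℝ) : ℂ) := by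
    intro t
    have h1 : symbolEval (fun i t => (e i t : ℂ)) m q t
        = symbolEval (fun i t => (e i t : ℂ)) m (X ^ m) t + ∑ ι ∈ Finset.Icc 1 m,
          (k ι : ℂ) * symbolEval (fun i t => (e i t : ℂ)) m (X ^ (ι - 1)) t := by
      simp only [hq, symbolEval, coeff_add, finsetSum_coeff, coeff_C_mul, add_mul,
        Finset.sum_add_distrib, Finset.sum_mul, Finset.mul_sum]
      rw [Finset.sum_comm]
      simp only [mul_assoc]
    rw [h1, hX m le_rfl]
    push_cast
    rw [add_comm]
    congr 1
    refine Finset.sum_congr rfl fun ι hι => ?_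
    have := Finset.mem_Icc.mp hι
    rw [hX _ (by omega)]
  have hbd : ∀ i, ∃ B, i < m → ∀ t, e i t ^ 2 ≤ B * W t := by
    intro i
    by_cases hi : i < m
    · obtain ⟨B, hB⟩ := hp (X ^ i) (by rw [degree_X_pow, hcard]; exact_mod_cast hi)
      refine ⟨B, fun _ t => ?_⟩
      have := hB t
      rw [hX i hi.le] at this
      simpa using this
    · exact ⟨0, fun h => absurd h hi⟩
  choose B hB using hbd
  refine ⟨W, W', a, K, ∑ i ∈ Finset.range m, |B i| + 1, ha, hK, by positivity, hW0, hW,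
    fun t ht => ?_, fun i hi t => (hB i hi t).trans (mul_le_mul_of_nonneg_right ?_ (hW0 t))⟩
  · have := hle t ht
    rw [hprod, hqe, Complex.norm_real, Real.norm_eq_abs, sq_abs] at this
    exact this
  · have h1 : |B i| ≤ ∑ i ∈ Finset.range m, |B i| :=
      Finset.single_le_sum (f := fun i => |B i|) (fun i _ => abs_nonneg _)
        (Finset.mem_range.mpr hi)
    have h2 := le_abs_self (B i)
    linarith

end LinearFilter

/-- The optimal signal generator: exponential-type decay with a Lyapunov function that dominates
the tracking reference error and its derivative. -/
lemma exists_signal_generator_gain {ι : Type*} [Fintype ι] [Nonempty ι] {A : ι → ι → ℝ}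
    (hA : ∀ i j, 0 ≤ A i j) (hbal : ∀ i, ∑ j, A i j = ∑ j, A j i)
    (hconn : ∀ i j : ι, i ≠ j → Relation.TransGen (fun p q => 0 < A q p) i j) :
    ∃ β, 0 < β ∧ ∀ (d : ι → ℝ) (r v r' : ι → ℝ → ℝ),
      (∀ i t, 0 ≤ t → HasDerivAt (r i) (r' i t) t) →
      (∀ i t, 0 ≤ t → r' i t = -(2 * (r i t - d i)) - β * lapAct A (fun j => r j t) i
        - lapAct A (fun j => v j t) i) →
      (∀ i t, 0 ≤ t → HasDerivAt (v i) (β * lapAct A (fun j => r j t) i) t) →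
      ∃ (V V' : ℝ → ℝ) (C : ℝ), 0 < C ∧ (∀ t, 0 ≤ V t) ∧
        (∀ t, 0 ≤ t → HasDerivAt V (V' t) t) ∧ Tendsto V atTop (nhds 0) ∧
        (∀ i t, 0 ≤ t →
          (r i t - (∑ j, d j) / Fintype.card ι) ^ 2 + r' i t ^ 2 ≤ C * -V' t) ∧
        (∀ i, Tendsto (r i) atTop (nhds ((∑ j, d j) / Fintype.card ι))) ∧
        ∀ i, ∃ l, Tendsto (v i) atTop (nhds l) := by
  obtain ⟨β, hβ, hgain⟩ := exists_gain hA hbal hconn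
  obtain ⟨l, hl, hpoin⟩ := exists_poincare hA hbal hconn
  obtain ⟨D, hD, hlap⟩ := exists_sum_sq_lapAct_le hA hbal
  refine ⟨β, hβ, fun d r v r' hr hr' hv => ?_⟩
  set n : ℝ := (Fintype.card ι : ℝ) with hn
  have hn0 : n ≠ 0 := by rw [hn]; exact_mod_cast Fintype.card_ne_zero
  set avg := (∑ j, d j) / n with havg
  obtain ⟨v₀, hv₀sum, hv₀⟩ := exists_lapAct_eq hA hbal hconn (fun i => 2 * (d i - avg)) (by
    rw [← Finset.mul_sum, Finset.sum_sub_distrib]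
    simp only [Finset.sum_const, Finset.card_univ, nsmul_eq_mul, ← hn]
    rw [havg, mul_div_cancel₀ _ hn0]
    ring)
  set a : ℝ → ℝ := fun t => (∑ j, r j t) / n - avg with ha
  set x : ι → ℝ → ℝ := fun i t => r i t - (∑ j, r j t) / n with hx
  set w : ι → ℝ → ℝ := fun i t => x i t + (v i t - v₀ i - (∑ j, v j t) / n) with hw
  have hmean : ∀ z : ι → ℝ, ∑ i, (z i - (∑ j, z j) / n) = 0 := by
    intro z
    rw [Finset.sum_sub_distrib]
    simp only [Finset.sum_const, Finset.card_univ, nsmul_eq_mul, ← hn]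
    rw [mul_div_cancel₀ _ hn0, sub_self]
  have hxsum : ∀ t, ∑ i, x i t = 0 := fun t => hmean fun i => r i t
  have hwsum : ∀ t, ∑ i, w i t = 0 := by
    intro t
    have h1 : ∀ i, w i t = x i t + (v i t - (∑ j, v j t) / n) - v₀ i := fun i => by
      simp only [hw]
      ring
    simp only [h1, Finset.sum_sub_distrib (f := fun i => x i t + (v i t - (∑ j, v j t) / n)),
      Finset.sum_add_distrib, hxsum, hv₀sum]
    rw [hmean fun i => v i t]
    simp
  have hxlap : ∀ i t, lapAct A (fun j => x j t) i = lapAct A (fun j => r j t) i := by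
    intro i t
    simp [lapAct, hx]
  have hvlap : ∀ i t, lapAct A (fun j => v j t) i
      = lapAct A (fun j => w j t) i - lapAct A (fun j => x j t) i + 2 * (d i - avg) := by
    intro i t
    rw [← hv₀ i]
    simp only [lapAct, hw, ← Finset.sum_sub_distrib, ← Finset.sum_add_distrib]
    exact Finset.sum_congr rfl fun j _ => by ring
  have hr'eq : ∀ i t, 0 ≤ t → r' i t = -2 * (x i t + a t)
      - (β - 1) * lapAct A (fun j => x j t) i - lapAct A (fun j => w j t) i := by
    intro i t ht
    rw [hr' i t ht, hvlap, ← hxlap]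
    simp only [hx, ha]
    ring
  have hr'sum : ∀ t, 0 ≤ t → (∑ j, r' j t) / n = -2 * a t := by
    intro t ht
    have h1 : ∑ j, r' j t = -2 * ∑ j, x j t - 2 * (n * a t) := by
      have : ∀ j, r' j t = -2 * x j t - 2 * a t
          - (β - 1) * lapAct A (fun j => x j t) j - lapAct A (fun j => w j t) j := fun j => by
        rw [hr'eq j t ht]
        ring
      simp only [this, Finset.sum_sub_distrib, ← Finset.mul_sum, sum_lapAct hbal]
      simp only [Finset.sum_const, Finset.card_univ, nsmul_eq_mul, ← hn]
      ring
    rw [h1, hxsum]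
    field_simp
    ring
  have hrsum : ∀ t, 0 ≤ t → HasDerivAt (fun t => (∑ j, r j t) / n) (-2 * a t) t := by
    intro t ht
    rw [← hr'sum t ht]
    exact (HasDerivAt.fun_sum fun j _ => hr j t ht).div_const n
  have hvsum : ∀ t, 0 ≤ t → HasDerivAt (fun t => (∑ j, v j t) / n) 0 t := by
    intro t ht
    have := (HasDerivAt.fun_sum fun j (_ : j ∈ Finset.univ) => hv j t ht).div_const n
    rwa [← Finset.mul_sum, sum_lapAct hbal, mul_zero, zero_div] at this
  have had : ∀ t, 0 ≤ t → HasDerivAt a (-2 * a t) t := fun t ht => (hrsum t ht).sub_const avg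
  have hxd : ∀ i t, 0 ≤ t → HasDerivAt (x i) (-2 * x i t
      - (β - 1) * lapAct A (fun j => x j t) i - lapAct A (fun j => w j t) i) t := by
    intro i t ht
    refine ((hr i t ht).sub (hrsum t ht)).congr_deriv ?_
    rw [hr'eq i t ht]
    ring
  have hwd : ∀ i t, 0 ≤ t → HasDerivAt (w i) (-2 * x i t
      - lapAct A (fun j => w j t) i + lapAct A (fun j => x j t) i) t := by
    intro i t ht
    refine ((hxd i t ht).add (((hv i t ht).sub_const (v₀ i)).sub (hvsum t ht))).congr_deriv ?_
    rw [hxlap]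
    ring
  set V : ℝ → ℝ := fun t => a t ^ 2 + (∑ i, (x i t ^ 2 + w i t ^ 2)) / 2 with hV
  set V' : ℝ → ℝ := fun t => -4 * a t ^ 2
    + ∑ i, (x i t * (-2 * x i t - (β - 1) * lapAct A (fun j => x j t) i
        - lapAct A (fun j => w j t) i)
      + w i t * (-2 * x i t - lapAct A (fun j => w j t) i + lapAct A (fun j => x j t) i)) with hV'
  have hVd : ∀ t, 0 ≤ t → HasDerivAt V (V' t) t := by
    intro t ht
    refine (((had t ht).pow 2).add ((HasDerivAt.fun_sum fun i (_ : i ∈ Finset.univ) =>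
      ((hxd i t ht).pow 2).add ((hwd i t ht).pow 2)).div_const 2)).congr_deriv ?_
    rw [hV', Finset.sum_div]
    simp only [Nat.cast_ofNat, Nat.add_one_sub_one, pow_one]
    congr 1
    · ring
    · exact Finset.sum_congr rfl fun i _ => by ring
  have hV0 : ∀ t, 0 ≤ V t := fun t => by positivity
  have hxV : ∀ i t, x i t ^ 2 ≤ ∑ i, x i t ^ 2 := fun i t =>
    Finset.single_le_sum (f := fun i => x i t ^ 2) (fun i _ => sq_nonneg _) (Finset.mem_univ i)
  have hwV : ∀ i t, w i t ^ 2 ≤ ∑ i, w i t ^ 2 := fun i t =>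
    Finset.single_le_sum (f := fun i => w i t ^ 2) (fun i _ => sq_nonneg _) (Finset.mem_univ i)
  have hVsplit : ∀ t, V t = a t ^ 2 + (∑ i, x i t ^ 2) / 2 + (∑ i, w i t ^ 2) / 2 := by
    intro t
    simp only [hV, Finset.sum_add_distrib]
    ring
  set Q : ℝ → ℝ := fun t => 4 * a t ^ 2 + 2 * ∑ i, x i t ^ 2
    + ∑ i, x i t * lapAct A (fun j => x j t) i
    + (∑ i, w i t * lapAct A (fun j => w j t) i) / 4 with hQ
  have hVQ : ∀ t, V' t ≤ -Q t := by
    intro t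
    have := hgain (fun i => x i t) (fun i => w i t) (hxsum t) (hwsum t)
    simp only [hV', hQ]
    linarith
  have hEx : ∀ t, 0 ≤ ∑ i, x i t * lapAct A (fun j => x j t) i := fun t =>
    sum_mul_lapAct_nonneg hA hbal fun i => x i t
  have hEw : ∀ t, 0 ≤ ∑ i, w i t * lapAct A (fun j => w j t) i := fun t =>
    sum_mul_lapAct_nonneg hA hbal fun i => w i t
  have hVlim : Tendsto V atTop (nhds 0) := by
    refine tendsto_zero_of_deriv_le (c := min 2 (l / 2)) (G := fun _ => 0) (G' := fun _ => 0)
      (by positivity) (fun t _ => hV0 t) hVd (fun t _ => hasDerivAt_const t 0)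
      tendsto_const_nhds fun t ht => ?_
    have h1 := hpoin (fun i => w i t) (hwsum t)
    have h2 := hVQ t
    have h3 : min 2 (l / 2) * (a t ^ 2 + (∑ i, x i t ^ 2) / 2)
        ≤ 2 * (a t ^ 2 + (∑ i, x i t ^ 2) / 2) :=
      mul_le_mul_of_nonneg_right (min_le_left _ _) (by positivity)
    have h4 : min 2 (l / 2) * ((∑ i, w i t ^ 2) / 2) ≤ l / 2 * ((∑ i, w i t ^ 2) / 2) :=
      mul_le_mul_of_nonneg_right (min_le_right _ _) (by positivity)
    have h5 : 0 ≤ ∑ i, x i t ^ 2 := by positivity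
    rw [hVsplit]
    simp only [hQ] at h2
    linarith [sq_nonneg (a t), hEx t]
  have hsq : ∀ f : ℝ → ℝ, (∀ t, f t ^ 2 ≤ 2 * V t) → Tendsto f atTop (nhds 0) := by
    intro f hf
    have h1 : Tendsto (fun t => f t ^ 2) atTop (nhds 0) :=
      squeeze_zero (fun t => sq_nonneg _) hf (by simpa using hVlim.const_mul 2)
    have h2 := h1.sqrt
    simp only [Real.sqrt_sq_eq_abs, Real.sqrt_zero] at h2
    exact (tendsto_zero_iff_abs_tendsto_zero f).mpr h2
  have halim : Tendsto a atTop (nhds 0) := hsq a fun t => by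
    have h1 : 0 ≤ ∑ i, x i t ^ 2 := by positivity
    have h2 : 0 ≤ ∑ i, w i t ^ 2 := by positivity
    rw [hVsplit]
    linarith [sq_nonneg (a t)]
  have hxlim : ∀ i, Tendsto (x i) atTop (nhds 0) := fun i => hsq _ fun t => by
    have h2 : 0 ≤ ∑ i, w i t ^ 2 := by positivity
    rw [hVsplit]
    linarith [sq_nonneg (a t), hxV i t]
  have hwlim : ∀ i, Tendsto (w i) atTop (nhds 0) := fun i => hsq _ fun t => by
    have h2 : 0 ≤ ∑ i, x i t ^ 2 := by positivity
    rw [hVsplit]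
    linarith [sq_nonneg (a t), hwV i t]
  refine ⟨V, V', 13 + 3 * (β - 1) ^ 2 * D + 12 * D, by positivity, hV0, hVd, hVlim,
    fun i t ht => ?_, fun i => ?_, fun i => ?_⟩
  · have hra : r i t - avg = x i t + a t := by
      simp only [hx, ha]
      ring
    rw [hr'eq i t ht, hra]
    set b₁ := lapAct A (fun j => x j t) i
    set b₂ := lapAct A (fun j => w j t) i
    have h1 : b₁ ^ 2 ≤ D * ∑ i, x i t * lapAct A (fun j => x j t) i :=
      (Finset.single_le_sum (f := fun i => lapAct A (fun j => x j t) i ^ 2)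
        (fun i _ => sq_nonneg _) (Finset.mem_univ i)).trans (hlap fun i => x i t)
    have h2 : b₂ ^ 2 ≤ D * ∑ i, w i t * lapAct A (fun j => w j t) i :=
      (Finset.single_le_sum (f := fun i => lapAct A (fun j => w j t) i ^ 2)
        (fun i _ => sq_nonneg _) (Finset.mem_univ i)).trans (hlap fun i => w i t)
    have hXQ : (x i t + a t) ^ 2 ≤ Q t := by
      simp only [hQ]
      nlinarith [hxV i t, hEx t, hEw t, sq_nonneg (x i t - a t), sq_nonneg (a t)]
    have h0 : 0 ≤ ∑ i, x i t ^ 2 := by positivity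
    have hExQ : ∑ i, x i t * lapAct A (fun j => x j t) i ≤ Q t := by
      simp only [hQ]
      linarith [hEw t, sq_nonneg (a t)]
    have hEwQ : ∑ i, w i t * lapAct A (fun j => w j t) i ≤ 4 * Q t := by
      simp only [hQ]
      linarith [hEx t, sq_nonneg (a t)]
    have h3 : b₁ ^ 2 ≤ D * Q t := h1.trans (mul_le_mul_of_nonneg_left hExQ hD.le)
    have h4 : b₂ ^ 2 ≤ D * (4 * Q t) := h2.trans (mul_le_mul_of_nonneg_left hEwQ hD.le)
    have h5 : (β - 1) ^ 2 * b₁ ^ 2 ≤ (β - 1) ^ 2 * (D * Q t) :=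
      mul_le_mul_of_nonneg_left h3 (sq_nonneg _)
    set y := x i t + a t
    have h6 : (-2 * y - (β - 1) * b₁ - b₂) ^ 2
        ≤ 12 * y ^ 2 + 3 * ((β - 1) ^ 2 * b₁ ^ 2) + 3 * b₂ ^ 2 := by
      nlinarith [sq_nonneg (2 * y - (β - 1) * b₁), sq_nonneg (2 * y - b₂),
        sq_nonneg ((β - 1) * b₁ - b₂)]
    have h7 : (13 + 3 * (β - 1) ^ 2 * D + 12 * D) * Q t
        ≤ (13 + 3 * (β - 1) ^ 2 * D + 12 * D) * -V' t :=
      mul_le_mul_of_nonneg_left (by linarith [hVQ t]) (by positivity)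
    refine le_trans ?_ h7
    linarith
  · have := ((hxlim i).add halim).add_const avg
    simp only [add_zero, zero_add] at this
    refine this.congr fun t => ?_
    simp only [hx, ha]
    ring
  · obtain ⟨s, hs⟩ : ∃ s, ∀ t, 0 ≤ t → (∑ j, v j t) / n = s := by
      refine ⟨(∑ j, v j 0) / n, fun t ht => ?_⟩
      exact constant_of_has_deriv_right_zero
        (fun s hs => (hvsum s hs.1).continuousAt.continuousWithinAt)
        (fun s hs => (hvsum s hs.1).hasDerivWithinAt) t ⟨ht, le_rfl⟩
    refine ⟨v₀ i + s, ?_⟩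
    have := ((hwlim i).sub (hxlim i)).add_const (v₀ i + s)
    simp only [sub_zero, zero_add] at this
    refine this.congr' ?_
    filter_upwards [eventually_ge_atTop 0] with t ht
    simp only [hw, hs t ht]
    ring

/-- Tracking of a convergent reference by one agent under the Nussbaum-type controller. -/
lemma agent_tracking {Nb : ℝ → ℝ} (hNb : Continuous Nb)
    (hsup : ∀ M : ℝ, ∃ᶠ θ in atTop, M < (∫ s in (0:ℝ)..θ, Nb s) / θ)
    (hinf : ∀ M : ℝ, ∃ᶠ θ in atTop, (∫ s in (0:ℝ)..θ, Nb s) / θ < M)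
    {m : ℕ} {c g : ℝ} (hc : 0 < c) (hg : g ≠ 0) {k : ℕ → ℝ}
    (hk : ∀ z : ℂ, (Polynomial.X ^ m + ∑ ι ∈ Finset.Icc 1 m,
      Polynomial.C (k ι : ℂ) * Polynomial.X ^ (ι - 1)).IsRoot z → z.re < 0)
    {e : ℕ → ℝ → ℝ} {th ζ ρ ρ' V V' : ℝ → ℝ}
    (he : ∀ i, i < m → ∀ t, 0 ≤ t → HasDerivAt (e i) (c * e (i + 1) t) t)
    (hem : ∀ t, 0 ≤ t → HasDerivAt (e m) (g * (Nb (th t) * ζ t)) t)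
    (hth : ∀ t, 0 ≤ t → HasDerivAt th (ζ t ^ 2) t)
    (hζ : ∀ t, ζ t = (∑ ι ∈ Finset.Icc 1 m, k ι * e (ι - 1) t) + e m t - ρ t)
    (hρ : ∀ t, 0 ≤ t → HasDerivAt ρ (ρ' t) t) (hρlim : Tendsto ρ atTop (nhds 0))
    (hV0 : ∀ t, 0 ≤ V t) (hV : ∀ t, 0 ≤ t → HasDerivAt V (V' t) t)
    (hVlim : Tendsto V atTop (nhds 0)) (hρV : ∀ t, 0 ≤ t → ρ t ^ 2 + ρ' t ^ 2 ≤ -V' t) :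
    (∃ l, Tendsto th atTop (nhds l)) ∧ ∀ j, j ≤ m → Tendsto (e j) atTop (nhds 0) := by
  obtain ⟨W, W', a, K, B, ha, hK, hB, hW0, hW, hle, hbd⟩ := exists_lyapunov_of_hurwitz hc he hk
  have hs : ∀ t, (∑ ι ∈ Finset.Icc 1 m, k ι * e (ι - 1) t) + e m t = ζ t + ρ t := fun t => by
    rw [hζ]
    ring
  set κ := ∑ ι ∈ Finset.Icc 1 m, k ι ^ 2 with hκ
  have hκ0 : 0 ≤ κ := Finset.sum_nonneg fun i _ => sq_nonneg _
  have hCS : ∀ (f : ℕ → ℝ) (M : ℝ), (∀ ι ∈ Finset.Icc 1 m, f ι ^ 2 ≤ M) →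
      (∑ ι ∈ Finset.Icc 1 m, k ι * f ι) ^ 2 ≤ κ * (m * M) := by
    intro f M hf
    refine (Finset.sum_mul_sq_le_sq_mul_sq _ _ _).trans (mul_le_mul_of_nonneg_left ?_ hκ0)
    simpa using Finset.sum_le_sum hf
  set B₂ := 2 + B + 2 * κ * m * B with hB₂
  have hB₂0 : 0 < B₂ := by positivity
  have hbd₂ : ∀ j, j ≤ m → ∀ t, e j t ^ 2 ≤ B₂ * (W t + (ζ t + ρ t) ^ 2) := by
    intro j hj t
    have hW0 := hW0 t
    have h0 : 0 ≤ κ * m * B * (ζ t + ρ t) ^ 2 := by positivity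
    have h0b : 0 ≤ κ * m * B * W t := by positivity
    have h0c : 0 ≤ B * (ζ t + ρ t) ^ 2 := by positivity
    have h0d : 0 ≤ B * W t := by positivity
    rcases hj.lt_or_eq with hj | rfl
    · have := hbd j hj t
      rw [hB₂]
      nlinarith [sq_nonneg (ζ t + ρ t)]
    · have h1 := hCS (fun ι => e (ι - 1) t) (B * W t) fun ι hι => by
        have := Finset.mem_Icc.mp hι
        exact hbd _ (by omega) t
      have h2 := hs t
      set σ := ∑ ι ∈ Finset.Icc 1 j, k ι * e (ι - 1) t
      have h3 : e j t = (ζ t + ρ t) - σ := by linarith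
      rw [h3, hB₂]
      nlinarith [sq_nonneg ((ζ t + ρ t) + σ)]
  set D : ℝ → ℝ := fun t => ∑ ι ∈ Finset.Icc 1 m, k ι * e ι t with hD
  set C₁ := κ * m * B₂ + 1 with hC₁
  have hC₁0 : 0 < C₁ := by positivity
  have hDle : ∀ t, D t ^ 2 ≤ C₁ * (W t + (ζ t + ρ t) ^ 2) := by
    intro t
    have h1 := hCS (fun ι => e ι t) _ fun ι hι => hbd₂ ι (Finset.mem_Icc.mp hι).2 t
    have h2 : 0 ≤ W t + (ζ t + ρ t) ^ 2 := add_nonneg (hW0 t) (sq_nonneg _)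
    simp only [hD, hC₁]
    linarith
  have hζd : ∀ t, 0 ≤ t → HasDerivAt ζ (c * D t + g * (Nb (th t) * ζ t) - ρ' t) t := by
    intro t ht
    have h1 : HasDerivAt (fun t => ∑ ι ∈ Finset.Icc 1 m, k ι * e (ι - 1) t) (c * D t) t := by
      refine (HasDerivAt.fun_sum (u := Finset.Icc 1 m)
        (A' := fun ι => k ι * (c * e ι t)) fun ι hι => ?_).congr_deriv ?_
      · have hι := Finset.mem_Icc.mp hι
        have := he (ι - 1) (by omega) t ht
        rw [Nat.sub_add_cancel hι.1] at this
        exact this.const_mul _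
      · rw [hD, Finset.mul_sum]
        exact Finset.sum_congr rfl fun ι _ => by ring
    exact ((h1.add (hem t ht)).sub (hρ t ht)).congr_of_eventuallyEq (Eventually.of_forall hζ)
  set γ := C₁ / a with hγ
  have hγ0 : 0 < γ := by positivity
  have hγa : γ * a = C₁ := div_mul_cancel₀ _ ha.ne'
  set U : ℝ → ℝ := fun t => ζ t ^ 2 / 2 + γ * W t with hU
  set U' : ℝ → ℝ := fun t => ζ t * (c * D t + g * (Nb (th t) * ζ t) - ρ' t) + γ * W' t with hU'
  have hU0 : ∀ t, 0 ≤ U t := fun t => add_nonneg (by positivity) (mul_nonneg hγ0.le (hW0 t))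
  have hUd : ∀ t, 0 ≤ t → HasDerivAt U (U' t) t := by
    intro t ht
    refine ((((hζd t ht).pow 2).div_const 2).add ((hW t ht).const_mul γ)).congr_deriv ?_
    simp only [hU', Nat.cast_ofNat, Nat.add_one_sub_one, pow_one]
    ring
  set L := c ^ 2 + 1 + C₁ + 2 * γ * K with hL
  have hL0 : 0 < L := by positivity
  have hUle : ∀ t, 0 ≤ t →
      U' t ≤ g * Nb (th t) * ζ t ^ 2 - C₁ / 2 * W t + L * ζ t ^ 2 - L * V' t := by
    intro t ht
    have h1 : ζ t * (c * D t) ≤ c ^ 2 * ζ t ^ 2 / 2 + D t ^ 2 / 2 := by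
      linarith [sq_nonneg (c * ζ t - D t)]
    have h2 : -(ζ t * ρ' t) ≤ ζ t ^ 2 / 2 + ρ' t ^ 2 / 2 := by
      linarith [sq_nonneg (ζ t + ρ' t)]
    have h3 := hDle t
    have h4 := hle t ht
    rw [hs] at h4
    have h5 := mul_le_mul_of_nonneg_left h4 hγ0.le
    have h6 : γ * (-a * W t + K * (ζ t + ρ t) ^ 2)
        = -C₁ * W t + γ * K * (ζ t + ρ t) ^ 2 := by
      rw [← hγa]
      ring
    have h7 : (C₁ / 2 + γ * K) * (ζ t + ρ t) ^ 2
        ≤ (C₁ / 2 + γ * K) * (2 * ζ t ^ 2 + 2 * ρ t ^ 2) :=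
      mul_le_mul_of_nonneg_left (by linarith [sq_nonneg (ζ t - ρ t)]) (by positivity)
    have h8 : L * (ρ t ^ 2 + ρ' t ^ 2) ≤ L * -V' t := mul_le_mul_of_nonneg_left (hρV t ht) hL0.le
    have h9 : 0 ≤ c ^ 2 * ζ t ^ 2 := by positivity
    have h10 : 0 ≤ c ^ 2 * ρ t ^ 2 := by positivity
    have h11 : 0 ≤ (c ^ 2 + C₁ + 2 * γ * K) * ρ' t ^ 2 := by positivity
    have h12 := sq_nonneg (ζ t)
    have h13 := sq_nonneg (ρ t)
    have h14 := sq_nonneg (ρ' t)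
    have h15 : U' t = ζ t * (c * D t) + g * Nb (th t) * ζ t ^ 2 + -(ζ t * ρ' t) + γ * W' t := by
      simp only [hU']
      ring
    rw [h15]
    simp only [hL] at h8 ⊢
    linarith
  have hthm : MonotoneOn th (Set.Ici 0) :=
    monotoneOn_of_hasDerivWithinAt_nonneg (f' := fun t => ζ t ^ 2) (convex_Ici 0)
      (fun t ht => (hth t ht).continuousAt.continuousWithinAt)
      (fun t ht => (hth t (interior_subset ht)).hasDerivWithinAt) (fun t _ => sq_nonneg _)
  have hF : ∀ x, HasDerivAt (fun x => ∫ s in (0:ℝ)..x, Nb s) (Nb x) x := fun x =>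
    intervalIntegral.integral_hasDerivAt_right (hNb.intervalIntegrable _ _)
      (hNb.stronglyMeasurableAtFilter _ _) hNb.continuousAt
  set Φ : ℝ → ℝ := fun t => U t - g * (∫ s in (0:ℝ)..(th t), Nb s) - L * th t + L * V t with hΦ
  have hΦanti : AntitoneOn Φ (Set.Ici 0) := by
    refine antitoneOn_Ici_of_hasDerivAt_nonpos
      (f' := fun t => U' t - g * (Nb (th t) * ζ t ^ 2) - L * ζ t ^ 2 + L * V' t)
      (fun t ht => ?_) (fun t ht => ?_)
    · exact (((hUd t ht).sub (((hF (th t)).comp t (hth t ht)).const_mul g)).sub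
        ((hth t ht).const_mul L)).add ((hV t ht).const_mul L)
    · have h1 := hUle t ht
      have h2 : 0 ≤ C₁ / 2 * W t := mul_nonneg (by positivity) (hW0 t)
      linarith
  obtain ⟨M, hM⟩ := bounded_of_nussbaum_s14 hsup hinf (th := th) (g := g) (K := L) (P := Φ 0)
    (fun t ht => (hth t ht).continuousAt.continuousWithinAt) hg (fun t ht => by
      have h1 := hΦanti (Set.mem_Ici.mpr le_rfl) (Set.mem_Ici.mpr ht) ht
      have h2 := hU0 t
      have h3 := mul_nonneg hL0.le (hV0 t)
      simp only [hΦ] at h1 ⊢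
      linarith)
  obtain ⟨l, hl⟩ := exists_tendsto_of_monotoneOn_Ici hthm hM
  obtain ⟨R, hR⟩ := (isCompact_Icc (a := th 0) (b := M)).exists_bound_of_continuousOn
    hNb.continuousOn
  set J := |g| * R + L + a / 4 with hJ
  have hUlim : Tendsto U atTop (nhds 0) := by
    refine tendsto_zero_of_deriv_le (c := a / 2) (G := fun t => J * th t - L * V t)
      (G' := fun t => J * ζ t ^ 2 - L * V' t) (by positivity) (fun t _ => hU0 t) hUd
      (fun t ht => ((hth t ht).const_mul J).sub ((hV t ht).const_mul L))
      ((hl.const_mul J).sub (hVlim.const_mul L)) fun t ht => ?_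
    have h1 := hUle t ht
    have h2 : |Nb (th t)| ≤ R := hR _ ⟨hthm (Set.mem_Ici.mpr le_rfl) ht ht, hM t ht⟩
    have h3 : g * Nb (th t) ≤ |g| * R := by
      refine (le_abs_self _).trans ?_
      rw [abs_mul]
      exact mul_le_mul_of_nonneg_left h2 (abs_nonneg g)
    have h4 := mul_le_mul_of_nonneg_right h3 (sq_nonneg (ζ t))
    have h5 : C₁ / 2 * W t = a / 2 * (U t - ζ t ^ 2 / 2) := by
      rw [← hγa]
      simp only [hU]
      ring
    rw [h5] at h1
    simp only [hJ]
    linarith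
  have hWlim : Tendsto W atTop (nhds 0) := by
    refine squeeze_zero hW0 (fun t => ?_) (by simpa using hUlim.div_const γ)
    rw [le_div_iff₀ hγ0]
    simp only [hU]
    linarith [sq_nonneg (ζ t)]
  have habs : ∀ f : ℝ → ℝ, Tendsto (fun t => f t ^ 2) atTop (nhds 0) →
      Tendsto f atTop (nhds 0) := by
    intro f hf
    have h2 := hf.sqrt
    simp only [Real.sqrt_sq_eq_abs, Real.sqrt_zero] at h2
    exact (tendsto_zero_iff_abs_tendsto_zero f).mpr h2
  have hζlim : Tendsto ζ atTop (nhds 0) := by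
    refine habs _ (squeeze_zero (fun t => sq_nonneg _) (fun t => ?_)
      (by simpa using hUlim.const_mul 2))
    simp only [hU]
    linarith [mul_nonneg hγ0.le (hW0 t)]
  refine ⟨⟨l, hl⟩, fun j hj => habs _ (squeeze_zero (fun t => sq_nonneg _) (hbd₂ j hj) ?_)⟩
  simpa using (hWlim.add ((hζlim.add hρlim).pow 2)).const_mul B₂

/-- Average consensus via the optimal consensus controller: choosing the local
costs `f_i(y) = (y − y_i(0))²` (so `f_i'(x) = 2(x − y_i(0))`), there exist
`α, β > 0` such that for any `ε > 0`, along any closed-loop trajectory of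
`u_i = N̄(θ_i)ζ_i`, `θ̇_i = ζ_i²`,
`ṙ_i = −αf_i'(r_i) − βΣ_j a_{ij}(r_i−r_j) − Σ_j a_{ij}(v_i−v_j)`,
`v̇_i = αβΣ_j a_{ij}(r_i−r_j)`, all states are bounded on `[0,∞)` and every agent
output achieves average consensus: `y_i(t) → (1/N)Σ_j y_j(0)` for every `i`. -/
theorem average_consensus_unknown_control_directions
    (N : ℕ) (hN : 2 ≤ N)
    (A : Fin N → Fin N → ℝ)
    (hAdiag : ∀ i, A i i = 0) (hAnn : ∀ i j, 0 ≤ A i j)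
    (hbal : ∀ i, ∑ j, A i j = ∑ j, A j i)
    (hconn : ∀ i j : Fin N, i ≠ j →
      Relation.TransGen (fun p q : Fin N => 0 < A q p) i j)
    -- agent orders and unknown high-frequency gains
    (n : Fin N → ℕ) (hn : ∀ i, 1 ≤ n i)
    (b : Fin N → ℝ) (hb : ∀ i, b i ≠ 0)
    -- a smooth Nussbaum function
    (Nb : ℝ → ℝ) (hNbsmooth : ContDiff ℝ (⊤ : ℕ∞) Nb)
    (hNbsup : ∀ M : ℝ, ∃ᶠ θ in atTop, M < (∫ s in (0:ℝ)..θ, Nb s) / θ)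
    (hNbinf : ∀ M : ℝ, ∃ᶠ θ in atTop, (∫ s in (0:ℝ)..θ, Nb s) / θ < M)
    -- Hurwitz coefficients
    (k : Fin N → ℕ → ℝ)
    (hHurwitz : ∀ i, ∀ z : ℂ,
      (Polynomial.X ^ (n i - 1) + ∑ ι ∈ Finset.Icc 1 (n i - 1),
        Polynomial.C ((k i ι : ℂ)) * Polynomial.X ^ (ι - 1)).IsRoot z → z.re < 0) :
    ∃ α β : ℝ, 0 < α ∧ 0 < β ∧
      ∀ ε : ℝ, 0 < ε →
      ∀ (y u th : Fin N → ℝ → ℝ) (r v : Fin N → ℝ → ℝ) (ζ : Fin N → ℝ → ℝ),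
        (∀ i, ContDiff ℝ (n i : ℕ∞) (y i)) →
        -- definition of ζ_i
        (∀ i t, ζ i t =
          (∑ ι ∈ Finset.Icc 1 (n i - 1), k i ι *
            (if ι = 1 then y i t - r i t
             else ε ^ (ι - 1) * iteratedDeriv (ι - 1) (y i) t))
          + (if n i = 1 then y i t - r i t
             else ε ^ (n i - 1) * iteratedDeriv (n i - 1) (y i) t)) →
        -- the distributed controller
        (∀ i t, u i t = Nb (th i t) * ζ i t) →
        (∀ i t, 0 ≤ t → HasDerivAt (th i) ((ζ i t) ^ 2) t) →
        -- agent dynamics y_i^{(n_i)} = b_i u_i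
        (∀ i t, 0 ≤ t →
          HasDerivAt (iteratedDeriv (n i - 1) (y i)) (b i * u i t) t) →
        -- optimal signal generator for f_i(x) = (x − y_i(0))², f_i'(x) = 2(x − y_i(0))
        (∀ i t, 0 ≤ t → HasDerivAt (r i)
          (-α * (2 * (r i t - y i 0)) - β * (∑ j, A i j * (r i t - r j t))
            - ∑ j, A i j * (v i t - v j t)) t) →
        (∀ i t, 0 ≤ t → HasDerivAt (v i)
          (α * β * ∑ j, A i j * (r i t - r j t)) t) →
        -- boundedness of the closed-loop trajectory and average consensus
        (∃ B : ℝ, ∀ t, 0 ≤ t → ∀ i,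
          (∀ ι, ι ≤ n i - 1 → |iteratedDeriv ι (y i) t| ≤ B) ∧
          |th i t| ≤ B ∧ |r i t| ≤ B ∧ |v i t| ≤ B) ∧
        (∀ i, Tendsto (fun t => y i t) atTop (nhds ((∑ j, y j 0) / N))) := by
  have : Nonempty (Fin N) := ⟨⟨0, by omega⟩⟩
  obtain ⟨β, hβ, hgen⟩ := exists_signal_generator_gain hAnn hbal hconn
  refine ⟨1, β, one_pos, hβ, fun ε hε y u th r v ζ hy hζ hu hth hyn hr hv => ?_⟩
  obtain ⟨V, V', C, hC, hV0, hV, hVlim, hCV, hrlim, hvlim⟩ := hgen (fun i => y i 0) r v _ hr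
    (fun i t _ => by rw [neg_one_mul]; rfl)
    (fun i t ht => by have := hv i t ht; rwa [one_mul] at this)
  rw [Fintype.card_fin] at hrlim hCV
  set avg := (∑ j, y j 0) / (N : ℝ) with havg
  set e : Fin N → ℕ → ℝ → ℝ := fun i j t =>
    ε ^ j * iteratedDeriv j (y i) t - if j = 0 then avg else 0 with he
  have key : ∀ i, (∃ l, Tendsto (th i) atTop (nhds l)) ∧
      ∀ j, j ≤ n i - 1 → Tendsto (e i j) atTop (nhds 0) := by
    intro i
    set κ : ℝ := (∑ ι ∈ Finset.Icc 1 (n i - 1), k i ι * if ι = 1 then 1 else 0)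
      + if n i = 1 then 1 else 0 with hκ
    refine agent_tracking (c := 1 / ε) (g := ε ^ (n i - 1) * b i) (ρ := fun t => κ * (r i t - avg))
      (V := fun t => κ ^ 2 * C * V t) (V' := fun t => κ ^ 2 * C * V' t)
      hNbsmooth.continuous hNbsup hNbinf (by positivity)
      (mul_ne_zero (by positivity) (hb i)) (hHurwitz i) (fun j hj t _ => ?_) (fun t ht => ?_)
      (hth i) (fun t => ?_) (fun t ht => ((hr i t ht).sub_const avg).const_mul κ) ?_
      (fun t => by have := hV0 t; positivity) (fun t ht => (hV t ht).const_mul _)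
      (by simpa using hVlim.const_mul (κ ^ 2 * C)) (fun t ht => ?_)
    · have h1 : HasDerivAt (iteratedDeriv j (y i)) (iteratedDeriv (j + 1) (y i) t) t := by
        rw [iteratedDeriv_succ]
        exact ((hy i).differentiable_iteratedDeriv j (by exact_mod_cast (by omega))
          t).hasDerivAt
      refine ((h1.const_mul (ε ^ j)).sub_const _).congr_deriv ?_
      simp only [he, if_neg (Nat.succ_ne_zero j)]
      field_simp
      ring
    · refine (((hyn i t ht).const_mul (ε ^ (n i - 1))).sub_const _).congr_deriv ?_
      rw [hu]
      ring
    · have h1 : ∀ ι, 1 ≤ ι → (if ι = 1 then y i t - r i t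
          else ε ^ (ι - 1) * iteratedDeriv (ι - 1) (y i) t)
          = e i (ι - 1) t - (if ι = 1 then 1 else 0) * (r i t - avg) := by
        intro ι hι
        rcases hι.eq_or_lt with rfl | hι
        · simp [he]
        · simp [he, hι.ne', show ι - 1 ≠ 0 by omega]
      rw [hζ, h1 (n i) (hn i), Finset.sum_congr rfl fun ι hι => by
        rw [h1 ι (Finset.mem_Icc.mp hι).1, mul_sub, ← mul_assoc]]
      rw [Finset.sum_sub_distrib, ← Finset.sum_mul, hκ]
      ring
    · simpa using ((hrlim i).sub_const avg).const_mul κ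
    · have := mul_le_mul_of_nonneg_left (hCV i t ht) (sq_nonneg κ)
      rw [mul_pow, mul_pow]
      linarith
  have hder : ∀ i j, j ≤ n i - 1 →
      Tendsto (iteratedDeriv j (y i)) atTop (nhds ((if j = 0 then avg else 0) / ε ^ j)) := by
    intro i j hj
    have := (((key i).2 j hj).add_const (if j = 0 then avg else 0)).div_const (ε ^ j)
    rw [zero_add] at this
    refine this.congr fun t => ?_
    simp only [he, sub_add_cancel]
    rw [mul_div_cancel_left₀ _ (by positivity)]
  refine ⟨Eventually.exists (f := atTop) (p := fun B : ℝ => ∀ t, 0 ≤ t → ∀ i,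
          (∀ ι, ι ≤ n i - 1 → |iteratedDeriv ι (y i) t| ≤ B) ∧
          |th i t| ≤ B ∧ |r i t| ≤ B ∧ |v i t| ≤ B) ?_, fun i => ?_⟩
  · have h1 : ∀ᶠ B in atTop, ∀ i, ∀ ι ∈ Finset.range (n i - 1 + 1), ∀ t, 0 ≤ t →
        |iteratedDeriv ι (y i) t| ≤ B := by
      refine eventually_all.2 fun i => (eventually_all_finset _).2 fun ι hι => ?_
      have hι := Finset.mem_range_succ_iff.mp hι
      have := hn i
      exact eventually_abs_le_of_tendsto (fun t _ => ((hy i).continuous_iteratedDeriv ι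
        (by exact_mod_cast (by omega))).continuousAt) (hder i ι hι)
    have h2 : ∀ᶠ B in atTop, ∀ i, ∀ t, 0 ≤ t → |th i t| ≤ B := eventually_all.2 fun i => by
      obtain ⟨l, hl⟩ := (key i).1
      exact eventually_abs_le_of_tendsto (fun t ht => (hth i t ht).continuousAt) hl
    have h3 : ∀ᶠ B in atTop, ∀ i, ∀ t, 0 ≤ t → |r i t| ≤ B := eventually_all.2 fun i =>
      eventually_abs_le_of_tendsto (fun t ht => (hr i t ht).continuousAt) (hrlim i)
    have h4 : ∀ᶠ B in atTop, ∀ i, ∀ t, 0 ≤ t → |v i t| ≤ B := eventually_all.2 fun i => by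
      obtain ⟨l, hl⟩ := hvlim i
      exact eventually_abs_le_of_tendsto (fun t ht => (hv i t ht).continuousAt) hl
    filter_upwards [h1, h2, h3, h4] with B h1 h2 h3 h4 t ht i
    exact ⟨fun ι hι => h1 i ι (Finset.mem_range_succ_iff.mpr hι) t ht,
      h2 i t ht, h3 i t ht, h4 i t ht⟩
  · simpa using hder i 0 (Nat.zero_le _)
end
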